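/- Assume α and β are locally integrable and γ-periodic, and that (−1)^m·β(t) ≥ (−1)^m·β_0 > 0 for almost every t ∈ ℝ, for some integer m and constant β_0. Then: (i) the set of Floquet multipliers, counted with algebraic multiplicity, is countably infinite; (ii) if (λ_k)_{k≥1} is an ordered enumeration of the Floquet multipliers, then |λ_k| > |λ_{k+1}| whenever k − m is even; (iii) for every k ≥ 2 with k − m even, the product λ_{k−1}·λ_k is real and strictly positive, and every nonzero function φ ∈ Re(⊕_{|λ|=|λ_{k−1}|} G_λ) and every nonzero function φ ∈ Re(⊕_{|λ|=|λ_k|} G_λ) satisfies V^±(φ) = k − 1, where V^± denotes V^− if m is even and V^+ if m is odd, and Re(S) = {Re ψ : ψ ∈ S} ⊆ C([−1,0],ℝ); (iv) if m is odd then λ_1 is real and strictly positive, and every nonzero function φ ∈ Re(⊕_{|λ|=|λ_1|} G_λ) satisfies V^+(φ) = 0. -/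

import Mathlib

open MeasureTheory

noncomputable section

abbrev I01 : Set ℝ := Set.Icc (-1 : ℝ) 0

abbrev CC := C(I01, ℂ)

/-- A complex-valued solution of `x'(t) = -α(t) x(t) - β(t) x(t-1)` on `[τ-1, T]`. -/
def IsSolutionC (a c : ℝ → ℝ) (τ T : ℝ) (x : ℝ → ℂ) : Prop :=
  ContinuousOn x (Set.Icc (τ - 1) T) ∧
  ∀ t ∈ Set.Icc τ T, x t = x τ - ∫ s in τ..t, ((a s : ℂ) * x s + (c s : ℂ) * x (s - 1))

/-- `M` is the monodromy operator of the `γ`-periodic delay equation. -/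
def IsMonodromy (a c : ℝ → ℝ) (γ : ℝ) (M : CC →L[ℂ] CC) : Prop :=
  ∀ (φ : CC) (x : ℝ → ℂ), IsSolutionC a c 0 γ x →
    (∀ θ : I01, x (θ : ℝ) = φ θ) → ∀ θ : I01, M φ θ = x (γ + (θ : ℝ))

/-- A Floquet multiplier: a nonzero eigenvalue of the monodromy operator. -/
def IsFloquetMult (M : CC →L[ℂ] CC) (μ : ℂ) : Prop :=
  μ ≠ 0 ∧ ∃ φ : CC, φ ≠ 0 ∧ M φ = μ • φ

/-- The generalized eigenspace `G_μ = ⋃ₙ ker (M - μ I)^n`. -/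
def genEig (M : CC →L[ℂ] CC) (μ : ℂ) : Submodule ℂ CC :=
  ⨆ n : ℕ, LinearMap.ker ((M - μ • (1 : CC →L[ℂ] CC)) ^ n : CC →L[ℂ] CC).toLinearMap

/-- The algebraic multiplicity of `μ`. -/
def algMult (M : CC →L[ℂ] CC) (μ : ℂ) : ℕ :=
  Module.finrank ℂ (genEig M μ)

/-- An ordered enumeration `(Λ k)_{k ≥ 1}` of the Floquet multipliers,
with repetitions according to algebraic multiplicity. -/
def IsOrderedEnum (M : CC →L[ℂ] CC) (Λ : ℕ → ℂ) : Prop :=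
  (∀ k : ℕ, 1 ≤ k → ‖Λ (k + 1)‖ ≤ ‖Λ k‖) ∧
  (∀ k : ℕ, 1 ≤ k → IsFloquetMult M (Λ k)) ∧
  (∀ μ : ℂ, IsFloquetMult M μ → Nat.card {k : ℕ | 1 ≤ k ∧ Λ k = μ} = algMult M μ)

/-- The real part of the span of the generalized eigenspaces of all Floquet
multipliers of absolute value `ρ`; `calg_ρ` in the paper is `{re ∘ ψ | ψ ∈ GabsSpan M ρ}`. -/
def GabsSpan (M : CC →L[ℂ] CC) (ρ : ℝ) : Submodule ℂ CC :=
  ⨆ μ ∈ {μ : ℂ | IsFloquetMult M μ ∧ ‖μ‖ = ρ}, genEig M μ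

/-- There exist `-1 < θ₀ < θ₁ < ⋯ < θ_k < 0` with `φ(θ_{i-1}) φ(θ_i) < 0`. -/
def SignChangeWitness (φ : I01 → ℝ) (k : ℕ) : Prop :=
  ∃ θ : Fin (k + 1) → I01, (StrictMono fun i => (θ i : ℝ)) ∧
    (-1 : ℝ) < (θ 0 : ℝ) ∧ ((θ (Fin.last k) : ℝ) < 0) ∧
    ∀ i : Fin k, φ (θ i.castSucc) * φ (θ i.succ) < 0

/-- The number of sign changes `sc(φ) ∈ {0,1,…,∞}`. -/
def sc (φ : I01 → ℝ) : ℕ∞ :=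
  sSup {n : ℕ∞ | ∃ k : ℕ, 1 ≤ k ∧ SignChangeWitness φ k ∧ n = (k : ℕ∞)}

open Classical in
/-- `Vpm 1 = V⁻` (values in odd numbers) and `Vpm 0 = V⁺` (values in even numbers):
`Vpm p φ = sc φ` if `sc φ` is infinite or has parity `p`, and `sc φ + 1` otherwise. -/
def Vpm (par : ℕ) (φ : I01 → ℝ) : ℕ∞ :=
  if ∃ n : ℕ, sc φ = (n : ℕ∞) ∧ n % 2 ≠ par then sc φ + 1 else sc φ

/-- A locally integrable delayed coefficient `b` whose sign `δ = ±1` is fixed and which is bounded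
away from zero. -/
structure Feedback (b : ℝ → ℝ) (δ c₀ : ℝ) : Prop where
  int : LocallyIntegrable b volume
  pos : 0 < c₀
  sq : δ * δ = 1
  ge : ∀ᵐ t ∂volume, c₀ ≤ δ * b t

/-- Solutions of `y'(t) = b(t) y(t-1)` on `[0, ∞)`. -/
structure DelaySol (b y : ℝ → ℝ) : Prop where
  cont : Continuous y
  eq : ∀ s t, 0 ≤ s → s ≤ t → y t - y s = ∫ u in s..t, b u * y (u - 1)

theorem MeasureTheory.LocallyIntegrable.intervalIntegrable' {b : ℝ → ℝ}
    (hb : LocallyIntegrable b volume) (s t : ℝ) : IntervalIntegrable b volume s t :=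
  (hb.integrableOn_isCompact isCompact_uIcc).intervalIntegrable

section Config

variable {b f g : ℝ → ℝ} {δ c₀ : ℝ}

theorem Feedback.integrand (hb : LocallyIntegrable b volume) (hf : Continuous f) (s t : ℝ) :
    IntervalIntegrable (fun u => b u * f (u - 1)) volume s t :=
  (hb.intervalIntegrable' s t).mul_continuousOn (by fun_prop)

theorem Feedback.growth (hb : Feedback b δ c₀) (hf : DelaySol b f) {s t ς v : ℝ} (hs : 0 ≤ s)
    (hst : s ≤ t) (hv : 0 ≤ v) (h : ∀ r ∈ Set.Ioo s t, v ≤ ς * f (r - 1)) :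
    c₀ * v * (t - s) ≤ δ * ς * (f t - f s) := by
  rw [hf.eq s t hs hst, ← intervalIntegral.integral_const_mul]
  have : c₀ * v * (t - s) = ∫ _ in s..t, c₀ * v := by
    rw [intervalIntegral.integral_const, smul_eq_mul]; ring
  rw [this]
  apply intervalIntegral.integral_mono_ae_restrict hst intervalIntegrable_const
    ((Feedback.integrand hb.int hf.cont s t).const_mul _)
  rw [Filter.EventuallyLE, ae_restrict_iff' measurableSet_Icc]
  filter_upwards [hb.ge, Measure.ae_ne volume s, Measure.ae_ne volume t] with u hu h1 h2 h3
  have h4 := h u ⟨lt_of_le_of_ne h3.1 (Ne.symm h1), lt_of_le_of_ne h3.2 h2⟩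
  nlinarith [mul_le_mul hu h4 hv (hb.pos.le.trans hu)]

theorem Feedback.exists_delayed (hb : Feedback b δ c₀) (hf : DelaySol b f) {s t ς : ℝ}
    (hs : 0 ≤ s) (hst : s < t) (h : 0 < ς * (f t - f s)) :
    ∃ r ∈ Set.Ioo s t, 0 < δ * ς * f (r - 1) := by
  by_contra! hc
  have := hb.growth hf (ς := -(δ * ς)) (v := 0) hs hst.le le_rfl
    (fun r hr => by linarith [hc r hr])
  have h2 := hb.sq
  have : 0 ≤ -(δ * δ) * (ς * (f t - f s)) := by linarith
  rw [h2] at this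
  linarith

/-- If a solution vanishes on a window, it vanishes on all earlier windows. -/
theorem Feedback.zero_pred (hb : Feedback b δ c₀) (hf : DelaySol b f) {s t : ℝ}
    (hs : 0 ≤ s) (hst : s < t) (h : ∀ x ∈ Set.Icc s t, f x = 0) :
    ∀ x ∈ Set.Icc (s - 1) (t - 1), f x = 0 := by
  have key : ∀ x ∈ Set.Ioo (s - 1) (t - 1), f x = 0 := by
    intro x hx
    by_contra hne
    have hpos : 0 < (f x / 2) * f x - (f x / 2) * (f x / 2) := by
      have : 0 < f x ^ 2 := by positivity
      nlinarith
    have hcont : ContinuousAt (fun z => (f x / 2) * f z - (f x / 2) * (f x / 2)) x := by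
      have := hf.cont
      fun_prop
    have hev := hcont.eventually (lt_mem_nhds hpos)
    have hev2 := hev.and (Ioo_mem_nhds hx.1 hx.2)
    obtain ⟨e, he, hball⟩ := Metric.eventually_nhds_iff.1 hev2
    have hin : ∀ z, |z - x| < e → 0 < (f x / 2) * f z - (f x / 2) * (f x / 2) ∧
        z ∈ Set.Ioo (s - 1) (t - 1) := fun z hz => hball (by rwa [Real.dist_eq])
    have h1 := (hin (x - e / 2) (by rw [abs_lt]; constructor <;> linarith)).2
    have h2 := (hin (x + e / 2) (by rw [abs_lt]; constructor <;> linarith)).2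
    have := hb.growth hf (s := x + 1 - e / 2) (t := x + 1 + e / 2) (ς := f x / 2)
      (v := (f x / 2) * (f x / 2)) (by linarith [h1.1]) (by linarith)
        (by nlinarith [sq_nonneg (f x)])
      (fun r hr => by
        have := (hin (r - 1) (by rw [abs_lt]; constructor <;> linarith [hr.1, hr.2])).1
        linarith)
    have e1 := h (x + 1 + e / 2) ⟨by linarith [h2.1, h1.1], by linarith [h2.2]⟩
    have e2 := h (x + 1 - e / 2) ⟨by linarith [h1.1], by linarith [h1.2, h2.2]⟩
    rw [e1, e2] at this
    have h5 : 0 < c₀ * (f x / 2 * (f x / 2)) * (x + 1 + e / 2 - (x + 1 - e / 2)) := by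
      have := hb.pos
      have h6 : 0 < f x / 2 * (f x / 2) := by
        have : 0 < f x ^ 2 := by positivity
        nlinarith
      apply mul_pos (mul_pos this h6); linarith
    linarith
  have hcl : Set.EqOn f (fun _ => 0) (closure (Set.Ioo (s - 1) (t - 1))) :=
    Set.EqOn.closure (fun x hx => key x hx) hf.cont continuous_const
  rw [closure_Ioo (by linarith)] at hcl
  exact hcl

theorem Feedback.zero_backward (hb : Feedback b δ c₀) (hf : DelaySol b f) {τ t : ℝ} (hτ : 0 ≤ τ)
    (ht : τ ≤ t) (h : ∀ x ∈ Set.Icc (t - 1) t, f x = 0) :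
    ∀ x ∈ Set.Icc (τ - 1) τ, f x = 0 := by
  have key : ∀ n : ℕ, ∀ x ∈ Set.Icc (max (t - 1 - n) (τ - 1)) t, f x = 0 := by
    intro n
    induction n with
    | zero =>
      intro x hx
      refine h x ⟨?_, hx.2⟩
      have := le_max_left (t - 1 - (0 : ℕ)) (τ - 1)
      have := hx.1
      push_cast at *
      linarith
    | succ n ih =>
      intro x hx
      set a := max (t - 1 - n) (τ - 1) with ha
      by_cases hxa : a ≤ x
      · exact ih x ⟨hxa, hx.2⟩
      push Not at hxa
      have hx1 : τ - 1 ≤ x := le_trans (le_max_right _ _) hx.1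
      have hx2 : t - 1 - (n + 1) ≤ x := by
        have := le_trans (le_max_left _ _) hx.1
        push_cast at this; linarith
      rcases eq_or_lt_of_le ht with rfl | hlt
      · exact h x ⟨hx1, hx.2⟩
      have hat : a ≤ t - 1 := by
        rw [ha]; apply max_le <;> linarith [(Nat.cast_nonneg n : (0 : ℝ) ≤ n)]
      have := hb.zero_pred hf (s := max a τ) (t := t) (le_trans hτ (le_max_right _ _))
        (max_lt (by linarith) hlt)
        (fun z hz => ih z ⟨le_trans (le_max_left _ _) hz.1, hz.2⟩)
      refine this x ⟨?_, by linarith⟩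
      rcases max_choice a τ with h' | h' <;> rw [h']
      · rcases max_choice (t - 1 - n) (τ - 1) with h'' | h'' <;> rw [h''] at ha <;> linarith
      · linarith
  obtain ⟨n, hn⟩ := exists_nat_ge (t - τ)
  intro x hx
  refine key n x ⟨?_, by linarith [hx.2]⟩
  rw [max_le_iff]
  exact ⟨by linarith [hx.1], hx.1⟩

end Config

/-- `p 0 < ⋯ < p (n-1)` are points where the signs of `f` alternate, starting with the
sign of `σ`. -/
structure AltPts (f : ℝ → ℝ) (n : ℕ) (σ : ℝ) (p : ℕ → ℝ) : Prop where
  lt : ∀ i, i + 1 < n → p i < p (i + 1)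
  sign : ∀ i < n, 0 < σ * (-1) ^ i * f (p i)

/-- `f` alternates `n` times on the window `[t-1, t]`. -/
def Alt (f : ℝ → ℝ) (n : ℕ) (t : ℝ) : Prop :=
  ∃ σ p, AltPts f n σ p ∧ ∀ i < n, p i ∈ Set.Icc (t - 1) t

section Config

variable {b f g : ℝ → ℝ} {δ c₀ : ℝ}

theorem AltPts.le {n : ℕ} {σ : ℝ} {p : ℕ → ℝ} (h : AltPts f n σ p) {i j : ℕ} (hij : i ≤ j)
    (hj : j < n) : p i ≤ p j := by
  induction j, hij using Nat.le_induction with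
  | base => exact le_rfl
  | succ k hk ih => exact (ih (by omega)).trans (h.lt k hj).le

theorem AltPts.lt' {n : ℕ} {σ : ℝ} {p : ℕ → ℝ} (h : AltPts f n σ p) {i j : ℕ} (hij : i < j)
    (hj : j < n) : p i < p j :=
  (h.lt i (by omega)).trans_le (h.le hij hj)

theorem AltPts.mono {n k : ℕ} {σ : ℝ} {p : ℕ → ℝ} (h : AltPts f n σ p) (hk : k ≤ n) :
    AltPts f k σ p :=
  ⟨fun i hi => h.lt i (by omega), fun i hi => h.sign i (by omega)⟩

theorem Alt.mono {n k : ℕ} {t : ℝ} (h : Alt f n t) (hk : k ≤ n) : Alt f k t := by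
  obtain ⟨σ, p, hp, hw⟩ := h
  exact ⟨σ, p, hp.mono hk, fun i hi => hw i (by omega)⟩

theorem alt_zero (f : ℝ → ℝ) (t : ℝ) : Alt f 0 t :=
  ⟨1, fun _ => 0, ⟨fun i hi => by omega, fun i hi => by omega⟩, fun i hi => by omega⟩

theorem alt_one_iff {t : ℝ} : Alt f 1 t ↔ ∃ x ∈ Set.Icc (t - 1) t, f x ≠ 0 := by
  constructor
  · rintro ⟨σ, p, hp, hw⟩
    refine ⟨p 0, hw 0 one_pos, fun h => ?_⟩
    have := hp.sign 0 one_pos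
    simp [h] at this
  · rintro ⟨x, hx, hne⟩
    refine ⟨f x, fun _ => x, ⟨fun i hi => by omega, fun i hi => ?_⟩, fun i hi => hx⟩
    have : i = 0 := by omega
    subst this
    have : 0 < f x ^ 2 := by positivity
    simpa [sq] using this

/-- Prepending a point. -/
def consPt (r : ℝ) (p : ℕ → ℝ) : ℕ → ℝ := fun i => if i = 0 then r else p (i - 1)

@[simp] theorem consPt_zero (r : ℝ) (p : ℕ → ℝ) : consPt r p 0 = r := rfl

@[simp] theorem consPt_succ (r : ℝ) (p : ℕ → ℝ) (i : ℕ) : consPt r p (i + 1) = p i := by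
  simp [consPt]

theorem AltPts.cons {n : ℕ} {σ r : ℝ} {p : ℕ → ℝ} (h : AltPts f n σ p) (hr : 0 < n → r < p 0)
    (hs : 0 < -σ * f r) : AltPts f (n + 1) (-σ) (consPt r p) := by
  constructor
  · intro i hi
    rcases i with _ | i
    · simpa using hr (by omega)
    · simpa using h.lt i (by omega)
  · intro i hi
    rcases i with _ | i
    · simpa using hs
    · have := h.sign i (by omega)
      rw [consPt_succ, pow_succ]
      linarith

theorem AltPts.update_last {k : ℕ} {σ r : ℝ} {p : ℕ → ℝ} (h : AltPts f k σ p)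
    (hr : 0 < k → p (k - 1) < r) (hs : 0 < σ * (-1) ^ k * f r) :
    AltPts f (k + 1) σ (Function.update p k r) := by
  constructor
  · intro i hi
    rw [Function.update_of_ne (by omega)]
    by_cases hik : i + 1 = k
    · rw [hik, Function.update_self]
      have := hr (by omega)
      rwa [← hik, Nat.add_sub_cancel] at this
    · rw [Function.update_of_ne hik]
      exact h.lt i (by omega)
  · intro i hi
    by_cases hik : i = k
    · rw [hik, Function.update_self]
      exact hs
    · rw [Function.update_of_ne hik]
      exact h.sign i (by omega)

/-- Alternating configurations, spread over at most one delay, can be moved back in time. -/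
theorem Feedback.alt_of_cyclic (hb : Feedback b δ c₀) (hf : DelaySol b f) {k : ℕ}
    (hδ : δ = (-1) ^ (k + 1)) {τ : ℝ} (hτ : 0 ≤ τ) {σ : ℝ} {p : ℕ → ℝ}
    (hp : AltPts f (k + 1) σ p) (hlow : τ - 1 ≤ p 0) (hcyc : p k ≤ p 0 + 1) :
    Alt f (k + 1) τ := by
  induction hn : ∑ i ∈ Finset.range (k + 1), ⌈p i - τ⌉₊ using Nat.strong_induction_on
    generalizing σ p with
  | _ n ih =>
  by_cases hle : p k ≤ τ
  · exact ⟨σ, p, hp, fun i hi => ⟨hlow.trans (hp.le (Nat.zero_le i) hi),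
      (hp.le (Nat.lt_succ_iff.1 hi) (by omega)).trans hle⟩⟩
  push Not at hle
  have hk := hp.sign k (by omega)
  have step : ∀ s, τ ≤ s → (0 < k → p (k - 1) ≤ s) → s < p k → σ * (-1) ^ k * f s ≤ 0 →
      Alt f (k + 1) τ := by
    intro s hs1 hs2 hs3 hs4
    obtain ⟨r, ⟨hr1, hr2⟩, hr3⟩ := hb.exists_delayed hf (ς := σ * (-1) ^ k) (hτ.trans hs1) hs3
      (by linarith)
    have hr4 : 0 < -σ * f (r - 1) := by
      have : δ * (σ * (-1) ^ k) = -σ := by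
        rw [hδ, pow_succ]
        have : ((-1 : ℝ) ^ k) * (-1) ^ k = 1 := by
          rw [← mul_pow]; simp
        linear_combination (-σ) * this
      rwa [this] at hr3
    have hp' := (hp.mono (Nat.le_succ k)).cons (r := r - 1) (fun _ => by linarith) hr4
    refine ih _ ?_ hp' ?_ ?_ rfl
    · rw [← hn, Finset.sum_range_succ', Finset.sum_range_succ]
      simp only [consPt_succ, consPt_zero]
      have h1 : ⌈r - 1 - τ⌉₊ < ⌈p k - τ⌉₊ := by
        rcases le_or_gt (r - 1 - τ) 0 with h0 | h0
        · rw [Nat.ceil_eq_zero.2 h0]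
          exact Nat.ceil_pos.2 (by linarith)
        · rw [Nat.lt_ceil]
          have := Nat.ceil_lt_add_one h0.le
          linarith
      omega
    · simp; linarith
    · rcases k with _ | k
      · simp
      · simp only [consPt_succ, consPt_zero]
        have := hs2 (by omega)
        simp at this
        linarith
  by_cases hk0 : 0 < k ∧ τ ≤ p (k - 1)
  · have h1 := hp.sign (k - 1) (by omega)
    have h2 := hp.lt (k - 1) (by omega)
    obtain ⟨j, rfl⟩ : ∃ j, k = j + 1 := ⟨k - 1, by omega⟩
    simp only [Nat.add_sub_cancel] at *
    refine step (p j) hk0.2 (fun _ => le_rfl) h2 ?_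
    rw [pow_succ]
    linarith
  · have hk1 : 0 < k → p (k - 1) < τ := fun h => by
      by_contra! h'
      exact hk0 ⟨h, h'⟩
    rcases le_or_gt (σ * (-1) ^ k * f τ) 0 with hs | hs
    · exact step τ le_rfl (fun h => (hk1 h).le) hle hs
    · refine ⟨σ, _, (hp.mono (Nat.le_succ k)).update_last hk1 hs, fun i hi => ?_⟩
      by_cases hik : i = k
      · rw [hik, Function.update_self]
        exact ⟨by linarith, le_rfl⟩
      · rw [Function.update_of_ne hik]
        have := hp.le (Nat.zero_le i) hi
        have h3 := hp.le (i := i) (j := k - 1) (by omega) (by omega)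
        have := hk1 (by omega)
        exact ⟨by linarith, by linarith⟩

theorem Feedback.alt_backward (hb : Feedback b δ c₀) (hf : DelaySol b f) {n : ℕ}
    (hδ : δ = (-1) ^ n) {τ t : ℝ} (hτ : 0 ≤ τ) (ht : τ ≤ t) (h : Alt f n t) : Alt f n τ := by
  rcases n with _ | k
  · exact alt_zero f τ
  obtain ⟨σ, p, hp, hw⟩ := h
  have h0 := hw 0 (by omega)
  have h1 := hw k (by omega)
  exact hb.alt_of_cyclic hf hδ hτ hp (by linarith [h0.1]) (by linarith [h0.1, h1.2])

/-- If `f` vanishes at both ends of a window, then going back one delay produces one more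
alternation, strictly inside. -/
theorem Feedback.rolle (hb : Feedback b δ c₀) (hf : DelaySol b f) {n : ℕ} (hn : 0 < n) {t σ : ℝ}
    {p : ℕ → ℝ} (ht : 1 ≤ t) (h0 : f (t - 1) = 0) (h1 : f t = 0) (hp : AltPts f n σ p)
    (hw : ∀ i < n, p i ∈ Set.Icc (t - 1) t) :
    ∃ P, AltPts f (n + 1) (δ * σ) P ∧ ∀ i < n + 1, P i ∈ Set.Ioo (t - 2) (t - 1) := by
  set q : ℕ → ℝ := fun i => if i = 0 then t - 1 else if i ≤ n then p (i - 1) else t with hq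
  have q0 : q 0 = t - 1 := rfl
  have qs : ∀ i < n, q (i + 1) = p i := fun i hi => by simp [hq, Nat.succ_le_iff.2 hi]
  have qn : q (n + 1) = t := by simp [hq]
  have ne : ∀ i < n, f (p i) ≠ 0 := fun i hi h => by
    have := hp.sign i hi
    simp [h] at this
  have hlt : ∀ i < n + 1, q i < q (i + 1) := by
    intro i hi
    rcases i with _ | i
    · rw [q0, qs 0 hn]
      exact lt_of_le_of_ne (hw 0 hn).1 fun h => ne 0 hn (by rw [← h, h0])
    · rw [qs i (by omega)]
      by_cases hin : i + 1 < n
      · rw [qs (i + 1) hin]; exact hp.lt i hin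
      · obtain rfl : n = i + 1 := by omega
        rw [qn]
        exact lt_of_le_of_ne (hw i (by omega)).2 fun h => ne i (by omega) (by rw [h, h1])
  have hge : ∀ i ≤ n + 1, t - 1 ≤ q i := by
    intro i hi
    rcases i with _ | i
    · rw [q0]
    · by_cases hin : i < n
      · rw [qs i hin]; exact (hw i hin).1
      · obtain rfl : n = i := by omega
        rw [qn]; linarith
  have hle : ∀ i ≤ n + 1, q i ≤ t := by
    intro i hi
    rcases i with _ | i
    · rw [q0]; linarith
    · by_cases hin : i < n
      · rw [qs i hin]; exact (hw i hin).2
      · obtain rfl : n = i := by omega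
        rw [qn]
  have hsg : ∀ i < n + 1, 0 < σ * (-1) ^ i * (f (q (i + 1)) - f (q i)) := by
    intro i hi
    have a1 : 0 ≤ σ * (-1) ^ i * f (q (i + 1)) ∧ (i < n → 0 < σ * (-1) ^ i * f (q (i + 1))) := by
      by_cases hin : i < n
      · rw [qs i hin]; exact ⟨(hp.sign i hin).le, fun _ => hp.sign i hin⟩
      · obtain rfl : n = i := by omega
        rw [qn, h1]; simp
    have a2 : σ * (-1) ^ i * f (q i) ≤ 0 ∧ (i = n → σ * (-1) ^ i * f (q i) < 0) := by
      rcases i with _ | i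
      · rw [q0, h0]; simp; omega
      · rw [qs i (by omega)]
        have := hp.sign i (by omega)
        rw [pow_succ]
        exact ⟨by linarith, fun _ => by linarith⟩
    by_cases hin : i < n
    · linarith [a1.2 hin, a2.1]
    · linarith [a1.1, a2.2 (by omega)]
  have : ∀ i, ∃ r, i < n + 1 → r ∈ Set.Ioo (q i) (q (i + 1)) ∧
      0 < δ * (σ * (-1) ^ i) * f (r - 1) := by
    intro i
    by_cases hi : i < n + 1
    · obtain ⟨r, hr, hr2⟩ := hb.exists_delayed hf (s := q i) (by linarith [hge i hi.le])
        (hlt i hi) (hsg i hi)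
      exact ⟨r, fun _ => ⟨hr, hr2⟩⟩
    · exact ⟨0, fun h => absurd h hi⟩
  choose r hr using this
  refine ⟨fun i => r i - 1, ⟨fun i hi => ?_, fun i hi => ?_⟩, fun i hi => ?_⟩
  · have a := (hr i (by omega)).1.2
    have a' := (hr (i + 1) hi).1.1
    linarith
  · have := (hr i hi).2
    linarith
  · have a := (hr i hi).1
    have a1 := hge i (by omega)
    have a2 := hle (i + 1) (by omega)
    constructor
    · have := a.1; linarith
    · have := a.2; linarith

/-- If `f` vanishes at both ends of a window, its number of alternations has dropped. -/
theorem Feedback.drop (hb : Feedback b δ c₀) (hf : DelaySol b f) {N : ℕ}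
    (hδ : δ = (-1) ^ N) {τ t : ℝ} (hτ : 0 ≤ τ) (ht : τ + 2 ≤ t) (hno : ¬ Alt f (N + 2) τ)
    (h0 : f (t - 1) = 0) (h1 : f t = 0) : ¬ Alt f (max N 1) t := by
  rintro ⟨σ, p, hp, hw⟩
  obtain ⟨P, hP, hPw⟩ := hb.rolle hf (by omega) (by linarith) h0 h1 hp hw
  apply hno
  rcases Nat.eq_zero_or_pos N with rfl | hN
  · refine hb.alt_of_cyclic (k := 1) hf (by simpa using hδ) hτ hP ?_ ?_
    · linarith [(hPw 0 (by omega)).1]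
    · linarith [(hPw 0 (by omega)).1, (hPw 1 (by simp)).2]
  · rw [max_eq_left hN] at hP hPw
    have hPN := hP.sign N (by omega)
    have hwN := hPw N (by omega)
    have hw0 := hPw 0 (by omega)
    have hδN : δ * (-1) ^ N = 1 := by rw [← hδ, hb.sq]
    have e : 0 < σ * f (P N) := by
      have : δ * σ * (-1) ^ N * f (P N) = (δ * (-1) ^ N) * (σ * f (P N)) := by ring
      rwa [this, hδN, one_mul] at hPN
    obtain ⟨q, hq, hq2⟩ := hb.exists_delayed hf (s := P N) (t := t - 1) (ς := -σ)
      (by linarith [hwN.1]) hwN.2 (by rw [h0]; linarith)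
    refine hb.alt_of_cyclic (k := N + 1) hf (by rw [hδ, pow_add, pow_succ]; simp) hτ
      (hP.cons (r := q - 1) (fun _ => by linarith [hq.2, hw0.1]) (by linarith)) ?_ ?_
    · simp; linarith [hq.1, hwN.1]
    · simp; linarith [hq.1]

end Config

section Stable

variable {b f g : ℝ → ℝ} {δ c₀ : ℝ}

theorem AltPts.normalize {n : ℕ} {σ : ℝ} {p : ℕ → ℝ} (h : AltPts f n σ p) :
    ∃ σ' : ℝ, |σ'| = 1 ∧ AltPts f n σ' p := by
  rcases eq_or_ne σ 0 with rfl | hσ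
  · refine ⟨1, by simp, h.lt, fun i hi => ?_⟩
    have := h.sign i hi
    simp at this
  · have hσ' : 0 < |σ| := abs_pos.2 hσ
    refine ⟨σ / |σ|, by rw [abs_div, abs_abs, div_self hσ'.ne'], h.lt, fun i hi => ?_⟩
    have := h.sign i hi
    have e : σ / |σ| * (-1) ^ i * f (p i) = (σ * (-1) ^ i * f (p i)) / |σ| := by ring
    rw [e]; positivity

/-- Near a sign point of `g` there is a point of the same sign for `f`, if `f` and `g` are close
and `f` is regular. -/
theorem Feedback.shift_point (hb : Feedback b δ c₀) (hg : DelaySol b g) {T m η ε : ℝ}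
    (hT : 1 ≤ T) (hη : 0 < η) (hη1 : η < 1) (hm : 0 < m)
    (hreg : ∀ t ∈ Set.Icc (T - 1) T, m ≤ |f t| ∨ m ≤ |f (t - 1)|)
    (hT0 : m ≤ |f T|) (hT1 : m ≤ |f (T - 1)|)
    (huc : ∀ x ∈ Set.Icc (T - 2) T, ∀ y ∈ Set.Icc (T - 2) T, |x - y| ≤ 2 * η → |f x - f y| < m / 4)
    (hε : ε ≤ m / 4) (hε2 : ε < c₀ * (m / 2) * η)
    (hgf : ∀ x ∈ Set.Icc (T - 2) T, |g x - f x| ≤ ε) {ω p : ℝ} (hω : |ω| = 1)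
    (hp : p ∈ Set.Icc (T - 1) T) (hgp : 0 < ω * g p) :
    ∃ q ∈ Set.Icc (T - 1) T, |q - p| ≤ η ∧ 0 < ω * f q ∧
      (p < q → ∀ r ∈ Set.Icc (T - 1) T, p ≤ r → r ≤ p + 2 * η → 0 < ω * g r) ∧
      (q < p → ∀ r ∈ Set.Icc (T - 1) T, r ≤ p → p - 2 * η ≤ r → 0 < ω * g r) := by
  obtain ⟨hp1, hp2⟩ := hp
  have close : ∀ ω', |ω'| = 1 → ∀ x ∈ Set.Icc (T - 2) T, |ω' * g x - ω' * f x| ≤ ε :=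
    fun ω' hω' x hx => by
      rw [← mul_sub, abs_mul, hω', one_mul]; exact hgf x hx
  by_cases hbig : m / 2 ≤ |f p|
  · refine ⟨p, ⟨hp1, hp2⟩, by simp [hη.le], ?_, fun h => absurd h (lt_irrefl _),
      fun h => absurd h (lt_irrefl _)⟩
    have h1 := abs_le.1 (close ω hω p ⟨by linarith, hp2⟩)
    have h2 : m / 2 ≤ |ω * f p| := by rw [abs_mul, hω, one_mul]; exact hbig
    rcases le_abs.1 h2 with h3 | h3 <;> linarith [h1.1, h1.2]
  push Not at hbig
  have hpb : m ≤ |f (p - 1)| := (hreg p ⟨hp1, hp2⟩).resolve_left (by linarith)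
  have hfar1 : T - 1 + η < p := by
    by_contra! h
    have h1 := abs_lt.1 (huc p ⟨by linarith, hp2⟩ (T - 1) ⟨by linarith, by linarith⟩
      (by rw [abs_le]; constructor <;> linarith))
    have h2 := abs_lt.1 hbig
    rcases le_abs.1 hT1 with h3 | h3 <;> linarith [h1.1, h1.2, h2.1, h2.2]
  have hfar2 : p < T - η := by
    by_contra! h
    have h1 := abs_lt.1 (huc p ⟨by linarith, hp2⟩ T ⟨by linarith, by linarith⟩
      (by rw [abs_le]; constructor <;> linarith))
    have h2 := abs_lt.1 hbig
    rcases le_abs.1 hT0 with h3 | h3 <;> linarith [h1.1, h1.2, h2.1, h2.2]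
  obtain ⟨ς, hς, hς2⟩ : ∃ ς : ℝ, |ς| = 1 ∧ m ≤ ς * f (p - 1) := by
    rcases le_abs.1 hpb with h | h
    · exact ⟨1, by simp, by linarith⟩
    · exact ⟨-1, by simp, by linarith⟩
  have hnear : ∀ r ∈ Set.Icc (T - 1) T, |r - p| ≤ 2 * η → m / 2 ≤ ς * g (r - 1) := by
    intro r hr hrp
    have h1 := huc (r - 1) ⟨by linarith [hr.1], by linarith [hr.2]⟩ (p - 1)
      ⟨by linarith, by linarith⟩ (by simpa using hrp)
    have h2 : |ς * f (r - 1) - ς * f (p - 1)| < m / 4 := by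
      rw [← mul_sub, abs_mul, hς, one_mul]; exact h1
    have h3 := abs_le.1 (close ς hς (r - 1) ⟨by linarith [hr.1], by linarith [hr.2]⟩)
    linarith [(abs_lt.1 h2).1, h3.1]
  have hgr : ∀ s ∈ Set.Icc (T - 1) T, ∀ t ∈ Set.Icc (T - 1) T, s ≤ t → |s - p| ≤ 2 * η →
      |t - p| ≤ 2 * η → c₀ * (m / 2) * (t - s) ≤ δ * ς * (g t - g s) := by
    intro s hs t ht hst h1 h2
    refine hb.growth hg (by linarith [hs.1]) hst (by positivity) fun r hr => hnear r
      ⟨by linarith [hs.1, hr.1], by linarith [ht.2, hr.2]⟩ ?_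
    rw [abs_le] at *
    constructor <;> linarith [hr.1, hr.2]
  have hc : 0 < c₀ * (m / 2) := mul_pos hb.pos (by linarith)
  have hδ : |δ| = 1 := by
    have h := hb.sq
    have : |δ| * |δ| = 1 := by rw [abs_mul_abs_self, h]
    nlinarith [abs_nonneg δ]
  have hcase : δ * ς = ω ∨ δ * ς = -ω := by
    have : |δ * ς| = |ω| := by rw [abs_mul, hδ, hς, hω, one_mul]
    exact abs_eq_abs.1 this
  have habs : |(2 : ℝ) * η| = 2 * η := abs_of_pos (by linarith)
  rcases hcase with hcs | hcs <;> rw [hcs] at hgr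
  · refine ⟨p + η, ⟨by linarith, by linarith⟩, by simp [abs_of_pos hη], ?_, fun _ r hr h1 h2 => ?_,
      fun h => absurd h (by linarith)⟩
    · have h1 := hgr p ⟨hp1, hp2⟩ (p + η) ⟨by linarith, by linarith⟩ (by linarith)
        (by simp [hη.le]) (by rw [abs_le]; constructor <;> linarith)
      have h2 := abs_le.1 (close ω hω (p + η) ⟨by linarith, by linarith⟩)
      rw [show p + η - p = η by ring] at h1
      linarith [h2.1, h2.2]
    · have h3 := hgr p ⟨hp1, hp2⟩ r hr h1 (by simp [hη.le])
        (by rw [abs_le]; constructor <;> linarith)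
      have := mul_nonneg hc.le (sub_nonneg.2 h1)
      linarith
  · refine ⟨p - η, ⟨by linarith, by linarith⟩, by simp [abs_of_pos hη], ?_,
      fun h => absurd h (by linarith), fun _ r hr h1 h2 => ?_⟩
    · have h1 := hgr (p - η) ⟨by linarith, by linarith⟩ p ⟨hp1, hp2⟩ (by linarith)
        (by rw [abs_le]; constructor <;> linarith) (by simp [hη.le])
      have h2 := abs_le.1 (close ω hω (p - η) ⟨by linarith, by linarith⟩)
      rw [show p - (p - η) = η by ring] at h1
      linarith [h2.1, h2.2]
    · have h3 := hgr r hr p ⟨hp1, hp2⟩ h1 (by rw [abs_le]; constructor <;> linarith)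
        (by simp [hη.le])
      have := mul_nonneg hc.le (sub_nonneg.2 h1)
      linarith

/-- Alternations of nearby solutions are also alternations of a regular solution. -/
theorem Feedback.alt_of_close (hb : Feedback b δ c₀) (hf : DelaySol b f) {T : ℝ} (hT : 1 ≤ T)
    (hreg : ∀ t ∈ Set.Icc (T - 1) T, f t ≠ 0 ∨ f (t - 1) ≠ 0) (hT0 : f T ≠ 0)
    (hT1 : f (T - 1) ≠ 0) :
    ∃ ε > 0, ∀ g, DelaySol b g → (∀ x ∈ Set.Icc (T - 2) T, |g x - f x| ≤ ε) →
      ∀ n, Alt g n T → Alt f n T := by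
  have hfc := hf.cont
  obtain ⟨t₀, ht₀, hmin⟩ := (isCompact_Icc (a := T - 1) (b := T)).exists_isMinOn
    ⟨T, by simp⟩ (f := fun t => max |f t| |f (t - 1)|) (by fun_prop)
  set m := min (max |f t₀| |f (t₀ - 1)|) (min |f T| |f (T - 1)|) with hmdef
  have hm : 0 < m := by
    refine lt_min ?_ (lt_min (abs_pos.2 hT0) (abs_pos.2 hT1))
    rcases hreg t₀ ht₀ with h | h
    · exact lt_max_of_lt_left (abs_pos.2 h)
    · exact lt_max_of_lt_right (abs_pos.2 h)
  have hmT : m ≤ |f T| := (min_le_right _ _).trans (min_le_left _ _)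
  have hmT1 : m ≤ |f (T - 1)| := (min_le_right _ _).trans (min_le_right _ _)
  have hmreg : ∀ t ∈ Set.Icc (T - 1) T, m ≤ |f t| ∨ m ≤ |f (t - 1)| := fun t ht => by
    have : max |f t₀| |f (t₀ - 1)| ≤ max |f t| |f (t - 1)| := hmin ht
    exact le_max_iff.1 ((min_le_left _ _).trans this)
  have huc := (isCompact_Icc (a := T - 2) (b := T)).uniformContinuousOn_of_continuous
    hfc.continuousOn
  obtain ⟨η₀, hη₀, huc⟩ := Metric.uniformContinuousOn_iff.1 huc (m / 4) (by positivity)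
  set η := min (η₀ / 4) (1 / 2) with hη
  have hηpos : 0 < η := by positivity
  have hη1 : η ≤ η₀ / 4 := min_le_left _ _
  have hη2 : η ≤ 1 / 2 := min_le_right _ _
  have hc := hb.pos
  refine ⟨min (m / 4) (c₀ * (m / 2) * η / 2), by positivity, fun g hg hgf n hn => ?_⟩
  obtain ⟨σ, p, hp, hw⟩ := hn
  obtain ⟨σ, hσ, hp⟩ := hp.normalize
  have hω : ∀ i : ℕ, |σ * (-1) ^ i| = 1 := fun i => by rw [abs_mul, hσ, abs_pow]; simp
  have hsh := fun i (hi : i < n) => hb.shift_point hg hT hηpos (by linarith) hm hmreg hmT hmT1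
    (fun x hx y hy hxy => by
      have := huc x hx y hy (by rw [Real.dist_eq]; linarith)
      rwa [Real.dist_eq] at this)
    (min_le_left _ _) ((min_le_right _ _).trans_lt (half_lt_self (by positivity))) hgf (hω i)
      (hw i hi) (hp.sign i hi)
  have : ∀ i, ∃ q, i < n → q ∈ Set.Icc (T - 1) T ∧ |q - p i| ≤ η ∧ 0 < σ * (-1) ^ i * f q ∧
      (p i < q → ∀ r ∈ Set.Icc (T - 1) T, p i ≤ r → r ≤ p i + 2 * η → 0 < σ * (-1) ^ i * g r) ∧
      (q < p i → ∀ r ∈ Set.Icc (T - 1) T, r ≤ p i → p i - 2 * η ≤ r →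
        0 < σ * (-1) ^ i * g r) := by
    intro i
    by_cases hi : i < n
    · obtain ⟨q, h1, h2⟩ := hsh i hi
      exact ⟨q, fun _ => ⟨h1, h2⟩⟩
    · exact ⟨0, fun h => absurd h hi⟩
  choose q hq using this
  refine ⟨σ, q, ⟨fun i hi => ?_, fun i hi => (hq i hi).2.2.1⟩, fun i hi => (hq i hi).1⟩
  obtain ⟨-, a2, -, a4, -⟩ := hq i (by omega)
  obtain ⟨-, b2, -, -, b5⟩ := hq (i + 1) hi
  have hlt := hp.lt i hi
  have s1 := hp.sign i (by omega)
  have s2 := hp.sign (i + 1) hi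
  rw [pow_succ] at s2
  by_contra! hle
  rw [abs_le] at a2 b2
  have hq1 : q i ≤ p i := by
    by_contra! h
    have := a4 h (p (i + 1)) (hw _ hi) hlt.le (by linarith [a2.2, b2.1])
    linarith
  have hq2 : p (i + 1) ≤ q (i + 1) := by
    by_contra! h
    have := b5 h (p i) (hw _ (by omega)) hlt.le (by linarith [a2.2, b2.1])
    rw [pow_succ] at this
    linarith
  linarith

/-- The property of having few alternations is stable under small perturbations, after waiting. -/
theorem Feedback.stable (hb : Feedback b δ c₀) (N : ℕ) (hδ : δ = (-1) ^ N) :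
    ∀ τ, 0 ≤ τ → ∀ f, DelaySol b f → ¬ Alt f (N + 2) τ → Alt f 1 τ →
      ∃ ε > 0, ∀ g, DelaySol b g → (∀ x ∈ Set.Icc (τ - 1) (τ + 2 * N + 4), |g x - f x| ≤ ε) →
        ¬ Alt g (N + 2) (τ + 2 * N + 4) := by
  induction N using Nat.strong_induction_on with
  | _ N ih =>
  intro τ hτ f hf hno hne
  have hN0 : (0 : ℝ) ≤ N := Nat.cast_nonneg N
  have hδ2 : δ = (-1) ^ (N + 2) := by rw [hδ, pow_add]; simp
  have nz : ∀ t, τ ≤ t → ∃ x ∈ Set.Icc (t - 1) t, f x ≠ 0 := by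
    intro t ht
    by_contra! h
    obtain ⟨x, hx, hx2⟩ := alt_one_iff.1 hne
    exact hx2 (hb.zero_backward hf hτ ht h x hx)
  by_cases hbad : ∃ t ∈ Set.Icc (τ + 2) (τ + 4), f t = 0 ∧ f (t - 1) = 0
  · obtain ⟨t, ht, h0, h1⟩ := hbad
    have hd := hb.drop hf hδ hτ ht.1 hno h1 h0
    rcases Nat.lt_or_ge N 2 with hN | hN
    · rw [max_eq_right (by omega), alt_one_iff] at hd
      exact absurd (nz t (by linarith [ht.1])) hd
    · rw [max_eq_left (by omega)] at hd
      obtain ⟨K, rfl⟩ : ∃ K, N = K + 2 := ⟨N - 2, by omega⟩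
      obtain ⟨ε, hε, h⟩ := ih K (by omega) (by rw [hδ, pow_add]; simp) t (by linarith [ht.1]) f hf
        hd
        (alt_one_iff.2 (nz t (by linarith [ht.1])))
      push_cast at *
      refine ⟨ε, hε, fun g hg hgf halt => ?_⟩
      refine h g hg (fun x hx => hgf x ⟨by linarith [hx.1, ht.1], by linarith [hx.2, ht.2]⟩) ?_
      exact (hb.alt_backward hg hδ2 (by linarith [ht.1]) (by linarith [ht.2]) halt).mono
        (by omega)
  · push Not at hbad
    have hT : ∃ T ∈ Set.Icc (τ + 3) (τ + 4), f T ≠ 0 ∧ f (T - 1) ≠ 0 := by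
      by_contra! hcon
      have hfc := hf.cont
      have hpre := isPreconnected_closed_iff.1 (isPreconnected_Icc (a := τ + 3) (b := τ + 4))
        {t | f t = 0} {t | f (t - 1) = 0} (isClosed_eq hfc continuous_const)
        (isClosed_eq (by fun_prop) continuous_const)
        (fun t ht => by
          by_cases h : f t = 0
          · exact Or.inl h
          · exact Or.inr (hcon t ht h))
      obtain ⟨x, hx, hx2⟩ := nz (τ + 4) (by linarith)
      obtain ⟨y, hy, hy2⟩ := nz (τ + 3) (by linarith)
      rw [show τ + 4 - 1 = τ + 3 by ring] at hx
      obtain ⟨z, hz, hz1, hz2⟩ := hpre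
        ⟨y + 1, ⟨by linarith [hy.1], by linarith [hy.2]⟩, by
          by_contra h
          have := hcon (y + 1) ⟨by linarith [hy.1], by linarith [hy.2]⟩ h
          simp at this; exact hy2 this⟩
        ⟨x, hx, hcon x hx hx2⟩
      exact hbad z ⟨by linarith [hz.1], hz.2⟩ hz1 hz2
    obtain ⟨T, hT, hT0, hT1⟩ := hT
    obtain ⟨ε, hε, h⟩ := hb.alt_of_close hf (T := T) (by linarith [hT.1]) (fun t ht => by
      by_contra! hc
      exact hbad t ⟨by linarith [ht.1, hT.1], by linarith [ht.2, hT.2]⟩ hc.1 hc.2) hT0 hT1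
    refine ⟨ε, hε, fun g hg hgf halt => hno ?_⟩
    have h1 := hb.alt_backward hg hδ2 (τ := T) (by linarith [hT.1]) (by linarith [hT.2]) halt
    have h2 := h g hg (fun x hx => hgf x ⟨by linarith [hx.1, hT.1], by linarith [hx.2, hT.2]⟩) _ h1
    exact hb.alt_backward hf hδ2 hτ (by linarith [hT.1]) h2

end Stable

section Det

variable {b : ℝ → ℝ} {δ c₀ : ℝ}

theorem DelaySol.sum {ι : Type*} (hb : LocallyIntegrable b volume) (s : Finset ι) (a : ι → ℝ)
    {f : ι → ℝ → ℝ} (hf : ∀ j, DelaySol b (f j)) : DelaySol b (fun t => ∑ j ∈ s, a j * f j t) := by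
  constructor
  · have := fun j => (hf j).cont
    fun_prop
  · intro t u ht htu
    have e : (fun r => b r * ∑ j ∈ s, a j * f j (r - 1)) =
        fun r => ∑ j ∈ s, a j * (b r * f j (r - 1)) := by
      funext r; rw [Finset.mul_sum]; exact Finset.sum_congr rfl fun j _ => by ring
    rw [e, intervalIntegral.integral_finsetSum
      (fun j _ => (Feedback.integrand hb (hf j).cont t u).const_mul _), ← Finset.sum_sub_distrib]
    refine Finset.sum_congr rfl fun j _ => ?_
    rw [intervalIntegral.integral_const_mul, ← (hf j).eq t u ht htu]
    ring

/-- The determinant of the values of `f 0, …, f N` at the points `p 0, …, p N`. -/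
def solDet (f : ℕ → ℝ → ℝ) (N : ℕ) (p : ℕ → ℝ) : ℝ :=
  (Matrix.of fun i j : Fin (N + 1) => f j (p i)).det

variable {f : ℕ → ℝ → ℝ} {N : ℕ}

theorem delaySol_solDet (hb : LocallyIntegrable b volume) (hf : ∀ j, DelaySol b (f j))
    (p : ℕ → ℝ) : DelaySol b (fun t => solDet f N (Function.update p N t)) := by
  have e : (fun t => solDet f N (Function.update p N t)) = fun t => ∑ j : Fin (N + 1),
      ((-1) ^ (N + (j : ℕ)) * ((Matrix.of fun i j : Fin (N + 1) => f j (p i)).submatrix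
        (Fin.last N).succAbove j.succAbove).det) * f j t := by
    funext t
    rw [solDet, Matrix.det_succ_row _ (Fin.last N)]
    refine Finset.sum_congr rfl fun j _ => ?_
    have : ((Matrix.of fun i j : Fin (N + 1) => f j (Function.update p N t i)).submatrix
        (Fin.last N).succAbove j.succAbove) = ((Matrix.of fun i j : Fin (N + 1) =>
          f j (p i)).submatrix (Fin.last N).succAbove j.succAbove) := by
      ext i k
      simp only [Matrix.submatrix_apply, Matrix.of_apply, Fin.succAbove_last, Fin.val_castSucc]
      rw [Function.update_of_ne (by omega)]
    rw [this]
    simp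
    ring
  rw [e]
  exact DelaySol.sum hb _ _ fun j => hf j

theorem solDet_update_last (p : ℕ → ℝ) (r : ℝ) :
    solDet f N (Function.update p N r) = (-1) ^ N * solDet f N (consPt r p) := by
  have h := Matrix.det_permute (finRotate (N + 1))
    (Matrix.of fun i j : Fin (N + 1) => f j (consPt r p i))
  rw [sign_finRotate] at h
  unfold solDet
  simp only [Nat.add_sub_cancel] at h
  push_cast at h
  rw [← h]
  congr 1
  ext i j
  simp only [Matrix.of_apply, Matrix.submatrix_apply, id]
  congr 1
  by_cases hi : i = Fin.last N
  · subst hi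
    simp
  · rw [coe_finRotate_of_ne_last hi, consPt_succ, Function.update_of_ne]
    intro h
    exact hi (Fin.ext h)

theorem solDet_eq_zero {p : ℕ → ℝ} {i j : ℕ} (hij : i ≠ j) (hi : i ≤ N) (hj : j ≤ N)
    (h : p i = p j) : solDet f N p = 0 :=
  Matrix.det_zero_of_row_eq (i := ⟨i, by omega⟩) (j := ⟨j, by omega⟩)
    (by simpa using hij) (by ext k; simp [h])

theorem solDet_vandermonde (hmono0 : ∀ j, ∀ θ ∈ Set.Icc (-1 : ℝ) 0, f j θ = θ ^ j) {p : ℕ → ℝ}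
    (hp : ∀ i ≤ N, p i ∈ Set.Icc (-1 : ℝ) 0) :
    solDet f N p = ∏ i : Fin (N + 1), ∏ j ∈ Finset.Ioi i, (p j - p i) := by
  rw [← Matrix.det_vandermonde (fun i : Fin (N + 1) => p i)]
  unfold solDet
  congr 1
  ext i j
  simp [Matrix.vandermonde_apply, hmono0 j _ (hp i (Nat.lt_succ_iff.1 i.2))]

theorem monoPts {p : ℕ → ℝ} (hp : ∀ i < N, p i < p (i + 1)) {i j : ℕ} (hij : i ≤ j) (hj : j ≤ N) :
    p i ≤ p j := by
  induction j, hij using Nat.le_induction with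
  | base => exact le_rfl
  | succ k hk ih => exact (ih (by omega)).trans (hp k (by omega)).le

theorem Feedback.solDet_nonneg (hb : Feedback b δ c₀) (hδ : δ = (-1) ^ N)
    (hf : ∀ j, DelaySol b (f j)) (hmono0 : ∀ j, ∀ θ ∈ Set.Icc (-1 : ℝ) 0, f j θ = θ ^ j)
    {p : ℕ → ℝ} (hp : ∀ i < N, p i < p (i + 1)) (hlow : -1 ≤ p 0) (hcyc : p N ≤ p 0 + 1) :
    0 ≤ solDet f N p := by
  induction hn : ∑ i ∈ Finset.range (N + 1), ⌈p i⌉₊ using Nat.strong_induction_on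
    generalizing p with
  | _ n ih =>
  by_cases hle : p N ≤ 0
  · rw [solDet_vandermonde hmono0 fun i hi => ⟨hlow.trans (monoPts hp (Nat.zero_le i) hi),
      (monoPts hp hi le_rfl).trans hle⟩]
    refine Finset.prod_nonneg fun i _ => Finset.prod_nonneg fun j hj => sub_nonneg.2 ?_
    have : i < j := Finset.mem_Ioi.1 hj
    exact monoPts hp this.le (Nat.lt_succ_iff.1 j.2)
  push Not at hle
  have step : ∀ s, 0 ≤ s → (0 < N → p (N - 1) ≤ s) → s < p N →
      0 ≤ solDet f N (Function.update p N s) → 0 ≤ solDet f N p := by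
    intro s hs1 hs2 hs3 hs4
    have h := hb.growth (delaySol_solDet hb.int hf p (N := N)) (s := s) (t := p N) (ς := δ) (v := 0)
      hs1 hs3.le le_rfl ?_
    · rw [hb.sq, Function.update_eq_self] at h
      linarith
    · intro r hr
      have e : δ * (-1) ^ N = 1 := by rw [← hδ, hb.sq]
      rw [solDet_update_last, ← mul_assoc δ, e, one_mul]
      refine ih _ ?_ ?_ ?_ ?_ rfl
      · rw [← hn, Finset.sum_range_succ', Finset.sum_range_succ]
        simp only [consPt_succ, consPt_zero]
        have h1 : ⌈r - 1⌉₊ < ⌈p N⌉₊ := by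
          rcases le_or_gt (r - 1) 0 with h0 | h0
          · rw [Nat.ceil_eq_zero.2 h0]
            exact Nat.ceil_pos.2 (by linarith)
          · rw [Nat.lt_ceil]
            have := Nat.ceil_lt_add_one h0.le
            linarith [hr.2]
        omega
      · intro i hi
        rcases i with _ | i
        · simp; linarith [hr.2]
        · simpa using hp i (by omega)
      · simp; linarith [hr.1]
      · rcases N with _ | k
        · simp
        · have := hs2 (by omega)
          simp at this
          simp; linarith [hr.1]
  by_cases hk0 : 0 < N ∧ 0 ≤ p (N - 1)
  · refine step (p (N - 1)) hk0.2 (fun _ => le_rfl) ?_ ?_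
    · have := hp (N - 1) (by omega)
      rwa [Nat.sub_add_cancel hk0.1] at this
    · apply le_of_eq
      symm
      refine solDet_eq_zero (i := N - 1) (j := N) (by omega) (by omega) le_rfl ?_
      rw [Function.update_self, Function.update_of_ne (by omega)]
  · have hk1 : 0 < N → p (N - 1) < 0 := fun h => by
      by_contra! h'
      exact hk0 ⟨h, h'⟩
    refine step 0 le_rfl (fun h => (hk1 h).le) hle ?_
    have hinc : ∀ i < N, Function.update p N 0 i < Function.update p N 0 (i + 1) := by
      intro i hi
      rw [Function.update_of_ne (by omega)]
      by_cases hik : i + 1 = N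
      · rw [hik, Function.update_self]
        have := hk1 (by omega)
        rwa [← hik, Nat.add_sub_cancel] at this
      · rw [Function.update_of_ne hik]
        exact hp i hi
    refine ih _ ?_ hinc ?_ ?_ rfl
    · rw [← hn, Finset.sum_range_succ, Finset.sum_range_succ, Function.update_self]
      have : ∑ x ∈ Finset.range N, ⌈Function.update p N 0 x⌉₊ = ∑ x ∈ Finset.range N, ⌈p x⌉₊ :=
        Finset.sum_congr rfl fun x hx => by
          rw [Function.update_of_ne (by have := Finset.mem_range.1 hx; omega)]
      rw [this]
      have := Nat.ceil_pos.2 hle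
      simpa using this
    · rcases Nat.eq_zero_or_pos N with rfl | h
      · simp
      · rw [Function.update_of_ne (by omega)]; exact hlow
    · rcases Nat.eq_zero_or_pos N with rfl | h
      · simp
      · rw [Function.update_self, Function.update_of_ne (by omega)]; linarith

theorem Feedback.solDet_lower (hb : Feedback b δ c₀) (hδ : δ = (-1) ^ N)
    (hf : ∀ j, DelaySol b (f j)) (hmono0 : ∀ j, ∀ θ ∈ Set.Icc (-1 : ℝ) 0, f j θ = θ ^ j) :
    ∃ m > 0, ∃ κ > 0, ∀ k : ℕ, ∃ p : ℕ → ℝ, (∀ i ≤ N, p i ∈ Set.Icc (-1 : ℝ) (2 * k + 1)) ∧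
      (∀ i ≤ N, (2 * k : ℝ) / (2 * N + 1) - 1 ≤ p i) ∧ m * κ ^ k ≤ solDet f N p := by
  have hN0 : (0 : ℝ) ≤ N := Nat.cast_nonneg N
  set h : ℝ := 2 / (2 * N + 1) with hh
  have hpos : 0 < h := by positivity
  have hNh : (2 * N + 1) * h = 2 := by rw [hh]; field_simp
  have hh2 : h ≤ 2 := by nlinarith
  have hc := hb.pos
  set κ := h / 8 with hκ
  set a₀ := -1 + κ with ha₀
  set m := ∏ i : Fin (N + 1), ∏ j ∈ Finset.Ioi i, (h / 2) with hm
  have hmpos : 0 < m := Finset.prod_pos fun i _ => Finset.prod_pos fun j _ => by positivity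
  have key : ∀ k : ℕ, ∀ p : ℕ → ℝ, (∀ i ≤ N, |p i - (a₀ + (k + i) * h)| ≤ κ) →
      m * (c₀ * (2 * κ)) ^ k ≤ solDet f N p := by
    intro k
    induction k with
    | zero =>
      intro p hp
      have hp' : ∀ i ≤ N, a₀ + i * h - κ ≤ p i ∧ p i ≤ a₀ + i * h + κ := fun i hi => by
        have := abs_le.1 (hp i hi)
        push_cast at this
        constructor <;> nlinarith [this.1, this.2]
      have hwin : ∀ i ≤ N, p i ∈ Set.Icc (-1 : ℝ) 0 := fun i hi => by
        have h1 := hp' i hi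
        have h2 : (i : ℝ) ≤ N := Nat.cast_le.2 hi
        have h3 : (0 : ℝ) ≤ i := Nat.cast_nonneg i
        constructor <;> nlinarith [h1.1, h1.2]
      rw [solDet_vandermonde hmono0 hwin, pow_zero, mul_one]
      refine Finset.prod_le_prod (fun i _ => Finset.prod_nonneg fun j _ => by positivity)
        fun i _ => Finset.prod_le_prod (fun j _ => by positivity) fun j hj => ?_
      have hij : i < j := Finset.mem_Ioi.1 hj
      have h1 := hp' i (Nat.lt_succ_iff.1 i.2)
      have h2 := hp' j (Nat.lt_succ_iff.1 j.2)
      have h3 : ((i : ℕ) : ℝ) + 1 ≤ ((j : ℕ) : ℝ) := by exact_mod_cast hij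
      nlinarith [h1.2, h2.1]
    | succ k ih =>
      intro p hp
      have hk0 : (0 : ℝ) ≤ k := Nat.cast_nonneg k
      have hp' : ∀ i ≤ N, a₀ + (k + 1 + i) * h - κ ≤ p i ∧ p i ≤ a₀ + (k + 1 + i) * h + κ :=
        fun i hi => by
          have := abs_le.1 (hp i hi)
          push_cast at this
          constructor <;> linarith [this.1, this.2]
      have hkh : 0 ≤ (k : ℝ) * h := by positivity
      have hinc : ∀ i < N, p i < p (i + 1) := fun i hi => by
        have h1 := (hp' i hi.le).2
        have h2 := (hp' (i + 1) hi).1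
        push_cast at h2
        nlinarith
      have hpN := hp' N le_rfl
      have hp0 := hp' 0 (Nat.zero_le N)
      have hprev : 0 < N → p (N - 1) ≤ a₀ + (k + N) * h + κ := fun hN => by
        have := (hp' (N - 1) (by omega)).2
        rw [Nat.cast_sub (by omega)] at this
        push_cast at this
        linarith
      simp only [Nat.cast_zero, add_zero] at hp0
      set s₁ := k * h with hs₁
      set s₂ := s₁ + 2 * κ with hs₂
      have eN : (k + 1 + N) * h = k * h + h / 2 + 1 := by linarith
      have eN' : (k + N) * h = k * h - h / 2 + 1 := by linarith
      rw [eN] at hpN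
      have e0 : (k + 1) * h = k * h + h := by ring
      rw [e0] at hp0
      have hs2N : s₂ ≤ p N := by linarith [hpN.1]
      have e : δ * (-1) ^ N = 1 := by rw [← hδ, hb.sq]
      have hcons : ∀ s, p N ≥ s → s₁ ≤ s → 0 ≤ δ * solDet f N (Function.update p N (s - 1)) := by
        intro s hs hs'
        rw [solDet_update_last, ← mul_assoc δ, e, one_mul]
        refine hb.solDet_nonneg hδ hf hmono0 ?_ ?_ ?_
        · intro i hi
          rcases i with _ | i
          · simp; linarith [hpN.2, hp0.1]
          · simpa using hinc i (by omega)
        · simp; linarith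
        · rcases N with _ | n
          · simp
          · have := hprev (by omega)
            simp at this
            simp; push_cast at *; linarith
      have g1 := hb.growth (delaySol_solDet hb.int hf p (N := N)) (s := s₂) (t := p N) (ς := δ)
        (v := 0) (by positivity) hs2N le_rfl (fun r hr => hcons r hr.2.le (by linarith [hr.1]))
      have g2 := hb.growth (delaySol_solDet hb.int hf p (N := N)) (s := s₁) (t := s₂) (ς := δ)
        (v := m * (c₀ * (2 * κ)) ^ k) (by positivity) (by linarith) (by positivity)
        (fun r hr => by
          rw [solDet_update_last, ← mul_assoc δ, e, one_mul]
          refine ih _ fun i hi => ?_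
          rcases i with _ | i
          · simp only [consPt_zero, Nat.cast_zero, add_zero]
            rw [abs_le]
            constructor <;> linarith [hr.1, hr.2]
          · have := hp' i (by omega)
            simp only [consPt_succ]
            push_cast
            rw [abs_le]
            constructor <;> linarith [this.1, this.2])
      have g3 : 0 ≤ solDet f N (Function.update p N s₁) := by
        refine hb.solDet_nonneg hδ hf hmono0 ?_ ?_ ?_
        · intro i hi
          rw [Function.update_of_ne (by omega)]
          by_cases hik : i + 1 = N
          · rw [hik, Function.update_self]
            have := hprev (by omega)
            rw [← hik, Nat.add_sub_cancel] at this
            have e5 : ((i + 1 : ℕ) : ℝ) = N := by rw [hik]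
            rw [e5] at this
            linarith
          · rw [Function.update_of_ne hik]
            exact hinc i hi
        · rcases Nat.eq_zero_or_pos N with h | h
          · subst h; simp; linarith
          · rw [Function.update_of_ne (by omega)]; linarith [hp0.1]
        · rcases Nat.eq_zero_or_pos N with h | h
          · subst h; simp
          · rw [Function.update_self, Function.update_of_ne (by omega)]; linarith [hp0.1]
      rw [hb.sq] at g1 g2
      rw [Function.update_eq_self] at g1
      rw [show s₂ - s₁ = 2 * κ by linarith] at g2
      rw [pow_succ]
      nlinarith
  refine ⟨m, hmpos, c₀ * (2 * κ), by positivity, fun k => ⟨fun i => a₀ + (k + i) * h, ?_, ?_, ?_⟩⟩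
  · intro i hi
    have h2 : (i : ℝ) ≤ N := Nat.cast_le.2 hi
    have h3 : (0 : ℝ) ≤ i := Nat.cast_nonneg i
    have hk0 : (0 : ℝ) ≤ k := Nat.cast_nonneg k
    constructor <;> simp only <;> nlinarith
  · intro i hi
    have h3 : (0 : ℝ) ≤ i := Nat.cast_nonneg i
    have : (2 * k : ℝ) / (2 * N + 1) = k * h := by rw [hh]; ring
    rw [this]
    nlinarith
  · exact key k _ fun i hi => by simp; positivity

/-- A nonzero polynomial of degree `≤ N` has no superexponentially decaying solution. -/
theorem Feedback.eq_zero_of_superexp (hb : Feedback b δ c₀) (hδ : δ = (-1) ^ N)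
    (hf : ∀ j, DelaySol b (f j)) (hmono0 : ∀ j, ∀ θ ∈ Set.Icc (-1 : ℝ) 0, f j θ = θ ^ j)
    {B K : ℝ} (hB : 1 ≤ B) (hK : 0 ≤ K)
    (hbd : ∀ j ≤ N, ∀ t, -1 ≤ t → |f j t| ≤ B * Real.exp (K * t))
    (a : Fin (N + 1) → ℝ)
    (ha : ∀ ρ : ℝ, ∃ C, ∀ t, -1 ≤ t → |∑ j, a j * f j t| ≤ C * Real.exp (-ρ * t)) : a = 0 := by
  obtain ⟨m, hm, κ, hκ, hlow⟩ := hb.solDet_lower hδ hf hmono0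
  set L : ℝ := (N + 1).factorial • B ^ (N + 1) with hL
  have hL0 : 0 ≤ L := by positivity
  set R : ℝ := (N + 1) * (K * 3) with hR
  obtain ⟨ρ, hρ0, hρ⟩ : ∃ ρ : ℝ, 0 ≤ ρ ∧ Real.exp R * Real.exp (-(ρ * (2 / (2 * N + 1)))) < κ := by
    have h1 : Filter.Tendsto (fun ρ : ℝ => Real.exp R * Real.exp (-(ρ * (2 / (2 * N + 1)))))
        Filter.atTop (nhds (Real.exp R * 0)) := by
      refine Filter.Tendsto.const_mul _ (Real.tendsto_exp_neg_atTop_nhds_zero.comp ?_)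
      exact Filter.tendsto_id.atTop_mul_const (by positivity)
    rw [mul_zero] at h1
    obtain ⟨ρ, h2, h3⟩ := ((h1.eventually (gt_mem_nhds hκ)).and
      (Filter.eventually_ge_atTop 0)).exists
    exact ⟨ρ, h3, h2⟩
  obtain ⟨C, hC⟩ := ha ρ
  have hC0 : 0 ≤ C := by
    have := (abs_nonneg _).trans (hC 0 (by norm_num))
    simpa using this
  funext j
  by_contra hne
  have hj : 0 < |a j| := abs_pos.2 hne
  set q := Real.exp R * Real.exp (-(ρ * (2 / (2 * N + 1)))) with hq
  have main : ∀ k : ℕ, |a j| * (m * κ ^ k) ≤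
      ((N + 1) * (L * Real.exp R * (C * Real.exp ρ))) * q ^ k := by
    intro k
    obtain ⟨p, hp1, hp2, hp3⟩ := hlow k
    set A : Matrix (Fin (N + 1)) (Fin (N + 1)) ℝ := Matrix.of fun i j : Fin (N + 1) => f j (p i)
      with hA
    have hk0 : (0 : ℝ) ≤ k := Nat.cast_nonneg k
    set X := B * Real.exp (K * (2 * k + 1)) with hX
    have hX1 : 1 ≤ X := by
      have : 1 ≤ Real.exp (K * (2 * k + 1)) := Real.one_le_exp (by positivity)
      nlinarith
    have hent : ∀ i j, |A i j| ≤ X := fun i j => by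
      have hi : (i : ℕ) ≤ N := Nat.lt_succ_iff.1 i.2
      refine (hbd j (Nat.lt_succ_iff.1 j.2) _ (hp1 i hi).1).trans ?_
      exact mul_le_mul_of_nonneg_left (Real.exp_le_exp.2
        (mul_le_mul_of_nonneg_left (hp1 i hi).2 hK)) (by linarith)
    have hadj : ∀ i j, |A.adjugate i j| ≤ (N + 1).factorial • X ^ (N + 1) := fun i j => by
      rw [Matrix.adjugate_apply]
      have := Matrix.det_le (A := A.updateRow j (Pi.single i 1)) (abv := AbsoluteValue.abs) (x := X)
        (fun i' j' => by
          rw [Matrix.updateRow_apply]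
          split_ifs
          · rw [Pi.single_apply]
            split_ifs
            · simpa using hX1
            · simpa using zero_le_one.trans hX1
          · exact hent i' j')
      simpa using this
    have hcr : A.det * a j = ∑ i, A.adjugate j i * ∑ l, a l * f l (p i) := by
      have h1 : A.adjugate.mulVec (A.mulVec a) = A.det • a := by
        rw [Matrix.mulVec_mulVec, Matrix.adjugate_mul, Matrix.smul_mulVec, Matrix.one_mulVec]
      have h2 := congrFun h1 j
      rw [Pi.smul_apply, smul_eq_mul] at h2
      rw [← h2]
      simp only [Matrix.mulVec, dotProduct]
      refine Finset.sum_congr rfl fun i _ => ?_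
      congr 1
      exact Finset.sum_congr rfl fun l _ => by simp [hA, mul_comm]
    have hu : ∀ i : Fin (N + 1), |∑ l, a l * f l (p i)| ≤
        C * Real.exp ρ * Real.exp (-(ρ * (2 / (2 * N + 1)))) ^ k := fun i => by
      have hi : (i : ℕ) ≤ N := Nat.lt_succ_iff.1 i.2
      refine (hC _ (hp1 i hi).1).trans ?_
      rw [mul_assoc, ← Real.exp_nat_mul, ← Real.exp_add]
      have := hp2 i hi
      have e : ρ + k * -(ρ * (2 / (2 * N + 1))) = -ρ * ((2 * k : ℝ) / (2 * N + 1) - 1) := by ring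
      rw [e]
      refine mul_le_mul_of_nonneg_left (Real.exp_le_exp.2 ?_) hC0
      nlinarith
    have hXk : (N + 1).factorial • X ^ (N + 1) ≤ L * Real.exp R * Real.exp R ^ k := by
      rw [hX, mul_pow, hL, nsmul_eq_mul, nsmul_eq_mul]
      rw [mul_assoc ((N + 1).factorial : ℝ) (B ^ (N + 1)), mul_assoc ((N + 1).factorial : ℝ),
        mul_assoc (B ^ (N + 1))]
      refine mul_le_mul_of_nonneg_left (mul_le_mul_of_nonneg_left ?_ (by positivity))
        (by positivity)
      rw [← Real.exp_nat_mul, ← Real.exp_nat_mul, ← Real.exp_add]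
      refine Real.exp_le_exp.2 ?_
      rw [hR]; push_cast
      have : 0 ≤ ((N : ℝ) + 1) * K := by positivity
      nlinarith [mul_nonneg this hk0]
    calc |a j| * (m * κ ^ k) ≤ |a j| * |A.det| := by
          gcongr; exact hp3.trans (le_abs_self _)
      _ = |∑ i, A.adjugate j i * ∑ l, a l * f l (p i)| := by rw [← hcr, abs_mul, mul_comm]
      _ ≤ ∑ i, |A.adjugate j i * ∑ l, a l * f l (p i)| := Finset.abs_sum_le_sum_abs _ _
      _ ≤ ∑ i : Fin (N + 1), (L * Real.exp R * Real.exp R ^ k) *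
            (C * Real.exp ρ * Real.exp (-(ρ * (2 / (2 * N + 1)))) ^ k) := by
          refine Finset.sum_le_sum fun i _ => ?_
          rw [abs_mul]
          exact mul_le_mul ((hadj j i).trans hXk) (hu i) (abs_nonneg _) (by positivity)
      _ = _ := by
          rw [Finset.sum_const, Finset.card_univ, Fintype.card_fin, nsmul_eq_mul, hq, mul_pow]
          push_cast; ring
  have hlim : Filter.Tendsto (fun k : ℕ => ((N + 1) * (L * Real.exp R * (C * Real.exp ρ))) *
      (q / κ) ^ k) Filter.atTop (nhds (((N + 1) * (L * Real.exp R * (C * Real.exp ρ))) * 0)) :=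
    (tendsto_pow_atTop_nhds_zero_of_lt_one (by positivity) ((div_lt_one hκ).2 hρ)).const_mul _
  rw [mul_zero] at hlim
  have : |a j| * m ≤ 0 := by
    refine ge_of_tendsto' hlim fun k => ?_
    rw [div_pow, mul_div_assoc', le_div_iff₀ (by positivity), mul_assoc]
    exact main k
  nlinarith

end Det

section Existence

variable {b f g : ℝ → ℝ} {Q : ℝ}

/-- Successive approximations of the delay equation with initial values `φ`. -/
def delayIter (b φ : ℝ → ℝ) : ℕ → ℝ → ℝ
  | 0, t => φ (min t 0)
  | n + 1, t => φ (min t 0) + ∫ u in (0 : ℝ)..max t 0, b u * delayIter b φ n (u - 1)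

theorem delayIter_continuous (hb : LocallyIntegrable b volume) {φ : ℝ → ℝ} (hφ : Continuous φ) :
    ∀ n, Continuous (delayIter b φ n)
  | 0 => by simp only [delayIter]; fun_prop
  | n + 1 => by
    simp only [delayIter]
    have := delayIter_continuous hb hφ n
    have h : Continuous fun t => ∫ u in (0 : ℝ)..t, b u * delayIter b φ n (u - 1) :=
      intervalIntegral.continuous_primitive (fun s t => Feedback.integrand hb this s t) 0
    have h2 : Continuous fun t : ℝ => max t 0 := by fun_prop
    have := h.comp h2
    simp only [Function.comp_def] at this
    fun_prop

theorem delayIter_succ (φ : ℝ → ℝ) : ∀ n : ℕ, ∀ t ≤ (n : ℝ),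
    delayIter b φ (n + 1) t = delayIter b φ n t
  | 0, t, ht => by
    have : t ≤ 0 := by simpa using ht
    simp [delayIter, max_eq_right this]
  | n + 1, t, ht => by
    rw [delayIter, delayIter]
    congr 1
    apply intervalIntegral.integral_congr
    intro u hu
    rw [Set.uIcc_of_le (le_max_right _ _)] at hu
    have h1 : u - 1 ≤ n := by
      have : u ≤ max t 0 := hu.2
      push_cast at ht
      rcases le_max_iff.mp this with h | h <;> linarith [(Nat.cast_nonneg n : (0 : ℝ) ≤ n)]
    simp only [delayIter_succ φ n _ h1]

theorem delayIter_eq (φ : ℝ → ℝ) {n k : ℕ} (hk : n ≤ k) {t : ℝ} (ht : t ≤ n) :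
    delayIter b φ k t = delayIter b φ n t := by
  induction k, hk using Nat.le_induction with
  | base => rfl
  | succ k hk ih => rw [delayIter_succ φ k t (ht.trans (by exact_mod_cast hk)), ih]

/-- Existence of solutions with prescribed initial values. -/
theorem DelaySol.exists (hb : LocallyIntegrable b volume) {φ : ℝ → ℝ} (hφ : Continuous φ) :
    ∃ f, DelaySol b f ∧ ∀ t ≤ 0, f t = φ t := by
  have key : ∀ n : ℕ, ∀ t ≤ (n : ℝ), delayIter b φ ⌈t⌉₊ t = delayIter b φ n t := fun n t ht =>
    (delayIter_eq φ (Nat.ceil_le.mpr ht) (Nat.le_ceil t)).symm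
  refine ⟨fun t => delayIter b φ ⌈t⌉₊ t, ⟨?_, fun s t hs hst => ?_⟩, fun t ht => ?_⟩
  · rw [continuous_iff_continuousAt]
    intro t
    obtain ⟨n, hn⟩ := exists_nat_gt t
    have : (fun t => delayIter b φ ⌈t⌉₊ t) =ᶠ[nhds t] delayIter b φ n := by
      filter_upwards [Iio_mem_nhds hn] with u hu
      exact key n u (le_of_lt hu)
    exact (delayIter_continuous hb hφ n).continuousAt.congr this.symm
  · obtain ⟨n, hn⟩ := exists_nat_gt t
    have hn' : t ≤ ((n + 1 : ℕ) : ℝ) := by push_cast; linarith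
    simp only [key (n + 1) t hn', key (n + 1) s (hst.trans hn')]
    have hi := fun s t => Feedback.integrand hb (delayIter_continuous hb hφ n) s t
    rw [delayIter, delayIter, max_eq_left hs, max_eq_left (hs.trans hst), min_eq_right hs,
      min_eq_right (hs.trans hst), add_sub_add_left_eq_sub,
      intervalIntegral.integral_interval_sub_left (hi _ _) (hi _ _)]
    apply intervalIntegral.integral_congr
    intro u hu
    rw [Set.uIcc_of_le hst] at hu
    simp only [key n (u - 1) (by linarith [hu.2])]
  · simp only [key 0 t (by simpa using ht)]
    simp [delayIter, ht]

theorem DelaySol.abs_sub_le (hb : LocallyIntegrable b volume) (hf : DelaySol b f) {s t B : ℝ}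
    (hs : 0 ≤ s) (hst : s ≤ t) (h : ∀ u ∈ Set.Icc (s - 1) (t - 1), |f u| ≤ B) :
    |f t - f s| ≤ B * ∫ u in s..t, |b u| := by
  rw [hf.eq s t hs hst, ← intervalIntegral.integral_const_mul]
  refine (intervalIntegral.abs_integral_le_integral_abs hst).trans ?_
  apply intervalIntegral.integral_mono_on hst (Feedback.integrand hb hf.cont s t).abs
    ((hb.intervalIntegrable' s t).abs.const_mul _)
  intro u hu
  rw [abs_mul, mul_comm]
  exact mul_le_mul_of_nonneg_right (h _ ⟨by linarith [hu.1], by linarith [hu.2]⟩) (abs_nonneg _)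

theorem integral_abs_mono (hb : LocallyIntegrable b volume) {s t t' : ℝ} (hst : s ≤ t)
    (htt : t ≤ t') : ∫ u in s..t, |b u| ≤ ∫ u in s..t', |b u| :=
  intervalIntegral.integral_mono_interval le_rfl hst htt
    (Filter.Eventually.of_forall fun u => abs_nonneg (b u)) (hb.intervalIntegrable' _ _).abs

/-- Growth of solutions from one window to later ones. -/
theorem DelaySol.bound (hb : LocallyIntegrable b volume)
    (hQ : ∀ s, 0 ≤ s → ∫ u in s..(s + 1), |b u| ≤ Q) (hf : DelaySol b f) {τ B : ℝ} (hτ : 0 ≤ τ)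
    (hB : ∀ t ∈ Set.Icc (τ - 1) τ, |f t| ≤ B) (n : ℕ) :
    ∀ t ∈ Set.Icc (τ - 1) (τ + n), |f t| ≤ B * (1 + Q) ^ n := by
  have hB0 : 0 ≤ B := (abs_nonneg _).trans (hB τ ⟨by linarith, le_rfl⟩)
  have hQ0 : 0 ≤ Q := le_trans (intervalIntegral.integral_nonneg (by norm_num)
    fun u _ => abs_nonneg _) (hQ 0 le_rfl)
  induction n with
  | zero => simpa using hB
  | succ n ih =>
    intro t ht
    have hp : 0 ≤ (1 + Q) ^ n := by positivity
    rcases le_total t (τ + n) with h | h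
    · refine (ih t ⟨ht.1, h⟩).trans ?_
      rw [pow_succ]
      have : 0 ≤ B * (1 + Q) ^ n * Q := by positivity
      nlinarith
    · have hn : (0 : ℝ) ≤ n := Nat.cast_nonneg n
      have h2 := ht.2
      push_cast at h2
      have h1 := hf.abs_sub_le hb (s := τ + n) (t := t) (B := B * (1 + Q) ^ n) (by linarith) h
        (fun u hu => ih u ⟨by linarith [hu.1], by linarith [hu.2]⟩)
      have h3 := (integral_abs_mono hb h (by linarith : t ≤ τ + n + 1)).trans
        (hQ (τ + n) (by linarith))
      have h4 := ih (τ + n) ⟨by linarith, le_rfl⟩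
      have h5 : |f t| ≤ |f t - f (τ + n)| + |f (τ + n)| := by
        simpa using abs_add_le (f t - f (τ + n)) (f (τ + n))
      have h6 := mul_le_mul_of_nonneg_left h3 (show 0 ≤ B * (1 + Q) ^ n by positivity)
      rw [pow_succ]
      linarith

theorem DelaySol.bound_exp (hb : LocallyIntegrable b volume)
    (hQ : ∀ s, 0 ≤ s → ∫ u in s..(s + 1), |b u| ≤ Q) (hf : DelaySol b f) {B : ℝ}
    (hB : ∀ t ∈ Set.Icc (-1) 0, |f t| ≤ B) {t : ℝ} (ht : -1 ≤ t) :
    |f t| ≤ B * Real.exp (2 * Q) * Real.exp (Q * t) := by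
  have hB0 : 0 ≤ B := (abs_nonneg _).trans (hB 0 ⟨by linarith, le_rfl⟩)
  have hQ0 : 0 ≤ Q := le_trans (intervalIntegral.integral_nonneg (by norm_num)
    fun u _ => abs_nonneg _) (hQ 0 le_rfl)
  have h := hf.bound hb hQ le_rfl (by simpa using hB) ⌈t⌉₊ t
    ⟨by simpa using ht, by simpa using Nat.le_ceil t⟩
  refine h.trans ?_
  rw [mul_assoc, ← Real.exp_add]
  apply mul_le_mul_of_nonneg_left _ hB0
  have h1 : (1 + Q) ^ ⌈t⌉₊ ≤ Real.exp Q ^ ⌈t⌉₊ :=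
    pow_le_pow_left₀ (by linarith) (by linarith [Real.add_one_le_exp Q]) _
  refine h1.trans ?_
  rw [← Real.exp_nat_mul, Real.exp_le_exp]
  have : (⌈t⌉₊ : ℝ) ≤ t + 2 := by
    rcases le_total t 0 with h | h
    · rw [Nat.ceil_eq_zero.mpr h]; push_cast; linarith
    · linarith [Nat.ceil_lt_add_one h]
  nlinarith

theorem DelaySol.sub (hb : LocallyIntegrable b volume) (hf : DelaySol b f) (hg : DelaySol b g) :
    DelaySol b (fun t => f t - g t) :=
  ⟨hf.cont.sub hg.cont, fun s t hs hst => by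
    have h1 := hf.eq s t hs hst
    have h2 := hg.eq s t hs hst
    simp only [mul_sub]
    rw [intervalIntegral.integral_sub (Feedback.integrand hb hf.cont s t)
      (Feedback.integrand hb hg.cont s t), ← h1, ← h2]
    ring⟩

theorem DelaySol.smul (hf : DelaySol b f) (c : ℝ) : DelaySol b (fun t => c * f t) :=
  ⟨hf.cont.const_mul c, fun s t hs hst => by
    rw [← mul_sub, hf.eq s t hs hst, ← intervalIntegral.integral_const_mul]
    congr 1; ext u; ring⟩

/-- Uniqueness of solutions. -/
theorem DelaySol.unique (hb : LocallyIntegrable b volume)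
    (hQ : ∀ s, 0 ≤ s → ∫ u in s..(s + 1), |b u| ≤ Q) (hf : DelaySol b f) (hg : DelaySol b g)
    (h : ∀ t ∈ Set.Icc (-1) 0, f t = g t) {t : ℝ} (ht : -1 ≤ t) : f t = g t := by
  have := (hf.sub hb hg).bound_exp hb hQ (B := 0) (fun t ht => by simp [h t ht]) ht
  simp only [zero_mul, abs_nonpos_iff] at this
  linarith

theorem DelaySol.shift {γ : ℝ} (hγ : 0 ≤ γ) (hper : ∀ᵐ t ∂volume, b (t + γ) = b t)
    (hf : DelaySol b f) : DelaySol b (fun t => f (t + γ)) :=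
  ⟨hf.cont.comp (continuous_add_const γ), fun s t hs hst => by
    rw [hf.eq (s + γ) (t + γ) (by linarith) (by linarith),
      ← intervalIntegral.integral_comp_add_right (fun u => b u * f (u - 1))]
    apply intervalIntegral.integral_congr_ae
    filter_upwards [hper] with u hu _
    rw [hu, show u + γ - 1 = u - 1 + γ by ring]⟩

theorem exists_window_bound (hb : LocallyIntegrable b volume) {γ : ℝ} (hγ : 0 < γ)
    (hper : ∀ᵐ t ∂volume, b (t + γ) = b t) :
    ∃ Q, 0 ≤ Q ∧ ∀ s, ∫ u in s..(s + 1), |b u| ≤ Q := by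
  have hi : ∀ s t, IntervalIntegrable (fun u => |b u|) volume s t :=
    fun s t => (hb.intervalIntegrable' s t).abs
  have hc : Continuous fun s => ∫ u in s..(s + 1), |b u| := by
    have h0 := intervalIntegral.continuous_primitive hi 0
    have : (fun s : ℝ => ∫ u in s..(s + 1), |b u|) =
        fun s => (∫ u in (0 : ℝ)..(s + 1), |b u|) - ∫ u in (0 : ℝ)..s, |b u| := by
      ext s; rw [intervalIntegral.integral_interval_sub_left (hi _ _) (hi _ _)]
    rw [this]
    exact (h0.comp (continuous_add_const 1)).sub h0
  have hp : Function.Periodic (fun s => ∫ u in s..(s + 1), |b u|) γ := by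
    intro s
    simp only
    rw [show s + γ + 1 = s + 1 + γ by ring,
      ← intervalIntegral.integral_comp_add_right (fun u => |b u|)]
    apply intervalIntegral.integral_congr_ae
    filter_upwards [hper] with u hu _
    rw [hu]
  obtain ⟨Q, hQ⟩ := (isCompact_Icc (a := (0 : ℝ)) (b := γ)).exists_bound_of_continuousOn
    hc.continuousOn
  have hle : ∀ s, ∫ u in s..(s + 1), |b u| ≤ Q := fun s => by
    obtain ⟨y, hy, he⟩ := hp.exists_mem_Ico₀ hγ s
    rw [he]
    exact (le_abs_self _).trans (hQ y ⟨hy.1, hy.2.le⟩)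
  exact ⟨Q, le_trans (intervalIntegral.integral_nonneg (by norm_num)
    fun u _ => abs_nonneg _) (hle 0), hle⟩

end Existence

section IntegratingFactor

/-- Composition with a `C¹` function preserves absolute continuity. -/
theorem AbsolutelyContinuousOnInterval.contDiff_comp {F f : ℝ → ℝ} {s t : ℝ} (hF : ContDiff ℝ 1 F)
    (hf : AbsolutelyContinuousOnInterval f s t) (hfc : ContinuousOn f (Set.uIcc s t)) :
    AbsolutelyContinuousOnInterval (fun x => F (f x)) s t := by
  obtain ⟨R, hR⟩ := isCompact_uIcc.exists_bound_of_continuousOn hfc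
  obtain ⟨K, hK⟩ := hF.contDiffOn.exists_lipschitzOnWith (s := Set.Icc (-R) R) (by decide)
    (convex_Icc _ _) isCompact_Icc
  have hmem : ∀ x ∈ Set.uIcc s t, f x ∈ Set.Icc (-R) R := fun x hx => abs_le.mp (hR x hx)
  rw [absolutelyContinuousOnInterval_iff] at hf ⊢
  intro ε hε
  obtain ⟨η, hη, h⟩ := hf (ε / (K + 1)) (by positivity)
  refine ⟨η, hη, fun (n, I) h1 h2 => ?_⟩
  calc
    _ ≤ ∑ i ∈ Finset.range n, K * dist (f (I i).1) (f (I i).2) := by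
      apply Finset.sum_le_sum
      intro i hi
      exact hK.dist_le_mul _ (hmem _ (h1.left i hi).left) _ (hmem _ (h1.left i hi).right)
    _ = K * ∑ i ∈ Finset.range n, dist (f (I i).1) (f (I i).2) := (Finset.mul_sum _ _ _).symm
    _ ≤ K * (ε / (K + 1)) := by have := h (n, I) h1 h2; gcongr
    _ < (K + 1) * (ε / (K + 1)) := by gcongr; linarith
    _ = ε := by field_simp

variable {α β b f g : ℝ → ℝ}

/-- The integrating factor `exp (-∫₀ᵗ α)`. -/
def iFac (α : ℝ → ℝ) (t : ℝ) : ℝ := Real.exp (-∫ u in (0 : ℝ)..t, α u)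

theorem iFac_pos (t : ℝ) : 0 < iFac α t := Real.exp_pos _

theorem continuous_primitive' (hα : LocallyIntegrable α volume) :
    Continuous fun t => ∫ u in (0 : ℝ)..t, α u :=
  intervalIntegral.continuous_primitive (fun s t => hα.intervalIntegrable' s t) 0

theorem iFac_continuous (hα : LocallyIntegrable α volume) : Continuous (iFac α) :=
  Real.continuous_exp.comp (continuous_primitive' hα).neg

theorem primitive_add_period (hα : LocallyIntegrable α volume) {γ : ℝ}
    (hper : ∀ᵐ t ∂volume, α (t + γ) = α t) (t : ℝ) :
    ∫ u in (0 : ℝ)..(t + γ), α u = (∫ u in (0 : ℝ)..γ, α u) + ∫ u in (0 : ℝ)..t, α u := by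
  rw [← intervalIntegral.integral_add_adjacent_intervals (hα.intervalIntegrable' 0 γ)
    (hα.intervalIntegrable' γ (t + γ))]
  congr 1
  have := intervalIntegral.integral_comp_add_right (a := 0) (b := t) α γ
  rw [zero_add] at this
  rw [← this]
  apply intervalIntegral.integral_congr_ae
  filter_upwards [hper] with u hu _ using hu

theorem iFac_add_period (hα : LocallyIntegrable α volume) {γ : ℝ}
    (hper : ∀ᵐ t ∂volume, α (t + γ) = α t) (t : ℝ) :
    iFac α (t + γ) = iFac α γ * iFac α t := by
  simp only [iFac]
  rw [← Real.exp_add, primitive_add_period hα hper, neg_add]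

theorem iFac_ratio_bound (hα : LocallyIntegrable α volume) {γ : ℝ} (hγ : 0 < γ)
    (hper : ∀ᵐ t ∂volume, α (t + γ) = α t) :
    ∃ ρ > 0, ∀ t, ρ ≤ iFac α (t - 1) / iFac α t := by
  set h : ℝ → ℝ := fun t => iFac α (t - 1) / iFac α t with hh
  have hc : Continuous h := by
    have := iFac_continuous hα
    apply Continuous.div (by fun_prop) (by fun_prop) (fun t => (iFac_pos t).ne')
  have hp : Function.Periodic h γ := by
    intro t
    simp only [hh]
    rw [show t + γ - 1 = t - 1 + γ by ring, iFac_add_period hα hper, iFac_add_period hα hper,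
      mul_div_mul_left _ _ (iFac_pos γ).ne']
  obtain ⟨x, -, hx⟩ := (isCompact_Icc (a := (0 : ℝ)) (b := γ)).exists_isMinOn
    ⟨0, le_rfl, hγ.le⟩ hc.continuousOn
  refine ⟨h x, div_pos (iFac_pos _) (iFac_pos _), fun t => ?_⟩
  obtain ⟨y, hy, he⟩ := hp.exists_mem_Ico₀ hγ t
  change h x ≤ h t
  rw [he]
  exact hx ⟨hy.1, hy.2.le⟩

/-- The coefficient of the transformed equation. -/
def iFacCoeff (α β : ℝ → ℝ) (t : ℝ) : ℝ := -(β t * (iFac α (t - 1) / iFac α t))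

theorem iFacCoeff_locallyIntegrable (hα : LocallyIntegrable α volume)
    (hβ : LocallyIntegrable β volume) : LocallyIntegrable (iFacCoeff α β) volume := by
  have hc : Continuous fun t => iFac α (t - 1) / iFac α t := by
    have := iFac_continuous hα
    apply Continuous.div (by fun_prop) (by fun_prop) (fun t => (iFac_pos t).ne')
  have := (locallyIntegrableOn_univ.mpr hβ).mul_continuousOn hc.continuousOn
    isClosed_univ.isLocallyClosed
  exact (locallyIntegrableOn_univ.mp this).neg

/-- Multiplication with the integrating factor transforms solutions. -/
theorem iFac_mul_sol (hα : LocallyIntegrable α volume) (hβ : LocallyIntegrable β volume)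
    (hf : DelaySol (iFacCoeff α β) f) {t : ℝ} (ht : 0 ≤ t) :
    iFac α t * f t = iFac α 0 * f 0 -
      ∫ s in (0 : ℝ)..t, (α s * (iFac α s * f s) + β s * (iFac α (s - 1) * f (s - 1))) := by
  have hb := iFacCoeff_locallyIntegrable hα hβ
  have hint := Feedback.integrand hb hf.cont
  set F : ℝ → ℝ := fun x => f 0 + ∫ u in (0 : ℝ)..x, iFacCoeff α β u * f (u - 1) with hF
  have hFf : ∀ x, 0 ≤ x → F x = f x := fun x hx => by
    simp only [hF, ← hf.eq 0 x le_rfl hx]; ring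
  have hE : AbsolutelyContinuousOnInterval (iFac α) 0 t := by
    refine AbsolutelyContinuousOnInterval.contDiff_comp (F := fun x => Real.exp (-x))
      (by fun_prop) ?_ (continuous_primitive' hα).continuousOn
    exact (hα.intervalIntegrable' 0 t).absolutelyContinuousOnInterval_intervalIntegral (by simp)
  have hFac : AbsolutelyContinuousOnInterval F 0 t := by
    have h1 := (hint 0 t).absolutelyContinuousOnInterval_intervalIntegral (c := 0) (by simp)
    have h2 : AbsolutelyContinuousOnInterval (fun _ : ℝ => f 0) 0 t :=
      (LipschitzWith.const (f 0)).lipschitzOnWith (s := Set.uIcc 0 t)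
        |>.absolutelyContinuousOnInterval
    exact h2.add h1
  have hli : LocallyIntegrable (fun u => iFacCoeff α β u * f (u - 1)) volume := by
    have hc : Continuous fun u => f (u - 1) := hf.cont.comp (by fun_prop)
    exact locallyIntegrableOn_univ.mp ((locallyIntegrableOn_univ.mpr hb).mul_continuousOn
      hc.continuousOn isClosed_univ.isLocallyClosed)
  have key := hE.integral_deriv_mul_eq_sub hFac
  rw [hFf t ht, hFf 0 le_rfl] at key
  have : ∫ s in (0 : ℝ)..t, (α s * (iFac α s * f s) + β s * (iFac α (s - 1) * f (s - 1))) =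
      -∫ x in (0 : ℝ)..t, deriv (iFac α) x * F x + iFac α x * deriv F x := by
    rw [← intervalIntegral.integral_neg]
    apply intervalIntegral.integral_congr_ae
    filter_upwards [_root_.LocallyIntegrable.ae_hasDerivAt_integral hα,
      _root_.LocallyIntegrable.ae_hasDerivAt_integral hli] with x h1 h2 hx
    rw [Set.uIoc_of_le ht] at hx
    have h3 : HasDerivAt (iFac α) (Real.exp (-∫ u in (0 : ℝ)..x, α u) * -α x) x :=
      (h1 0).neg.exp
    have h4 : HasDerivAt F (iFacCoeff α β x * f (x - 1)) x := (h2 0).const_add (f 0)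
    rw [h3.deriv, h4.deriv, hFf x hx.1.le]
    change _ = -(iFac α x * -α x * f x + iFac α x * (iFacCoeff α β x * f (x - 1)))
    rw [iFacCoeff]
    have := (iFac_pos (α := α) x).ne'
    field_simp
    ring
  rw [this, key]
  ring

end IntegratingFactor

/-- A monodromy operator `M` together with the transformed equation `y'(t) = b(t) y(t-1)`, whose
solutions become solutions of the original equation after multiplication with `E`. -/
structure Floq (b E : ℝ → ℝ) (γ Q δ c₀ : ℝ) (M : CC →L[ℂ] CC) : Prop where
  fb : Feedback b δ c₀
  γpos : 0 < γ
  per : ∀ᵐ t ∂volume, b (t + γ) = b t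
  Qnn : 0 ≤ Q
  window : ∀ s, ∫ u in s..(s + 1), |b u| ≤ Q
  Econt : Continuous E
  Epos : ∀ t, 0 < E t
  Eper : ∀ t, E (t + γ) = E γ * E t
  step : ∀ f g, DelaySol b f → DelaySol b g → ∀ ψ : CC,
    (∀ θ : I01, ψ θ = E θ * (f θ + g θ * Complex.I)) →
    ∀ θ : I01, M ψ θ = E (γ + θ) * (f (γ + θ) + g (γ + θ) * Complex.I)

theorem IsMonodromy.exists_floq {α β : ℝ → ℝ}
    (hα : LocallyIntegrable α volume) (hβ : LocallyIntegrable β volume)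
    {γ : ℝ} (hγ : 0 < γ)
    (hαper : ∀ᵐ t ∂volume, α (t + γ) = α t) (hβper : ∀ᵐ t ∂volume, β (t + γ) = β t)
    {δ β₀ : ℝ} (hδ : δ * δ = 1) (hβ₀ : 0 < -δ * β₀)
    (hsign : ∀ᵐ t ∂volume, -δ * β₀ ≤ -δ * β t)
    {M : CC →L[ℂ] CC} (hM : IsMonodromy α β γ M) :
    ∃ b E Q c₀, Floq b E γ Q δ c₀ M := by
  obtain ⟨ρ, hρ, hratio⟩ := iFac_ratio_bound hα hγ hαper
  have hb := iFacCoeff_locallyIntegrable hα hβ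
  have hper : ∀ᵐ t ∂volume, iFacCoeff α β (t + γ) = iFacCoeff α β t := by
    filter_upwards [hβper] with t ht
    simp only [iFacCoeff]
    rw [ht, show t + γ - 1 = t - 1 + γ by ring, iFac_add_period hα hαper,
      iFac_add_period hα hαper, mul_div_mul_left _ _ (iFac_pos γ).ne']
  obtain ⟨Q, hQ0, hQ⟩ := exists_window_bound hb hγ hper
  refine ⟨iFacCoeff α β, iFac α, Q, -δ * β₀ * ρ, ⟨hb, by positivity, hδ, ?_⟩, hγ, hper, hQ0, hQ,
    iFac_continuous hα, iFac_pos, iFac_add_period hα hαper, fun f g hf hg ψ hψ θ => ?_⟩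
  · filter_upwards [hsign] with t ht
    simp only [iFacCoeff]
    have := mul_le_mul ht (hratio t) hρ.le (hβ₀.le.trans ht)
    linarith
  · refine hM ψ (fun t => iFac α t * (f t + g t * Complex.I)) ⟨?_, fun t ht => ?_⟩
      (fun θ => (hψ θ).symm) θ
    · have h1 := iFac_continuous hα
      have h2 := hf.cont
      have h3 := hg.cont
      fun_prop
    · have hint : ∀ h : ℝ → ℝ, DelaySol (iFacCoeff α β) h → IntervalIntegrable (fun s =>
          α s * (iFac α s * h s) + β s * (iFac α (s - 1) * h (s - 1))) volume 0 t := by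
        intro h hh
        have h1 := iFac_continuous hα
        have h2 := hh.cont
        exact ((hα.intervalIntegrable' 0 t).mul_continuousOn (by fun_prop)).add
          ((hβ.intervalIntegrable' 0 t).mul_continuousOn (by fun_prop))
      have e1 := iFac_mul_sol hα hβ hf ht.1
      have e2 := iFac_mul_sol hα hβ hg ht.1
      have : ∫ s in (0 : ℝ)..t, ((α s : ℂ) * (iFac α s * (f s + g s * Complex.I)) +
          (β s : ℂ) * (iFac α (s - 1) * (f (s - 1) + g (s - 1) * Complex.I))) =
          ((∫ s in (0 : ℝ)..t, (α s * (iFac α s * f s) + β s * (iFac α (s - 1) * f (s - 1))) : ℝ) :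
            ℂ)
          + ((∫ s in (0 : ℝ)..t, (α s * (iFac α s * g s) +
            β s * (iFac α (s - 1) * g (s - 1))) : ℝ) : ℂ) * Complex.I := by
        rw [← intervalIntegral.integral_ofReal, ← intervalIntegral.integral_ofReal,
          ← intervalIntegral.integral_mul_const, ← intervalIntegral.integral_add]
        · apply intervalIntegral.integral_congr
          intro s _
          push_cast
          ring
        · exact ⟨(hint f hf).1.ofReal, (hint f hf).2.ofReal⟩
        · exact IntervalIntegrable.mul_const ⟨(hint g hg).1.ofReal, (hint g hg).2.ofReal⟩ _
      simp only
      rw [this]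
      have e1' := congrArg (fun r : ℝ => (r : ℂ)) e1
      have e2' := congrArg (fun r : ℝ => (r : ℂ)) e2
      push_cast at e1' e2' ⊢
      linear_combination e1' + Complex.I * e2'

/-- A bounded operator on `CC` whose image of the unit ball is equicontinuous is compact. -/
theorem isCompactOperator_of_modulus (T : CC →L[ℂ] CC) (ω : I01 → I01 → ℝ)
    (hω : ∀ x, Filter.Tendsto (ω x) (nhds x) (nhds 0))
    (h : ∀ ψ x y, |(T ψ x).re - (T ψ y).re| ≤ ω x y * ‖ψ‖) : IsCompactOperator T := by
  have hdist : ∀ ψ x y, dist (T ψ x) (T ψ y) ≤ 2 * ω x y * ‖ψ‖ := by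
    intro ψ x y
    have h1 := h ψ x y
    have h2 := h (-Complex.I • ψ) x y
    have e : ∀ x, (T (-Complex.I • ψ) x).re = (T ψ x).im := fun x => by simp
    rw [e, e, norm_smul, norm_neg, Complex.norm_I, one_mul] at h2
    rw [dist_eq_norm]
    have := Complex.norm_le_abs_re_add_abs_im (T ψ x - T ψ y)
    rw [Complex.sub_re, Complex.sub_im] at this
    linarith
  set A : Set (BoundedContinuousFunction I01 ℂ) :=
    {f | (∀ x, f x ∈ Metric.closedBall (0 : ℂ) ‖T‖) ∧ ∀ x y, dist (f x) (f y) ≤ 2 * ω x y} with hA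
  have hAc : IsClosed A := by
    have h1 : ∀ x : I01, Continuous fun f : BoundedContinuousFunction I01 ℂ => f x :=
      fun x => (continuous_eval_const x)
    rw [hA, Set.ofPred_and]
    refine IsClosed.inter ?_ ?_
    · simp only [Set.ofPred_forall]
      exact isClosed_iInter fun x => Metric.isClosed_closedBall.preimage (h1 x)
    · simp only [Set.ofPred_forall]
      exact isClosed_iInter fun x => isClosed_iInter fun y =>
        isClosed_le ((h1 x).dist (h1 y)) continuous_const
  have hAk : IsCompact A := by
    refine BoundedContinuousFunction.arzela_ascoli₂ _ (isCompact_closedBall (0 : ℂ) ‖T‖) A hAc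
      (fun f x hf => hf.1 x) fun x => ?_
    refine Metric.equicontinuousAt_of_continuity_modulus (fun y => 2 * ω x y)
      (by simpa using (hω x).const_mul 2) _ (Filter.Eventually.of_forall fun y f => f.2.2 x y)
  rw [← T.coe_coe, isCompactOperator_iff_image_closedBall_subset_compact _ one_pos]
  refine ⟨(fun f : BoundedContinuousFunction I01 ℂ => f.toContinuousMap) '' A,
    hAk.image (ContinuousMap.isometryEquivBoundedOfCompact I01 ℂ).symm.continuous, ?_⟩
  rintro _ ⟨ψ, hψ, rfl⟩
  rw [mem_closedBall_zero_iff] at hψ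
  refine ⟨BoundedContinuousFunction.mkOfCompact (T ψ), ⟨fun x => ?_, fun x y => ?_⟩, rfl⟩
  · rw [mem_closedBall_zero_iff]
    exact ((T ψ).norm_coe_le_norm x).trans
      ((T.le_opNorm ψ).trans (mul_le_of_le_one_right (norm_nonneg _) hψ))
  · have := hdist ψ x y
    have h0 : 0 ≤ 2 * ω x y := by
      have h1 := h 1 x y
      have : Nonempty I01 := ⟨x⟩
      have h2 : (0 : ℝ) < ‖(1 : CC)‖ := norm_pos_iff.mpr one_ne_zero
      have := nonneg_of_mul_nonneg_left ((abs_nonneg _).trans h1) h2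
      linarith
    exact this.trans (mul_le_of_le_one_right h0 hψ)

/-- The real part, extended to the line by constants. -/
def reExt (ψ : CC) (t : ℝ) : ℝ := (ψ (Set.projIcc (-1) 0 (by norm_num) t)).re

theorem reExt_coe (ψ : CC) (θ : I01) : reExt ψ θ = (ψ θ).re := by
  simp [reExt, Set.projIcc_val]

theorem reExt_of_mem (ψ : CC) {t : ℝ} (ht : t ∈ I01) : reExt ψ t = (ψ ⟨t, ht⟩).re :=
  reExt_coe ψ ⟨t, ht⟩

theorem reExt_continuous (ψ : CC) : Continuous (reExt ψ) := by
  unfold reExt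
  have : Continuous (Set.projIcc (-1 : ℝ) 0 (by norm_num)) := continuous_projIcc
  fun_prop

/-- Functions whose real part does not alternate `N + 2` times. -/
def cone (N : ℕ) : Set CC := {ψ | ¬ Alt (reExt ψ) (N + 2) 0}

theorem Alt.congr_mul {f g e : ℝ → ℝ} {n : ℕ} {t : ℝ} (h : Alt f n t)
    (hg : ∀ x ∈ Set.Icc (t - 1) t, 0 < e x ∧ g x = e x * f x) : Alt g n t := by
  obtain ⟨σ, p, hp, hw⟩ := h
  refine ⟨σ, p, ⟨hp.lt, fun i hi => ?_⟩, hw⟩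
  obtain ⟨h1, h2⟩ := hg _ (hw i hi)
  rw [h2]
  have := mul_pos h1 (hp.sign i hi)
  linarith

theorem smul_mem_cone {N : ℕ} {ψ : CC} (h : ψ ∈ cone N) (c : ℝ) : (c : ℂ) • ψ ∈ cone N := by
  rintro ⟨σ, p, hp, hw⟩
  refine h ⟨σ * c, p, ⟨hp.lt, fun i hi => ?_⟩, hw⟩
  have := hp.sign i hi
  have e : reExt ((c : ℂ) • ψ) (p i) = c * reExt ψ (p i) := by simp [reExt]
  rw [e] at this
  linarith

theorem isClosed_cone (N : ℕ) : IsClosed (cone N) := by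
  rw [← isOpen_compl_iff, isOpen_iff_mem_nhds]
  intro ψ hψ
  rw [Set.mem_compl_iff, cone, Set.mem_ofPred_eq, not_not] at hψ
  obtain ⟨σ, p, hp, hw⟩ := hψ
  have : ∀ᶠ φ : CC in nhds ψ, ∀ i ∈ Finset.range (N + 2), 0 < σ * (-1) ^ i * reExt φ (p i) := by
    rw [Filter.eventually_all_finset]
    intro i hi
    have hc : Continuous fun φ : CC => σ * (-1) ^ i * reExt φ (p i) := by
      unfold reExt
      fun_prop
    exact hc.continuousAt.eventually_const_lt (hp.sign i (Finset.mem_range.mp hi))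
  filter_upwards [this] with φ hφ
  rw [Set.mem_compl_iff, cone, Set.mem_ofPred_eq, not_not]
  exact ⟨σ, p, ⟨hp.lt, fun i hi => hφ i (Finset.mem_range.mpr hi)⟩, hw⟩

theorem mem_cone_of_re_eq {N : ℕ} {φ ψ : CC} (h : φ ∈ cone N) (he : ∀ θ, (ψ θ).re = (φ θ).re) :
    ψ ∈ cone N := by
  have : reExt ψ = reExt φ := by ext t; exact he _
  rwa [cone, Set.mem_ofPred_eq, this]

namespace Floq

variable {b E f g : ℝ → ℝ} {γ Q δ c₀ : ℝ} {M : CC →L[ℂ] CC} {N : ℕ} {ψ : CC}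

/-- Every `ψ` determines a solution with initial value `re ψ`. -/
theorem exists_rep (h : Floq b E γ Q δ c₀ M) (ψ : CC) :
    ∃ f, DelaySol b f ∧ ∀ θ : I01, (ψ θ).re = E θ * f θ := by
  have hc : Continuous fun t => reExt ψ t / E t :=
    (reExt_continuous ψ).div h.Econt fun t => (h.Epos t).ne'
  obtain ⟨f, hf, hi⟩ := DelaySol.exists h.fb.int hc
  refine ⟨f, hf, fun θ => ?_⟩
  rw [hi θ θ.2.2, reExt_coe]
  have := (h.Epos θ).ne'
  field_simp

theorem rep_step (h : Floq b E γ Q δ c₀ M) (hf : DelaySol b f)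
    (hψ : ∀ θ : I01, (ψ θ).re = E θ * f θ) (θ : I01) :
    (M ψ θ).re = E θ * (E γ * f (θ + γ)) := by
  obtain ⟨g, hg, hi⟩ := h.exists_rep (-Complex.I • ψ)
  rw [h.step f g hf hg ψ (fun θ => ?_) θ, add_comm γ, h.Eper]
  · simp; ring
  · have := hi θ
    simp at this
    apply Complex.ext <;> simp [hψ θ, this]

theorem rep_iter (h : Floq b E γ Q δ c₀ M) (hf : DelaySol b f)
    (hψ : ∀ θ : I01, (ψ θ).re = E θ * f θ) (n : ℕ) :
    ∀ θ : I01, ((M ^ n) ψ θ).re = E (n * γ + θ) * f (n * γ + θ) := by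
  induction n generalizing f ψ with
  | zero => simpa using hψ
  | succ n ih =>
    intro θ
    have h1 := ih ((hf.shift h.γpos.le h.per).smul (E γ)) (h.rep_step hf hψ) θ
    have e : ((n + 1 : ℕ) : ℝ) * γ + θ = n * γ + θ + γ := by push_cast; ring
    rw [pow_succ, mul_apply_eq_comp, h1, e, h.Eper]
    ring

theorem unique (h : Floq b E γ Q δ c₀ M) (hf : DelaySol b f) (hg : DelaySol b g)
    (he : ∀ t ∈ I01, f t = g t) {t : ℝ} (ht : -1 ≤ t) : f t = g t :=
  hf.unique h.fb.int (fun s _ => h.window s) hg he ht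

theorem exists_E_lower (h : Floq b E γ Q δ c₀ M) : ∃ e > 0, ∀ t ∈ I01, e ≤ E t := by
  obtain ⟨x, -, hx⟩ := (isCompact_Icc (a := (-1 : ℝ)) (b := 0)).exists_isMinOn
    ⟨0, by norm_num, le_rfl⟩ h.Econt.continuousOn
  exact ⟨E x, h.Epos x, fun t ht => hx ht⟩

theorem E_iter (h : Floq b E γ Q δ c₀ M) (n : ℕ) (t : ℝ) : E (n * γ + t) = E γ ^ n * E t := by
  induction n with
  | zero => simp
  | succ n ih =>
    rw [show ((n + 1 : ℕ) : ℝ) * γ + t = n * γ + t + γ by push_cast; ring, h.Eper, ih]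
    ring

/-- Continuous dependence on the initial values. -/
theorem exists_bound (h : Floq b E γ Q δ c₀ M) (T : ℝ) :
    ∃ C, 0 ≤ C ∧ ∀ ψ : CC, ∀ f, DelaySol b f → (∀ θ : I01, (ψ θ).re = E θ * f θ) →
      ∀ t ∈ Set.Icc (-1) T, |f t| ≤ C * ‖ψ‖ := by
  obtain ⟨e, he, hE⟩ := h.exists_E_lower
  refine ⟨e⁻¹ * (1 + Q) ^ ⌈T⌉₊, by have := h.Qnn; positivity, fun ψ f hf hψ t ht => ?_⟩
  have h0 : ∀ t ∈ Set.Icc (0 - 1 : ℝ) 0, |f t| ≤ e⁻¹ * ‖ψ‖ := by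
    intro t ht
    rw [zero_sub] at ht
    have h1 := hψ ⟨t, ht⟩
    have h2 := (Complex.abs_re_le_norm (ψ ⟨t, ht⟩)).trans (ψ.norm_coe_le_norm ⟨t, ht⟩)
    rw [h1, abs_mul, abs_of_pos (h.Epos _)] at h2
    rw [inv_mul_eq_div, le_div_iff₀ he]
    have := mul_le_mul_of_nonneg_right (hE t ht) (abs_nonneg (f t))
    simp only at h2
    linarith
  have := hf.bound h.fb.int (fun s _ => h.window s) le_rfl h0 ⌈T⌉₊ t
    ⟨by linarith [ht.1], by linarith [ht.2, Nat.le_ceil T]⟩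
  linarith

theorem isCompactOperator (h : Floq b E γ Q δ c₀ M) {p : ℕ} (hp : 1 ≤ p * γ) :
    IsCompactOperator (M ^ p) := by
  obtain ⟨C, hC0, hC⟩ := h.exists_bound (p * γ)
  obtain ⟨E1, hE1⟩ := (isCompact_Icc (a := (-1 : ℝ)) (b := p * γ)).exists_bound_of_continuousOn
    h.Econt.continuousOn
  have hpr : Continuous fun t => ∫ u in (0 : ℝ)..t, |b u| :=
    intervalIntegral.continuous_primitive (fun s t => (h.fb.int.intervalIntegrable' s t).abs) 0
  set G : ℝ → ℝ := fun t => ∫ u in (0 : ℝ)..t, |b u| with hG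
  have hi : ∀ s t, IntervalIntegrable (fun u => |b u|) volume s t :=
    fun s t => (h.fb.int.intervalIntegrable' s t).abs
  have hGs : ∀ s t, ∫ u in s..t, |b u| = G t - G s := fun s t => by
    rw [hG, intervalIntegral.integral_interval_sub_left (hi _ _) (hi _ _)]
  have hE10 : 0 ≤ E1 := (norm_nonneg _).trans (hE1 (-1) ⟨le_rfl, by linarith⟩)
  refine isCompactOperator_of_modulus _ (fun x y =>
    |E (p * γ + x) - E (p * γ + y)| * C + E1 * (C * |G (p * γ + x) - G (p * γ + y)|)) ?_ ?_
  · intro x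
    have hc : Continuous fun y : I01 => |E (p * γ + x) - E (p * γ + y)| * C +
        E1 * (C * |G (p * γ + x) - G (p * γ + y)|) := by
      have := h.Econt
      fun_prop
    simpa using hc.tendsto x
  · intro ψ x y
    obtain ⟨f, hf, hψ⟩ := h.exists_rep ψ
    have hw : ∀ t : I01, p * γ + t ∈ Set.Icc (-1 : ℝ) (p * γ) ∧ 0 ≤ p * γ + t := fun t =>
      ⟨⟨by linarith [t.2.1], by linarith [t.2.2]⟩, by linarith [t.2.1]⟩
    have hfd : ∀ s t, 0 ≤ s → t ≤ p * γ → s ≤ t → |f t - f s| ≤ C * ‖ψ‖ * |G t - G s| := by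
      intro s t hs ht hst
      have := hf.abs_sub_le h.fb.int hs hst (B := C * ‖ψ‖) (fun u hu => hC ψ f hf hψ u
        ⟨by linarith [hu.1], by linarith [hu.2]⟩)
      rw [hGs] at this
      exact this.trans (mul_le_mul_of_nonneg_left (le_abs_self _) (by positivity))
    have hfd2 : |f (p * γ + x) - f (p * γ + y)| ≤
        C * ‖ψ‖ * |G (p * γ + x) - G (p * γ + y)| := by
      rcases le_total ((x : ℝ)) y with hxy | hxy
      · rw [abs_sub_comm, abs_sub_comm (G _)]
        exact hfd _ _ (hw x).2 (hw y).1.2 (by linarith)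
      · exact hfd _ _ (hw y).2 (hw x).1.2 (by linarith)
    rw [h.rep_iter hf hψ, h.rep_iter hf hψ]
    have e : E (p * γ + x) * f (p * γ + x) - E (p * γ + y) * f (p * γ + y) =
      (E (p * γ + x) - E (p * γ + y)) * f (p * γ + x) +
        E (p * γ + y) * (f (p * γ + x) - f (p * γ + y)) := by ring
    rw [e]
    refine (abs_add_le _ _).trans ?_
    rw [abs_mul, abs_mul]
    have h1 := mul_le_mul_of_nonneg_left (hC ψ f hf hψ _ (hw x).1)
      (abs_nonneg (E (p * γ + x) - E (p * γ + y)))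
    have h2 := mul_le_mul (hE1 _ (hw y).1) hfd2 (abs_nonneg _) hE10
    rw [Real.norm_eq_abs] at h2
    linarith

theorem map_star (h : Floq b E γ Q δ c₀ M) (ψ : CC) : M (star ψ) = star (M ψ) := by
  obtain ⟨f, hf, hi⟩ := h.exists_rep ψ
  obtain ⟨g, hg, hj⟩ := h.exists_rep (-Complex.I • ψ)
  have hg' : DelaySol b (fun t => (-1) * g t) := hg.smul (-1)
  have him : ∀ θ : I01, (ψ θ).im = E θ * g θ := fun θ => by
    have := hj θ
    simpa using this
  ext θ
  rw [h.step f _ hf hg' (star ψ) (fun θ => ?_) θ, ContinuousMap.star_apply,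
    h.step f g hf hg ψ (fun θ => ?_) θ]
  · apply Complex.ext <;> simp
  · apply Complex.ext <;> simp [hi θ, him θ]
  · apply Complex.ext <;> simp [hi θ, him θ]

theorem iter_star (h : Floq b E γ Q δ c₀ M) (n : ℕ) (ψ : CC) :
    (M ^ n) (star ψ) = star ((M ^ n) ψ) := by
  induction n generalizing ψ with
  | zero => simp
  | succ n ih => simp only [pow_succ, mul_apply_eq_comp, h.map_star, ih]

theorem alt_rep_iff (h : Floq b E γ Q δ c₀ M)
    (hψ : ∀ θ : I01, (ψ θ).re = E θ * f θ) {n : ℕ} : Alt (reExt ψ) n 0 ↔ Alt f n 0 := by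
  constructor <;> intro hA
  · refine hA.congr_mul (e := fun t => (E t)⁻¹) fun x hx => ⟨inv_pos.mpr (h.Epos x), ?_⟩
    rw [zero_sub] at hx
    rw [reExt_of_mem ψ hx, hψ, inv_mul_cancel_left₀ (h.Epos _).ne']
  · refine hA.congr_mul (e := E) fun x hx => ⟨h.Epos x, ?_⟩
    rw [zero_sub] at hx
    rw [reExt_of_mem ψ hx, hψ]

/-- Alternations of iterates are alternations of the solution on later windows. -/
theorem alt_iter_iff (h : Floq b E γ Q δ c₀ M) (hf : DelaySol b f)
    (hψ : ∀ θ : I01, (ψ θ).re = E θ * f θ) (p : ℕ) {n : ℕ} :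
    Alt (reExt ((M ^ p) ψ)) n 0 ↔ Alt f n (p * γ) := by
  have key : ∀ x (hx : x ∈ I01), reExt ((M ^ p) ψ) x = E (p * γ + x) * f (p * γ + x) :=
    fun x hx => by rw [reExt_of_mem _ hx, h.rep_iter hf hψ]
  constructor
  · rintro ⟨σ, q, hq, hw⟩
    refine ⟨σ, fun i => p * γ + q i, ⟨fun i hi => by simpa using hq.lt i hi, fun i hi => ?_⟩,
      fun i hi => ⟨by linarith [(hw i hi).1], by linarith [(hw i hi).2]⟩⟩
    have h1 := hq.sign i hi
    rw [key _ (by simpa using hw i hi)] at h1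
    exact pos_of_mul_pos_right (by linarith :
      0 < E (p * γ + q i) * (σ * (-1) ^ i * f (p * γ + q i))) (h.Epos _).le
  · rintro ⟨σ, q, hq, hw⟩
    have hw' : ∀ i < n, q i - p * γ ∈ I01 := fun i hi =>
      ⟨by linarith [(hw i hi).1], by linarith [(hw i hi).2]⟩
    refine ⟨σ, fun i => q i - p * γ, ⟨fun i hi => by simpa using hq.lt i hi, fun i hi => ?_⟩,
      fun i hi => by simpa using hw' i hi⟩
    rw [key _ (hw' i hi), add_sub_cancel]
    have := mul_pos (h.Epos (q i)) (hq.sign i hi)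
    linarith

theorem iter_mem_cone (h : Floq b E γ Q δ c₀ M) (hδ : δ = (-1) ^ N) (hψ : ψ ∈ cone N) (p : ℕ) :
    (M ^ p) ψ ∈ cone N := by
  obtain ⟨f, hf, hi⟩ := h.exists_rep ψ
  intro hA
  rw [h.alt_iter_iff hf hi] at hA
  apply hψ
  rw [h.alt_rep_iff hi]
  exact h.fb.alt_backward hf (by rw [hδ, pow_add]; simp) le_rfl
    (mul_nonneg (Nat.cast_nonneg p) h.γpos.le) hA

/-- The cone is mapped into its interior, up to the point `0`. -/
theorem exists_nhds_cone (h : Floq b E γ Q δ c₀ M) (hδ : δ = (-1) ^ N) {p : ℕ}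
    (hp : 2 * N + 4 ≤ p * γ) {φ : CC} (hφ : φ ∈ cone N) (hne : ∃ θ, (φ θ).re ≠ 0) :
    ∃ ε > 0, ∀ ψ, ‖ψ - φ‖ < ε → (M ^ p) ψ ∈ cone N := by
  obtain ⟨f, hf, hi⟩ := h.exists_rep φ
  have hno : ¬ Alt f (N + 2) 0 := by rwa [← h.alt_rep_iff hi]
  obtain ⟨θ, hθ⟩ := hne
  have h1 : Alt f 1 0 := by
    refine alt_one_iff.mpr ⟨θ, by simp, fun h0 => hθ ?_⟩
    rw [hi, h0, mul_zero]
  obtain ⟨ε, hε, hst⟩ := h.fb.stable N hδ 0 le_rfl f hf hno h1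
  obtain ⟨C, hC0, hC⟩ := h.exists_bound (2 * N + 4)
  refine ⟨ε / (C + 1), by positivity, fun ψ hψ => ?_⟩
  obtain ⟨g, hg, hj⟩ := h.exists_rep ψ
  have hclose : ∀ x ∈ Set.Icc (0 - 1 : ℝ) (0 + 2 * N + 4), |g x - f x| ≤ ε := by
    intro x hx
    have h2 := hC (ψ - φ) _ (hg.sub h.fb.int hf) (fun θ => by simp [hi θ, hj θ]; ring) x
      ⟨by linarith [hx.1], by linarith [hx.2]⟩
    refine h2.trans ?_
    rw [lt_div_iff₀ (by positivity)] at hψ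
    nlinarith [norm_nonneg (ψ - φ)]
  have h3 := hst g hg hclose
  intro hA
  rw [h.alt_iter_iff hg hj] at hA
  have hN : (0 : ℝ) ≤ N := Nat.cast_nonneg N
  exact h3 (h.fb.alt_backward hg (by rw [hδ, pow_add]; simp) (by linarith) (by linarith) hA)

end Floq

/-- Between alternation points of a continuous function there are zeros. -/
theorem AltPts.exists_zeros {f : ℝ → ℝ} (hf : Continuous f) {n : ℕ} {σ : ℝ} {p : ℕ → ℝ}
    (h : AltPts f (n + 1) σ p) : ∃ z : Fin n → ℝ, Function.Injective z ∧ ∀ i, f (z i) = 0 := by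
  have : ∀ i : Fin n, ∃ z, p i < z ∧ z < p (i + 1) ∧ f z = 0 := by
    intro i
    have h1 := h.sign i (by omega)
    have h2 := h.sign (i + 1) (by omega)
    have hlt := h.lt i (by omega)
    have hc : ContinuousOn (fun x => σ * (-1) ^ (i : ℕ) * f x) (Set.Icc (p i) (p (i + 1))) := by
      fun_prop
    obtain ⟨z, hz, hz0⟩ := intermediate_value_Icc' hlt.le hc
      (show (0 : ℝ) ∈ Set.Icc _ _ from ⟨by rw [pow_succ] at h2; linarith, h1.le⟩)
    have hz1 : f z = 0 := by
      rcases mul_eq_zero.mp hz0 with h3 | h3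
      · rw [h3] at h1; simp at h1
      · exact h3
    refine ⟨z, lt_of_le_of_ne hz.1 ?_, lt_of_le_of_ne hz.2 ?_, hz1⟩
    · rintro rfl; rw [hz1] at h1; simp at h1
    · rintro rfl; rw [hz1] at h2; simp at h2
  choose z h1 h2 h3 using this
  refine ⟨z, StrictMono.injective fun i j hij => ?_, h3⟩
  exact (h2 i).trans_le ((h.le (show (i : ℕ) + 1 ≤ j from hij) (by omega)).trans (h1 j).le)

section Poly

variable {E : ℝ → ℝ}

/-- Polynomials of degree at most `N` times `E`, as elements of `CC`. -/
def polyC (hE : Continuous E) (N : ℕ) : (Fin (N + 1) → ℂ) →ₗ[ℂ] CC where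
  toFun a := ⟨fun θ => E θ * ∑ j, a j * ((θ : ℝ) : ℂ) ^ (j : ℕ), by fun_prop⟩
  map_add' a c := by
    ext θ
    simp only [Pi.add_apply, add_mul, Finset.sum_add_distrib, mul_add, ContinuousMap.coe_mk,
      ContinuousMap.add_apply]
  map_smul' r a := by
    ext θ
    simp only [Pi.smul_apply, smul_eq_mul, RingHom.id_apply, ContinuousMap.coe_mk,
      ContinuousMap.smul_apply, mul_assoc, ← Finset.mul_sum]
    ring

theorem polyC_apply (hE : Continuous E) (N : ℕ) (a : Fin (N + 1) → ℂ) (θ : I01) :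
    polyC hE N a θ = E θ * ∑ j, a j * ((θ : ℝ) : ℂ) ^ (j : ℕ) := rfl

theorem polyC_re (hE : Continuous E) (N : ℕ) (a : Fin (N + 1) → ℂ) (θ : I01) :
    (polyC hE N a θ).re = E θ * ∑ j, (a j).re * (θ : ℝ) ^ (j : ℕ) := by
  rw [polyC_apply, Complex.re_ofReal_mul, Complex.re_sum]
  congr 1
  refine Finset.sum_congr rfl fun j _ => ?_
  rw [← Complex.ofReal_pow, Complex.re_mul_ofReal]

theorem star_polyC (hE : Continuous E) (N : ℕ) (a : Fin (N + 1) → ℂ) :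
    star (polyC hE N a) = polyC hE N (star a) := by
  ext θ
  simp [polyC_apply]

open Polynomial in
theorem polyC_mem_cone (hE : Continuous E) (hpos : ∀ t, 0 < E t) (N : ℕ) (a : Fin (N + 1) → ℂ) :
    polyC hE N a ∈ cone N := by
  intro hA
  set P : ℝ[X] := ∑ j : Fin (N + 1), C (a j).re * X ^ (j : ℕ) with hP
  have hPe : ∀ x, P.eval x = ∑ j, (a j).re * x ^ (j : ℕ) := fun x => by
    simp [hP, eval_finsetSum]
  have hA' : Alt (fun x => P.eval x) (N + 2) 0 := by
    refine hA.congr_mul (e := fun t => (E t)⁻¹) fun x hx => ⟨inv_pos.mpr (hpos x), ?_⟩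
    rw [zero_sub] at hx
    rw [reExt_of_mem _ hx, polyC_re, inv_mul_cancel_left₀ (hpos _).ne']
    exact hPe x
  obtain ⟨σ, p, hp, -⟩ := hA'
  obtain ⟨z, hz, hz0⟩ := hp.exists_zeros P.continuous
  have hdeg : P.natDegree < Fintype.card (Fin (N + 1)) := by
    rw [Fintype.card_fin, Nat.lt_succ_iff, hP]
    refine natDegree_sum_le_of_forall_le _ _ fun j _ => ?_
    exact (natDegree_C_mul_X_pow_le _ _).trans (by omega)
  have := eq_zero_of_natDegree_lt_card_of_eval_eq_zero P hz hz0 hdeg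
  have h0 := hp.sign 0 (by omega)
  simp [this] at h0

end Poly

namespace Floq

variable {b E f g : ℝ → ℝ} {γ Q δ c₀ : ℝ} {M : CC →L[ℂ] CC} {N : ℕ} {ψ : CC}

/-- Superexponentially decaying iterates give superexponentially decaying solutions. -/
theorem exp_bound_of_iter (h : Floq b E γ Q δ c₀ M) (hf : DelaySol b f)
    (hψ : ∀ θ : I01, (ψ θ).re = E θ * f θ)
    (hs : ∀ q > 0, ∃ C, ∀ n : ℕ, ‖(M ^ n) ψ‖ ≤ C * q ^ n) (ρ : ℝ) :
    ∃ C, ∀ t, -1 ≤ t → |f t| ≤ C * Real.exp (-ρ * t) := by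
  obtain ⟨e, he, hE⟩ := h.exists_E_lower
  have hγ := h.γpos
  obtain ⟨C, hC⟩ := hs (E γ * Real.exp (-|ρ| * γ)) (mul_pos (h.Epos _) (Real.exp_pos _))
  have hC0 : 0 ≤ C := by simpa using (norm_nonneg _).trans (hC 0)
  have hw : ∀ n : ℕ, ∀ t ∈ Set.Icc (n * γ - 1) (n * γ),
      |f t| ≤ C / e * Real.exp (-|ρ| * γ) ^ n := by
    intro n t ht
    have hθ : t - n * γ ∈ I01 := ⟨by linarith [ht.1], by linarith [ht.2]⟩
    have h1 := h.rep_iter hf hψ n ⟨t - n * γ, hθ⟩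
    have h2 := (Complex.abs_re_le_norm _).trans
      ((((M ^ n) ψ).norm_coe_le_norm ⟨t - n * γ, hθ⟩).trans
      (hC n))
    rw [h1, h.E_iter, add_sub_cancel, abs_mul, abs_of_pos (mul_pos (pow_pos (h.Epos γ) n)
      (h.Epos _)), mul_pow] at h2
    have h3 := mul_le_mul_of_nonneg_right (mul_le_mul_of_nonneg_left (hE _ hθ)
      (pow_pos (h.Epos γ) n).le) (abs_nonneg (f t))
    rw [div_mul_eq_mul_div, le_div_iff₀ he]
    have h4 : E γ ^ n * (|f t| * e) ≤ E γ ^ n * (C * Real.exp (-|ρ| * γ) ^ n) := by linarith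
    exact le_of_mul_le_mul_left h4 (pow_pos (h.Epos γ) n)
  refine ⟨C / e * (1 + Q) ^ ⌈γ⌉₊ * Real.exp (|ρ| * γ) * Real.exp (-ρ), fun t ht => ?_⟩
  have hn0 : (0 : ℝ) ≤ (t + 1) / γ := div_nonneg (by linarith) hγ.le
  set n := ⌊(t + 1) / γ⌋₊ with hn
  have h1 : n * γ ≤ t + 1 := (le_div_iff₀ hγ).mp (Nat.floor_le hn0)
  have h2 : t + 1 < (n + 1) * γ := (div_lt_iff₀ hγ).mp (Nat.lt_floor_add_one _)
  have h3 := hf.bound h.fb.int (fun s _ => h.window s) (mul_nonneg (Nat.cast_nonneg n) hγ.le) (hw n)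
    ⌈γ⌉₊ t ⟨by linarith, by linarith [Nat.le_ceil γ]⟩
  have hQ := h.Qnn
  have h4 : Real.exp (-|ρ| * γ) ^ n ≤ Real.exp (|ρ| * γ) * Real.exp (-ρ) * Real.exp (-ρ * t) := by
    rw [← Real.exp_nat_mul, ← Real.exp_add, ← Real.exp_add, Real.exp_le_exp]
    have h5 := mul_le_mul_of_nonneg_left h2.le (abs_nonneg ρ)
    have h6 := mul_le_mul_of_nonneg_right (neg_abs_le ρ) (by linarith : 0 ≤ t + 1)
    have h7 := mul_le_mul_of_nonneg_right (le_abs_self ρ) (by linarith : 0 ≤ t + 1)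
    linarith
  calc |f t| ≤ C / e * Real.exp (-|ρ| * γ) ^ n * (1 + Q) ^ ⌈γ⌉₊ := h3
    _ = C / e * (1 + Q) ^ ⌈γ⌉₊ * Real.exp (-|ρ| * γ) ^ n := by ring
    _ ≤ C / e * (1 + Q) ^ ⌈γ⌉₊ * (Real.exp (|ρ| * γ) * Real.exp (-ρ) * Real.exp (-ρ * t)) := by
      gcongr
    _ = _ := by ring

theorem polyC_eq_zero (h : Floq b E γ Q δ c₀ M) (hδ : δ = (-1) ^ N) (a : Fin (N + 1) → ℂ)
    (ha : ∀ q > 0, ∃ C, ∀ n : ℕ, ‖(M ^ n) (polyC h.Econt N a)‖ ≤ C * q ^ n) : a = 0 := by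
  choose f hf hmono0 using fun j : ℕ => DelaySol.exists h.fb.int (continuous_pow (M := ℝ) j)
  have hbd : ∀ j ≤ N, ∀ t, -1 ≤ t → |f j t| ≤ Real.exp (2 * Q) * Real.exp (Q * t) := by
    intro j _ t ht
    have := (hf j).bound_exp h.fb.int (fun s _ => h.window s) (B := 1) (fun t ht => by
      rw [hmono0 j t ht.2, abs_pow]
      exact pow_le_one₀ (abs_nonneg _) (abs_le.mpr ⟨ht.1, by linarith [ht.2]⟩)) ht
    linarith
  have hre : ∀ a : Fin (N + 1) → ℂ,
      (∀ q > 0, ∃ C, ∀ n : ℕ, ‖(M ^ n) (polyC h.Econt N a)‖ ≤ C * q ^ n) →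
      (fun j => (a j).re) = 0 := by
    intro a ha
    refine h.fb.eq_zero_of_superexp hδ hf (fun j θ hθ => hmono0 j θ hθ.2)
      (Real.one_le_exp (by linarith [h.Qnn])) h.Qnn hbd _ ?_
    refine h.exp_bound_of_iter (DelaySol.sum h.fb.int Finset.univ (fun j : Fin (N + 1) => (a j).re)
      (fun j => hf j)) (fun θ => ?_) ha
    rw [polyC_re]
    simp only [hmono0 _ _ θ.2.2]
  have h1 := hre a ha
  have h2 := hre (-Complex.I • a) fun q hq => by
    obtain ⟨C, hC⟩ := ha q hq
    refine ⟨C, fun n => ?_⟩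
    rw [map_smul, map_smul, norm_smul, norm_neg, Complex.norm_I, one_mul]
    exact hC n
  ext j
  have e1 := congrFun h1 j
  have e2 := congrFun h2 j
  apply Complex.ext
  · simpa using e1
  · simpa using e2

end Floq

section Dimension

/-- On a space of functions of dimension `≥ k`, one can interpolate at `k` suitable points. -/
theorem exists_interpolation (W : Submodule ℂ CC) [FiniteDimensional ℂ W] (k : ℕ)
    (hk : k ≤ Module.finrank ℂ W) :
    ∃ s : Finset I01, s.card = k ∧ ∀ v : I01 → ℂ, ∃ w ∈ W, ∀ θ ∈ s, w θ = v θ := by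
  induction k with
  | zero => exact ⟨∅, rfl, fun v => ⟨0, W.zero_mem, by simp⟩⟩
  | succ k ih =>
    obtain ⟨s, hs, hv⟩ := ih (by omega)
    let L : W →ₗ[ℂ] (s → ℂ) :=
      { toFun := fun w θ => (w : CC) θ
        map_add' := fun _ _ => rfl
        map_smul' := fun _ _ => rfl }
    have hL : LinearMap.ker L ≠ ⊥ := by
      refine LinearMap.ker_ne_bot_of_finrank_lt (K := ℂ) (V := W) (V₂ := s → ℂ) (f := L) ?_
      rw [Module.finrank_fintype_fun_eq_card, Fintype.card_coe]
      omega
    obtain ⟨⟨u, hu⟩, hu0, hne⟩ := Submodule.exists_mem_ne_zero_of_ne_bot hL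
    have hus : ∀ θ ∈ s, u θ = 0 := fun θ hθ => congrFun (LinearMap.mem_ker.mp hu0) ⟨θ, hθ⟩
    have : ∃ θ, u θ ≠ 0 := by
      by_contra! hc
      exact hne (Subtype.ext (ContinuousMap.ext hc))
    obtain ⟨η, hη⟩ := this
    have hηs : η ∉ s := fun hm => hη (hus η hm)
    refine ⟨insert η s, by rw [Finset.card_insert_of_notMem hηs, hs], fun v => ?_⟩
    obtain ⟨w, hw, hwv⟩ := hv v
    refine ⟨w + ((v η - w η) / u η) • u, W.add_mem hw (W.smul_mem _ hu), fun θ hθ => ?_⟩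
    rw [ContinuousMap.add_apply, ContinuousMap.smul_apply, smul_eq_mul]
    rcases Finset.mem_insert.mp hθ with rfl | hθ
    · field_simp
      ring
    · rw [hus θ hθ, mul_zero, add_zero, hwv θ hθ]

theorem finrank_le_of_subset_cone {N : ℕ} (W : Submodule ℂ CC) [FiniteDimensional ℂ W]
    (hW : ∀ ψ ∈ W, ψ ∈ cone N) : Module.finrank ℂ W ≤ N + 1 := by
  by_contra! hlt
  obtain ⟨s, hs, hv⟩ := exists_interpolation W (N + 2) hlt
  classical
  obtain ⟨w, hw, hwv⟩ := hv fun θ =>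
    if h : θ ∈ s then (((-1 : ℝ) ^ (((s.orderIsoOfFin hs).symm ⟨θ, h⟩ : Fin (N + 2)) : ℕ) : ℝ) : ℂ)
    else 0
  refine hW w hw ⟨1, fun i => if h : i < N + 2 then (s.orderIsoOfFin hs ⟨i, h⟩ : I01) else 0,
    ⟨fun i hi => ?_, fun i hi => ?_⟩, fun i hi => ?_⟩
  · rw [dif_pos (by omega), dif_pos hi]
    exact (s.orderIsoOfFin hs).strictMono (by simp)
  · rw [dif_pos hi, reExt_coe, hwv _ (s.orderIsoOfFin hs ⟨i, hi⟩).2,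
      dif_pos (s.orderIsoOfFin hs ⟨i, hi⟩).2]
    simp only [Subtype.coe_eta, OrderIso.symm_apply_apply, Complex.ofReal_re, one_mul]
    rw [← pow_add, Even.neg_one_pow ⟨i, rfl⟩]
    exact one_pos
  · beta_reduce
    rw [dif_pos hi, zero_sub]
    exact (s.orderIsoOfFin hs ⟨i, hi⟩ : I01).2

end Dimension

section SignChanges

theorem pos_mul_neg_one_mul_iff {x y z : ℝ} (h : 0 < z * x) : 0 < z * (-1) * y ↔ x * y < 0 := by
  rcases lt_or_gt_of_ne (left_ne_zero_of_mul h.ne') with hz | hz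
  · have hx := neg_of_mul_pos_right h hz.le
    rw [mul_neg_one, mul_pos_iff_of_pos_left (neg_pos.mpr hz), mul_neg_iff]
    exact ⟨fun hy => Or.inr ⟨hx, hy⟩, fun hy => (hy.resolve_left fun c => c.1.not_gt hx).2⟩
  · have hx := (mul_pos_iff_of_pos_left hz).mp h
    rw [mul_neg_one, neg_mul, neg_pos, mul_neg_iff, mul_neg_iff]
    exact ⟨fun hy => Or.inl ⟨hx, (hy.resolve_right fun c => c.1.not_gt hz).2⟩,
      fun hy => Or.inl ⟨hz, (hy.resolve_right fun c => c.1.not_gt hx).2⟩⟩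

theorem sc_le_of_mem_cone {N : ℕ} {ψ : CC} (h : ψ ∈ cone N) :
    sc (fun θ => (ψ θ).re) ≤ N := by
  refine sSup_le ?_
  rintro _ ⟨k, -, ⟨θ, hmono, -, -, hsgn⟩, rfl⟩
  rw [Nat.cast_le]
  by_contra! hk
  have key : ∀ i, (hi : i < k + 1) → 0 < (ψ (θ 0)).re * (-1) ^ i * (ψ (θ ⟨i, hi⟩)).re := by
    intro i
    induction i with
    | zero =>
      intro hi
      have h0 : (ψ (θ 0)).re * (ψ (θ ⟨1, by omega⟩)).re < 0 := hsgn ⟨0, by omega⟩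
      have : (ψ (θ 0)).re ≠ 0 := fun hz => by simp [hz] at h0
      have := mul_self_pos.mpr this
      simpa using this
    | succ i ih =>
      intro hi
      have h1 := ih (by omega)
      have h2 : (ψ (θ ⟨i, by omega⟩)).re * (ψ (θ ⟨i + 1, hi⟩)).re < 0 := hsgn ⟨i, by omega⟩
      rw [pow_succ, ← mul_assoc]
      exact (pos_mul_neg_one_mul_iff h1).mpr h2
  refine h ⟨(ψ (θ 0)).re, fun i => if hi : i < k + 1 then θ ⟨i, hi⟩ else 0,
    ⟨fun i hi => ?_, fun i hi => ?_⟩, fun i hi => ?_⟩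
  · rw [dif_pos (by omega), dif_pos (by omega)]
    exact hmono (by simp)
  · rw [dif_pos (by omega), reExt_coe]
    exact key i (by omega)
  · beta_reduce
    rw [dif_pos (by omega), zero_sub]
    exact (θ ⟨i, by omega⟩).2

theorem le_sc_of_alt {k : ℕ} (hk : 1 ≤ k) {ψ : CC} (h : Alt (reExt ψ) (k + 1) 0) :
    (k : ℕ∞) ≤ sc (fun θ => (ψ θ).re) := by
  refine le_sSup ⟨k, hk, ?_, rfl⟩
  obtain ⟨σ, p, hp, hw⟩ := h
  rw [zero_sub] at hw
  have hev : ∀ᶠ η in nhds (0 : ℝ), ∀ i ∈ Finset.range (k + 1),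
      0 < σ * (-1) ^ i * reExt ψ ((1 - η) * p i + η * (-(1 / 2))) := by
    rw [Filter.eventually_all_finset]
    intro i hi
    have hc : Continuous fun η : ℝ => σ * (-1) ^ i * reExt ψ ((1 - η) * p i + η * (-(1 / 2))) := by
      have := reExt_continuous ψ
      fun_prop
    refine hc.continuousAt.eventually_const_lt ?_
    simpa using hp.sign i (Finset.mem_range.mp hi)
  obtain ⟨η, ⟨hη0, hη1⟩, hη⟩ := ((show ∀ᶠ η in nhdsWithin 0 (Set.Ioi 0), η ∈ Set.Ioo (0 : ℝ) 1 from
    Ioo_mem_nhdsGT one_pos).and (hev.filter_mono nhdsWithin_le_nhds)).exists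
  have hin : ∀ i < k + 1, -1 < (1 - η) * p i + η * (-(1 / 2)) ∧
      (1 - η) * p i + η * (-(1 / 2)) < 0 := by
    intro i hi
    have := hw i hi
    constructor <;> nlinarith [this.1, this.2]
  have hlt : ∀ i j, i < j → j < k + 1 →
      (1 - η) * p i + η * (-(1 / 2)) < (1 - η) * p j + η * (-(1 / 2)) := by
    intro i j hij hj
    have := hp.lt' hij hj
    nlinarith
  refine ⟨fun i => ⟨(1 - η) * p i + η * (-(1 / 2)), (hin i i.2).1.le, (hin i i.2).2.le⟩,
    fun i j hij => hlt i j hij j.2, (hin _ (by simp)).1, (hin _ (by simp)).2, fun i => ?_⟩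
  have h1 := hη i (Finset.mem_range.mpr (by omega))
  have h2 := hη (i + 1) (Finset.mem_range.mpr (by omega))
  rw [reExt_of_mem _ ⟨(hin i (by omega)).1.le, (hin i (by omega)).2.le⟩] at h1
  rw [reExt_of_mem _ ⟨(hin (i + 1) (by omega)).1.le, (hin (i + 1) (by omega)).2.le⟩, pow_succ,
    ← mul_assoc] at h2
  exact (pos_mul_neg_one_mul_iff h1).mp h2

/-- Functions on the `N`-th level of the discrete Lyapunov functional. -/
theorem vpm_eq {N : ℕ} {ψ : CC} (h : ψ ∈ cone N) (hlow : 2 ≤ N → ψ ∉ cone (N - 2)) :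
    Vpm (N % 2) (fun θ => (ψ θ).re) = N := by
  have h1 := sc_le_of_mem_cone h
  have h2 : ((N - 1 : ℕ) : ℕ∞) ≤ sc (fun θ => (ψ θ).re) := by
    rcases Nat.lt_or_ge N 2 with hN | hN
    · have : N - 1 = 0 := by omega
      simp [this]
    · have := hlow hN
      rw [cone, Set.mem_ofPred_eq, not_not] at this
      exact le_sc_of_alt (by omega) (by rwa [show N - 1 + 1 = N - 2 + 2 by omega])
  generalize hS : sc (fun θ => (ψ θ).re) = S at h1 h2
  obtain ⟨s, rfl⟩ := ENat.ne_top_iff_exists.mp (ne_top_of_le_ne_top (ENat.natCast_ne_top N) h1)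
  rw [Nat.cast_le] at h1 h2
  unfold Vpm
  rw [hS]
  split_ifs with hc
  · obtain ⟨n, hn, hpar⟩ := hc
    rw [Nat.cast_inj] at hn
    have : s + 1 = N := by omega
    rw [← this]; rfl
  · have : s = N := by
      by_contra hne
      exact hc ⟨s, rfl, by omega⟩
    rw [this]

end SignChanges

section SpecSup

variable {X : Type*} [AddCommGroup X] [Module ℂ X]

/-- The sum of the generalized eigenspaces with eigenvalues in `S`. -/
def specSup (f : Module.End ℂ X) (S : Set ℂ) : Submodule ℂ X :=
  ⨆ μ ∈ S, f.maxGenEigenspace μ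

variable {f : Module.End ℂ X} {S S' : Set ℂ} {x : X}

theorem specSup_mono (h : S ⊆ S') : specSup f S ≤ specSup f S' := biSup_mono h

theorem specSup_union : specSup f (S ∪ S') = specSup f S ⊔ specSup f S' := iSup_union

theorem le_specSup {μ : ℂ} (h : μ ∈ S) : f.maxGenEigenspace μ ≤ specSup f S :=
  le_biSup f.maxGenEigenspace h

theorem specSup_disjoint (h : Disjoint S S') : Disjoint (specSup f S) (specSup f S') :=
  f.independent_maxGenEigenspace.disjoint_biSup_biSup h

theorem specSup_mapsTo (hx : x ∈ specSup f S) : f x ∈ specSup f S := by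
  have : specSup f S ≤ (specSup f S).comap f := iSup₂_le fun μ hμ y hy =>
    le_specSup hμ (Module.End.mapsTo_maxGenEigenspace_of_comm (Commute.refl f) μ hy)
  exact this hx

theorem mem_specSup_of_aeval (P : Polynomial ℂ) (hP : P ≠ 0)
    (hx : Polynomial.aeval f P x = 0) (hS : ∀ z, P.IsRoot z → z ∈ S) : x ∈ specSup f S := by
  induction P using UniqueFactorizationMonoid.induction_on_coprime generalizing x with
  | h0 => exact absurd rfl hP
  | h1 hu =>
    obtain ⟨c, hc, rfl⟩ := Polynomial.isUnit_iff.mp hu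
    rw [Polynomial.aeval_C, Module.algebraMap_end_apply] at hx
    rw [(smul_eq_zero_iff_right hc.ne_zero).mp hx]
    exact zero_mem _
  | hpr i hp =>
    rename_i p
    rcases Nat.eq_zero_or_pos i with rfl | hi
    · rw [pow_zero, map_one, Module.End.one_apply] at hx
      rw [hx]; exact zero_mem _
    have hdeg := IsAlgClosed.degree_eq_one_of_irreducible ℂ hp.irreducible
    have h1 : p.leadingCoeff ≠ 0 := by simpa using hp.ne_zero
    have h2 : p.coeff 1 ≠ 0 := by
      rwa [Polynomial.leadingCoeff, Polynomial.natDegree_eq_of_degree_eq_some hdeg] at h1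
    set z := -(p.coeff 0) / p.coeff 1 with hz
    have hpz : p = Polynomial.C (p.coeff 1) * (Polynomial.X - Polynomial.C z) := by
      conv_lhs => rw [Polynomial.eq_X_add_C_of_degree_le_one hdeg.le]
      rw [mul_sub, ← Polynomial.C_mul, hz, mul_div_cancel₀ _ h2, Polynomial.C_neg, sub_neg_eq_add]
    have hroot : z ∈ S := hS z (by
      rw [hpz]
      simp [Polynomial.IsRoot, hi.ne'])
    refine le_specSup hroot ((Module.End.mem_maxGenEigenspace _ _ _).mpr ⟨i, ?_⟩)
    rw [hpz, mul_pow, ← Polynomial.C_pow, Polynomial.C_mul', map_smul, LinearMap.smul_apply,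
      smul_eq_zero_iff_right (pow_ne_zero _ h2)] at hx
    simpa [Algebra.algebraMap_eq_smul_one] using hx
  | hcp hab ha hb =>
    rename_i p q
    have h1 : p ≠ 0 := left_ne_zero_of_mul hP
    have h2 : q ≠ 0 := right_ne_zero_of_mul hP
    have h3 : x ∈ LinearMap.ker (Polynomial.aeval f (p * q)) := hx
    rw [← Polynomial.sup_ker_aeval_eq_ker_aeval_mul_of_coprime f hab.isCoprime] at h3
    obtain ⟨y, hy, z, hz, rfl⟩ := Submodule.mem_sup.mp h3
    refine add_mem (ha h1 hy fun w hw => hS w ?_) (hb h2 hz fun w hw => hS w ?_)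
    · exact Polynomial.root_mul_right_of_isRoot _ hw
    · exact Polynomial.root_mul_left_of_isRoot _ hw

/-- A submodule that is not the whole of `specSup f S` can be extended by one triangular step. -/
theorem exists_step {V : Submodule ℂ X} (h : ¬ specSup f S ≤ V) :
    ∃ μ ∈ S, ∃ x ∈ specSup f S, x ∉ V ∧ f x - μ • x ∈ V := by
  have : ∃ μ ∈ S, ¬ f.maxGenEigenspace μ ≤ V := by
    by_contra! hc
    exact h (iSup₂_le hc)
  obtain ⟨μ, hμ, hnot⟩ := this
  obtain ⟨x, hx, hxV⟩ := SetLike.not_le_iff_exists.mp hnot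
  have hmem : ∀ j, ((f - μ • (1 : Module.End ℂ X)) ^ j) x ∈ f.maxGenEigenspace μ := by
    intro j
    refine Module.End.mapsTo_maxGenEigenspace_of_comm (g := (f - μ • (1 : Module.End ℂ X)) ^ j)
      ?_ μ hx
    exact ((Commute.refl f).sub_right ((Commute.one_right f).smul_right μ)).pow_right j
  obtain ⟨k, hk⟩ := (Module.End.mem_maxGenEigenspace _ _ _).mp hx
  have hex : ∃ j, ((f - μ • (1 : Module.End ℂ X)) ^ j) x ∈ V := ⟨k, by rw [hk]; exact zero_mem _⟩
  classical
  have h0 : Nat.find hex ≠ 0 := fun h0 => hxV (by simpa [h0] using Nat.find_spec hex)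
  obtain ⟨j, hj⟩ := Nat.exists_eq_succ_of_ne_zero h0
  refine ⟨μ, hμ, _, le_specSup hμ (hmem j), Nat.find_min hex (by omega), ?_⟩
  have := Nat.find_spec hex
  rw [hj, pow_succ', Module.End.mul_apply] at this
  simpa using this

end SpecSup

section Riesz

variable {X : Type*} [NormedAddCommGroup X] [NormedSpace ℂ X] {T : X →L[ℂ] X}

theorem pow_sub_smul_mem {V : Submodule ℂ X} (hV : ∀ x ∈ V, T x ∈ V) {y : X} {μ : ℂ}
    (h : T y - μ • y ∈ V) (n : ℕ) : (T ^ n) y - μ ^ n • y ∈ V := by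
  induction n with
  | zero => simp
  | succ n ih =>
    have : (T ^ (n + 1)) y - μ ^ (n + 1) • y =
        T ((T ^ n) y - μ ^ n • y) + μ ^ n • (T y - μ • y) := by
      rw [pow_succ', mul_apply_eq_comp, pow_succ, map_sub, map_smul, smul_sub, smul_smul]
      abel
    rw [this]
    exact add_mem (hV _ ih) (V.smul_mem _ h)

theorem exists_step_normed {S : Set ℂ} {V : Submodule ℂ X} [FiniteDimensional ℂ V]
    (hV : ∀ x ∈ V, T x ∈ V) (hVE : V ≤ specSup T.toLinearMap S)
    (h : ¬ specSup T.toLinearMap S ≤ V) :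
    ∃ V' : Submodule ℂ X, V ≤ V' ∧ V' ≤ specSup T.toLinearMap S ∧ FiniteDimensional ℂ V' ∧
      (∀ x ∈ V', T x ∈ V') ∧ ∃ y ∈ V', ‖y‖ ≤ 3 ∧ (∀ v ∈ V, 1 ≤ ‖y - v‖) ∧
        ∃ μ ∈ S, T y - μ • y ∈ V := by
  obtain ⟨μ, hμ, x, hxE, hxV, hx⟩ := exists_step h
  have hx' : T x - μ • x ∈ V := hx
  have key : ∀ y ∈ V ⊔ Submodule.span ℂ {x}, T y - μ • y ∈ V := by
    intro y hy
    obtain ⟨v, hv, z, hz, rfl⟩ := Submodule.mem_sup.mp hy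
    obtain ⟨c, rfl⟩ := Submodule.mem_span_singleton.mp hz
    have : T (v + c • x) - μ • (v + c • x) = T v - μ • v + c • (T x - μ • x) := by
      rw [map_add, map_smul, smul_add, smul_sub, smul_comm c μ]
      abel
    rw [this]
    exact add_mem (sub_mem (hV v hv) (V.smul_mem _ hv)) (V.smul_mem _ hx')
  have hle : V ≤ V ⊔ Submodule.span ℂ {x} := le_sup_left
  refine ⟨V ⊔ Submodule.span ℂ {x}, hle, sup_le hVE ?_, inferInstance, fun y hy => ?_, ?_⟩
  · rwa [Submodule.span_singleton_le_iff_mem]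
  · have := add_mem (hle (key y hy)) (Submodule.smul_mem _ μ hy)
    rwa [sub_add_cancel] at this
  · have hcl : IsClosed ((V.comap (V ⊔ Submodule.span ℂ {x}).subtype :
        Submodule ℂ ↥(V ⊔ Submodule.span ℂ {x})) : Set ↥(V ⊔ Submodule.span ℂ {x})) :=
      V.closed_of_finiteDimensional.preimage continuous_subtype_val
    obtain ⟨y, hy, hyd⟩ := riesz_lemma_of_norm_lt (c := (2 : ℂ)) (R := 3) (by simp) (by norm_num)
      hcl ⟨⟨x, le_sup_right (a := V) (Submodule.mem_span_singleton_self x)⟩, hxV⟩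
    exact ⟨y, y.2, hy, fun v hv => hyd ⟨v, hle hv⟩ hv, μ, hμ, key y y.2⟩

theorem finiteDimensional_specSup {p : ℕ} (hK : IsCompactOperator (T ^ p)) {r : ℝ} (hr : 0 < r) :
    FiniteDimensional ℂ (specSup T.toLinearMap {μ | r ≤ ‖μ‖}) := by
  by_contra hinf
  let St := {V : Submodule ℂ X // V ≤ specSup T.toLinearMap {μ | r ≤ ‖μ‖} ∧
    FiniteDimensional ℂ V ∧ ∀ x ∈ V, T x ∈ V}
  have step : ∀ V : St, ∃ V' : St, V.1 ≤ V'.1 ∧ ∃ y ∈ V'.1, ‖y‖ ≤ 3 ∧ (∀ v ∈ V.1, 1 ≤ ‖y - v‖) ∧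
      ∃ μ : ℂ, r ≤ ‖μ‖ ∧ T y - μ • y ∈ V.1 := by
    rintro ⟨V, hVE, hfin, hinv⟩
    obtain ⟨V', h1, h2, h3, h4, h5⟩ := exists_step_normed hinv hVE fun hle =>
      hinf (Submodule.finiteDimensional_of_le hle)
    exact ⟨⟨V', h2, h3, h4⟩, h1, h5⟩
  choose nxt hle y hy hy3 hyd μ hμ hyμ using step
  let V : ℕ → St := fun n => Nat.rec ⟨⊥, bot_le, inferInstance, by simp⟩ (fun _ W => nxt W) n
  have hVs : ∀ n, V (n + 1) = nxt (V n) := fun _ => rfl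
  have hmono : Monotone fun n => (V n).1 := monotone_nat_of_le_succ fun n => hle (V n)
  have hsep : ∀ m n, m < n → r ^ p ≤ ‖(T ^ p) (y (V n)) - (T ^ p) (y (V m))‖ := by
    intro m n hmn
    have hinv := (V n).2.2.2
    have hm : y (V m) ∈ (V n).1 := hmono (Nat.succ_le_of_lt hmn) (hy (V m))
    have hpow : ∀ k : ℕ, (T ^ k) (y (V m)) ∈ (V n).1 := by
      intro k
      induction k with
      | zero => simpa using hm
      | succ k ih => rw [pow_succ', mul_apply_eq_comp]; exact hinv _ ih
    have h1 := pow_sub_smul_mem hinv (hyμ (V n)) p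
    have hμ0 : μ (V n) ^ p ≠ 0 := pow_ne_zero _ (norm_pos_iff.mp (hr.trans_le (hμ _)))
    have h2 : (μ (V n) ^ p)⁻¹ • ((T ^ p) (y (V m)) - ((T ^ p) (y (V n)) - μ (V n) ^ p • y (V n))) ∈
        (V n).1 := Submodule.smul_mem _ _ (sub_mem (hpow p) h1)
    have h3 := hyd (V n) _ h2
    have h4 : (T ^ p) (y (V n)) - (T ^ p) (y (V m)) = μ (V n) ^ p • (y (V n) -
        (μ (V n) ^ p)⁻¹ • ((T ^ p) (y (V m)) - ((T ^ p) (y (V n)) - μ (V n) ^ p • y (V n)))) := by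
      rw [smul_sub, smul_inv_smul₀ hμ0]
      abel
    rw [h4, norm_smul, norm_pow]
    exact (pow_le_pow_left₀ hr.le (hμ _) p).trans (le_mul_of_one_le_right (by positivity) h3)
  obtain ⟨C, hC, hsub⟩ := IsCompactOperator.image_closedBall_subset_compact
    (f := (T ^ p).toLinearMap) hK 3
  obtain ⟨a, -, φ, hφ, hlim⟩ := hC.tendsto_subseq (x := fun n => (T ^ p) (y (V n))) fun n =>
    hsub ⟨y (V n), by simpa using hy3 (V n), rfl⟩
  obtain ⟨n, hn⟩ := Metric.cauchySeq_iff.mp hlim.cauchySeq (r ^ p) (pow_pos hr p)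
  have h1 := hn (n + 1) (by omega) n le_rfl
  rw [dist_eq_norm] at h1
  exact absurd (hsep _ _ (hφ (Nat.lt_succ_self n))) (not_le.mpr h1)

end Riesz

section PowBound

open Filter Topology ENNReal NNReal in
/-- An element whose spectrum lies in an open disc has powers decaying at a smaller rate. -/
theorem exists_norm_pow_le {A : Type*} [NormedRing A] [NormedAlgebra ℂ A] [CompleteSpace A]
    (a : A) {r : ℝ} (hr : 0 < r) (h : ∀ z ∈ spectrum ℂ a, ‖z‖ < r) :
    ∃ q, 0 < q ∧ q < r ∧ ∃ C, ∀ n : ℕ, ‖a ^ n‖ ≤ C * q ^ n := by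
  rcases subsingleton_or_nontrivial A with hA | hA
  · exact ⟨r / 2, by linarith, by linarith, 0, fun n => by
      rw [Subsingleton.elim (a ^ n) 0, norm_zero, zero_mul]⟩
  lift r to ℝ≥0 using hr.le
  have h1 : spectralRadius ℂ a < r := spectrum.spectralRadius_lt_of_forall_lt a fun z hz => by
    exact_mod_cast h z hz
  obtain ⟨q, hq1, hq2⟩ := ENNReal.lt_iff_exists_nnreal_btwn.mp h1
  have hq2' : q < r := by exact_mod_cast hq2
  have hq0 : 0 < q := by
    rcases eq_zero_or_pos q with rfl | hq
    · simp at hq1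
    · exact hq
  have h2 := (spectrum.pow_nnnorm_pow_one_div_tendsto_nhds_spectralRadius a).eventually_lt_const hq1
  obtain ⟨N, hN⟩ := eventually_atTop.mp (h2.and (eventually_gt_atTop 0))
  have h3 : ∀ n ≥ N, ‖a ^ n‖ ≤ (q : ℝ) ^ n := by
    intro n hn
    obtain ⟨h4, h5⟩ := hN n hn
    have h6 : (‖a ^ n‖₊ : ℝ≥0∞) ≤ (q : ℝ≥0∞) ^ n := by
      have := ENNReal.rpow_le_rpow h4.le (Nat.cast_nonneg (α := ℝ) n)
      rwa [← ENNReal.rpow_mul, one_div_mul_cancel (by positivity), ENNReal.rpow_one,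
        ENNReal.rpow_natCast] at this
    exact_mod_cast h6
  have hq0' : (0 : ℝ) < q := hq0
  refine ⟨q, hq0', hq2', 1 + ∑ i ∈ Finset.range N, ‖a ^ i‖ / (q : ℝ) ^ i, fun n => ?_⟩
  rcases lt_or_ge n N with hn | hn
  · have := Finset.single_le_sum (f := fun i => ‖a ^ i‖ / (q : ℝ) ^ i)
      (fun i _ => by positivity) (Finset.mem_range.mpr hn)
    have h4 : ‖a ^ n‖ / (q : ℝ) ^ n ≤ 1 + ∑ i ∈ Finset.range N, ‖a ^ i‖ / (q : ℝ) ^ i := by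
      linarith
    rwa [div_le_iff₀ (by positivity)] at h4
  · refine (h3 n hn).trans (le_mul_of_one_le_left (by positivity) ?_)
    exact le_add_of_nonneg_right (Finset.sum_nonneg fun i _ => by positivity)

variable {X : Type*} [NormedAddCommGroup X] [NormedSpace ℂ X] {T : X →L[ℂ] X}

theorem restrict_pow_apply {F : Submodule ℂ X} (hF : ∀ x ∈ F, T x ∈ F) (n : ℕ) (x : F) :
    (((T.restrict hF) ^ n) x : X) = (T ^ n) x := by
  induction n with
  | zero => simp
  | succ n ih =>
    rw [pow_succ', pow_succ', mul_apply_eq_comp, mul_apply_eq_comp,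
      ContinuousLinearMap.coe_restrict_apply, ih]

theorem exists_norm_pow_apply_le [CompleteSpace X] {r : ℝ} (hr : 0 < r)
    (h : ∀ z ∈ spectrum ℂ T, ‖z‖ < r) :
    ∃ q, 0 < q ∧ q < r ∧ ∃ C, ∀ (n : ℕ) (x : X), ‖(T ^ n) x‖ ≤ C * q ^ n * ‖x‖ := by
  obtain ⟨q, hq, hqr, C, hC⟩ := exists_norm_pow_le T hr h
  exact ⟨q, hq, hqr, C, fun n x => (T ^ n).le_of_opNorm_le (hC n) x⟩

theorem exists_norm_pow_le_on {F : Submodule ℂ X} [CompleteSpace F] (hF : ∀ x ∈ F, T x ∈ F)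
    {r : ℝ} (hr : 0 < r) (h : ∀ z ∈ spectrum ℂ (T.restrict hF), ‖z‖ < r) :
    ∃ q, 0 < q ∧ q < r ∧ ∃ C, ∀ n : ℕ, ∀ x ∈ F, ‖(T ^ n) x‖ ≤ C * q ^ n * ‖x‖ := by
  obtain ⟨q, hq, hqr, C, hC⟩ := exists_norm_pow_apply_le hr h
  refine ⟨q, hq, hqr, C, fun n x hx => ?_⟩
  have := hC n ⟨x, hx⟩
  rwa [← Submodule.norm_coe, ← Submodule.norm_coe, restrict_pow_apply] at this

end PowBound

section Decay

variable {X : Type*} [NormedAddCommGroup X] [NormedSpace ℂ X]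

/-- The vectors whose iterates decay at an exponential rate smaller than `r > 0`. -/
def decay (T : X →L[ℂ] X) (r : ℝ) : Submodule ℂ X where
  carrier := {x | 0 < r → ∃ q, 0 < q ∧ q < r ∧ ∃ C, ∀ n : ℕ, ‖(T ^ n) x‖ ≤ C * q ^ n}
  zero_mem' := fun hr => ⟨r / 2, by linarith, by linarith, 0, fun n => by simp⟩
  add_mem' := by
    intro x y hx hy hr
    obtain ⟨q, hq, hqr, C, hC⟩ := hx hr
    obtain ⟨q', hq', hqr', C', hC'⟩ := hy hr
    have h0 : 0 ≤ C := by simpa using (norm_nonneg _).trans (hC 0)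
    have h0' : 0 ≤ C' := by simpa using (norm_nonneg _).trans (hC' 0)
    refine ⟨max q q', lt_max_of_lt_left hq, max_lt hqr hqr', C + C', fun n => ?_⟩
    rw [map_add, add_mul]
    refine (norm_add_le _ _).trans (add_le_add ((hC n).trans ?_) ((hC' n).trans ?_))
    · exact mul_le_mul_of_nonneg_left (pow_le_pow_left₀ hq.le (le_max_left _ _) n) h0
    · exact mul_le_mul_of_nonneg_left (pow_le_pow_left₀ hq'.le (le_max_right _ _) n) h0'
  smul_mem' := by
    intro c x hx hr
    obtain ⟨q, hq, hqr, C, hC⟩ := hx hr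
    refine ⟨q, hq, hqr, ‖c‖ * C, fun n => ?_⟩
    rw [map_smul, norm_smul, mul_assoc]
    exact mul_le_mul_of_nonneg_left (hC n) (norm_nonneg c)

variable {T : X →L[ℂ] X}

theorem aeval_clm_apply (P : Polynomial ℂ) (x : X) :
    (Polynomial.aeval T P) x = (Polynomial.aeval T.toLinearMap P) x := by
  have hpow : ∀ n : ℕ, (T ^ n) x = ((T.toLinearMap : Module.End ℂ X) ^ n) x := fun n => by
    rw [Module.End.pow_apply, FunLike.coe_pow_eq_iterate]; rfl
  rw [Polynomial.aeval_eq_sum_range, Polynomial.aeval_eq_sum_range]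
  simp [hpow]

theorem aeval_restrict_apply {f : Module.End ℂ X} {F : Submodule ℂ X} (hF : ∀ x ∈ F, f x ∈ F)
    (P : Polynomial ℂ) (x : F) :
    ((Polynomial.aeval (f.restrict hF) P) x : X) = (Polynomial.aeval f P) (x : X) := by
  rw [Polynomial.aeval_eq_sum_range, Polynomial.aeval_eq_sum_range]
  have hpow : ∀ n : ℕ, (((f.restrict hF) ^ n) x : X) = (f ^ n) x := fun n => by
    rw [Module.End.pow_restrict, LinearMap.restrict_apply]
  simp [LinearMap.sum_apply, hpow]

end Decay

section Decomposition

open Polynomial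

variable {X : Type*} [NormedAddCommGroup X] [NormedSpace ℂ X] {T : X →L[ℂ] X}

theorem le_norm_of_pow_eigen {f : Module.End ℂ X} {p : ℕ} (hp : 0 < p) {r : ℝ} (hr : 0 < r) {x : X}
    (hx : x ∈ specSup f {μ | r ≤ ‖μ‖}) (hx0 : x ≠ 0) {ν : ℂ} (hν : (f ^ p) x = ν • x) :
    r ^ p ≤ ‖ν‖ := by
  by_contra! hlt
  have h1 : x ∈ specSup f {μ | ‖μ‖ < r} := by
    refine mem_specSup_of_aeval (Polynomial.X ^ p - C ν) (X_pow_sub_C_ne_zero hp ν) ?_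
      fun z hz => ?_
    · simp [hν, Module.algebraMap_end_apply]
    · rw [IsRoot, eval_sub, eval_pow, eval_X, eval_C, sub_eq_zero] at hz
      rw [← hz, norm_pow] at hlt
      exact lt_of_pow_lt_pow_left₀ p hr.le hlt
  exact hx0 (Submodule.disjoint_def.mp (specSup_disjoint (f := f) (S := {μ | r ≤ ‖μ‖})
    (S' := {μ | ‖μ‖ < r}) (Set.disjoint_left.mpr fun μ (h2 : r ≤ ‖μ‖) (h3 : ‖μ‖ < r) => absurd h2
      (not_le.mpr h3))) x hx h1)

/-- A polynomial in a power of `T` whose kernel, and that of its square, is a spectral subspace. -/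
theorem exists_annihilator {p : ℕ} (hp : 0 < p) {r : ℝ} (hr : 0 < r)
    [FiniteDimensional ℂ (specSup T.toLinearMap {μ | r ≤ ‖μ‖})] :
    ∃ P : ℂ[X], P.eval 0 ≠ 0 ∧
      (∀ x ∈ specSup T.toLinearMap {μ | r ≤ ‖μ‖}, aeval (T ^ p) P x = 0) ∧
      ∀ x, aeval (T ^ p) P (aeval (T ^ p) P x) = 0 → x ∈ specSup T.toLinearMap {μ | r ≤ ‖μ‖} := by
  set f : Module.End ℂ X := T.toLinearMap with hf
  set E := specSup f {μ | r ≤ ‖μ‖} with hE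
  have hpowT : (T ^ p).toLinearMap = f ^ p := by
    ext x
    rw [Module.End.pow_apply, ContinuousLinearMap.coe_coe, FunLike.coe_pow_eq_iterate]; rfl
  have hinv : ∀ x ∈ E, (f ^ p) x ∈ E := fun x hx => by
    rw [Module.End.pow_apply]
    exact (show Set.MapsTo f E E from fun y hy => specSup_mapsTo hy).iterate p hx
  set g := (f ^ p).restrict hinv with hg
  have hroot : ∀ ν, g.charpoly.IsRoot ν → r ^ p ≤ ‖ν‖ := by
    intro ν hν
    obtain ⟨e, he⟩ := ((Module.End.hasEigenvalue_iff_isRoot_charpoly g ν).mpr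
      hν).exists_hasEigenvector
    exact le_norm_of_pow_eigen hp hr e.2 (fun h0 => he.2 (Subtype.ext h0))
      (congrArg Subtype.val he.apply_eq_smul)
  refine ⟨g.charpoly, fun h0 => ?_, fun x hx => ?_, fun x hx => ?_⟩
  · have := hroot 0 h0
    rw [norm_zero] at this
    exact absurd this (not_le.mpr (pow_pos hr p))
  · rw [aeval_clm_apply, hpowT]
    have := aeval_restrict_apply hinv g.charpoly ⟨x, hx⟩
    rw [← this, LinearMap.aeval_self_charpoly]
    rfl
  · rw [aeval_clm_apply, aeval_clm_apply, hpowT, ← Module.End.mul_apply, ← map_mul] at hx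
    have h1 : aeval f ((g.charpoly * g.charpoly).comp (Polynomial.X ^ p)) x = 0 := by
      rw [aeval_comp, map_pow, aeval_X, hx]
    have hmon := (g.charpoly_monic.mul g.charpoly_monic).comp (monic_X_pow p)
      (by simpa using hp.ne')
    refine mem_specSup_of_aeval _ hmon.ne_zero h1 fun z hz => ?_
    rw [IsRoot, eval_comp, eval_mul, mul_self_eq_zero, eval_pow, eval_X] at hz
    have := hroot _ hz
    rw [norm_pow] at this
    exact le_of_pow_le_pow_left₀ hp.ne' (norm_nonneg z) this

theorem isCompactOperator_aeval_sub {K : X →L[ℂ] X} (hK : IsCompactOperator K) (P : ℂ[X]) :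
    IsCompactOperator (aeval K P - (P.eval 0) • (1 : X →L[ℂ] X)) := by
  have h1 : aeval K P = aeval K P.divX * K + (P.eval 0) • (1 : X →L[ℂ] X) := by
    conv_lhs => rw [← P.divX_mul_X_add]
    rw [map_add, map_mul, aeval_X, aeval_C, Algebra.algebraMap_eq_smul_one, coeff_zero_eq_eval_zero]
  rw [h1, add_sub_cancel_right]
  exact hK.clm_comp (aeval K P.divX)

theorem isUnit_of_injective [CompleteSpace X] {B : X →L[ℂ] X} {c : ℂ} (hc : c ≠ 0)
    (hB : IsCompactOperator (B - c • (1 : X →L[ℂ] X))) (hinj : ∀ x, B x = 0 → x = 0) :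
    IsUnit B := by
  rcases hB.hasEigenvalue_or_mem_resolventSet (neg_ne_zero.mpr hc) with h | h
  · obtain ⟨x, hx⟩ := h.exists_hasEigenvector
    refine absurd (hinj x ?_) hx.2
    have : (B - c • (1 : X →L[ℂ] X)) x = (-c) • x := hx.apply_eq_smul
    simpa using this
  · rw [spectrum.mem_resolventSet_iff, Algebra.algebraMap_eq_smul_one] at h
    have := h.neg
    simpa using this

theorem specSup_sup_decay [CompleteSpace X] {p : ℕ} (hp : 0 < p) (hK : IsCompactOperator (T ^ p))
    {r : ℝ} (hr : 0 < r) : specSup T.toLinearMap {μ | r ≤ ‖μ‖} ⊔ decay T r = ⊤ := by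
  have hfin := finiteDimensional_specSup hK hr
  obtain ⟨P, hP0, hPE, hPE'⟩ := exists_annihilator (T := T) hp hr
  set E := specSup T.toLinearMap {μ | r ≤ ‖μ‖} with hE
  set A := aeval (T ^ p) P with hA
  have hproper : ProperSpace E := FiniteDimensional.proper ℂ E
  obtain ⟨π, hπ⟩ := Submodule.ClosedComplemented.of_finiteDimensional E
  set B := A + E.subtypeL ∘L π with hB
  have hinj : ∀ x, B x = 0 → x = 0 := by
    intro x hx
    have h1 : A x = -(π x : X) := eq_neg_of_add_eq_zero_left hx
    have h2 : x ∈ E := hPE' x (by rw [h1, map_neg, hPE _ (π x).2, neg_zero])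
    have h3 := hPE x h2
    rw [h1, neg_eq_zero] at h3
    have h4 := congrArg Subtype.val (hπ ⟨x, h2⟩)
    exact h4.symm.trans h3
  have hBc : IsCompactOperator (B - (P.eval 0) • (1 : X →L[ℂ] X)) := by
    have h1 : B - (P.eval 0) • (1 : X →L[ℂ] X) =
        (A - (P.eval 0) • (1 : X →L[ℂ] X)) + E.subtypeL ∘L π := by rw [hB]; abel
    rw [h1]
    exact (isCompactOperator_aeval_sub hK P).add
      ((isCompactOperator_of_locallyCompactSpace_dom π).clm_comp E.subtypeL)
  obtain ⟨u, hu⟩ := isUnit_of_injective hP0 hBc hinj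
  have hBinv : ∀ x, B ((↑u⁻¹ : X →L[ℂ] X) x) = x := fun x => by
    rw [← hu, ← mul_apply_eq_comp, Units.mul_inv]; rfl
  have hdisj : ∀ x, A x ∈ E → A x = 0 := fun x hx => hPE x (hPE' x (hPE _ hx))
  let F : Submodule ℂ X := LinearMap.ker (π ∘L (↑u⁻¹ : X →L[ℂ] X)).toLinearMap
  have hF : ∀ x, x ∈ F ↔ ∃ y, A y = x := by
    intro x
    have h1 : A ((↑u⁻¹ : X →L[ℂ] X) x) + π ((↑u⁻¹ : X →L[ℂ] X) x) = x := hBinv x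
    constructor
    · intro hx
      have h2 : π ((↑u⁻¹ : X →L[ℂ] X) x) = 0 := hx
      exact ⟨_, by rwa [h2, Submodule.coe_zero, add_zero] at h1⟩
    · rintro ⟨y, rfl⟩
      have h2 : A (y - (↑u⁻¹ : X →L[ℂ] X) (A y)) = π ((↑u⁻¹ : X →L[ℂ] X) (A y)) := by
        rw [map_sub, sub_eq_iff_eq_add, add_comm]
        exact h1.symm
      have h3 := hdisj _ (by rw [h2]; exact (π _).2)
      rw [h2] at h3
      exact Subtype.ext h3
  have hFcl : IsClosed (F : Set X) := (π ∘L (↑u⁻¹ : X →L[ℂ] X)).isClosed_ker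
  have hcomm : ∀ y, T (A y) = A (T y) := fun y => by
    have h1 : Commute T A := by
      have h2 := (Commute.all Polynomial.X (P.comp (Polynomial.X ^ p))).map (aeval T)
      rwa [aeval_comp, map_pow, aeval_X] at h2
    exact congrArg (fun L : X →L[ℂ] X => L y) h1.eq
  have hFinv : ∀ x ∈ F, T x ∈ F := by
    intro x hx
    obtain ⟨y, rfl⟩ := (hF x).mp hx
    exact (hF _).mpr ⟨T y, (hcomm y).symm⟩
  have hFE : ∀ x ∈ F, x ∈ E → x = 0 := by
    intro x hx hxE
    obtain ⟨y, rfl⟩ := (hF x).mp hx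
    exact hdisj y hxE
  have hcomplete : CompleteSpace F := hFcl.completeSpace_coe
  have hinvp : ∀ x ∈ F, (T ^ p) x ∈ F := fun x hx => by
    rw [← restrict_pow_apply hFinv p ⟨x, hx⟩]; exact Subtype.prop _
  have hpow : (T.restrict hFinv) ^ p = (T ^ p).restrict hinvp := by
    ext x
    exact restrict_pow_apply hFinv p x
  have hKF : IsCompactOperator ((T.restrict hFinv) ^ p) := by
    rw [hpow]
    exact IsCompactOperator.restrict (f := (T ^ p).toLinearMap) hK hinvp hFcl
  have hspec : ∀ z ∈ spectrum ℂ (T.restrict hFinv), ‖z‖ < r := by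
    intro z hz
    by_contra! hzr
    have hz0 : z ≠ 0 := norm_pos_iff.mp (hr.trans_le hzr)
    have h1 := spectrum.pow_mem_pow (T.restrict hFinv) p hz
    rw [← hKF.hasEigenvalue_iff_mem_spectrum (pow_ne_zero p hz0)] at h1
    obtain ⟨x, hx⟩ := h1.exists_hasEigenvector
    have h2 : (T ^ p) (x : X) = z ^ p • (x : X) := by
      rw [← restrict_pow_apply hFinv p x]
      exact congrArg Subtype.val hx.apply_eq_smul
    refine hx.2 (Subtype.ext (hFE x x.2 ?_))
    refine mem_specSup_of_aeval (Polynomial.X ^ p - C (z ^ p)) (X_pow_sub_C_ne_zero hp _) ?_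
      fun w hw => ?_
    · rw [← aeval_clm_apply]
      rw [map_sub, map_pow, aeval_X, aeval_C, sub_apply, h2, Algebra.algebraMap_eq_smul_one]
      exact sub_self _
    · rw [IsRoot, eval_sub, eval_pow, eval_X, eval_C, sub_eq_zero] at hw
      have h3 := congrArg norm hw
      rw [norm_pow, norm_pow] at h3
      exact hzr.trans ((pow_left_inj₀ (norm_nonneg w) (norm_nonneg z) hp.ne').mp h3).ge
  obtain ⟨q, hq, hqr, C, hC⟩ := exists_norm_pow_le_on hFinv hr hspec
  rw [eq_top_iff]
  intro x _
  have h1 : A ((↑u⁻¹ : X →L[ℂ] X) x) + π ((↑u⁻¹ : X →L[ℂ] X) x) = x := hBinv x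
  rw [← h1, add_comm]
  refine Submodule.add_mem_sup (π _).2 fun _ => ⟨q, hq, hqr, C * ‖A ((↑u⁻¹ : X →L[ℂ] X) x)‖,
    fun n => ?_⟩
  have := hC n _ ((hF _).mpr ⟨_, rfl⟩ : A ((↑u⁻¹ : X →L[ℂ] X) x) ∈ F)
  linarith

end Decomposition

section SpectralBounds

variable {X : Type*} [NormedAddCommGroup X] [NormedSpace ℂ X] {T : X →L[ℂ] X} {S : Set ℂ}

theorem mem_specSup_of_eigen {f : Module.End ℂ X} {μ : ℂ} (hμ : μ ∈ S) {x : X}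
    (hx : f x = μ • x) : x ∈ specSup f S := by
  refine mem_specSup_of_aeval (Polynomial.X - Polynomial.C μ) (Polynomial.X_sub_C_ne_zero μ) ?_
    fun z hz => ?_
  · rw [map_sub, Polynomial.aeval_X, Polynomial.aeval_C, LinearMap.sub_apply, hx,
      Module.algebraMap_end_apply, sub_self]
  · exact Polynomial.root_X_sub_C.mp hz ▸ hμ

theorem specSup_clm_mapsTo (T : X →L[ℂ] X) (S : Set ℂ) :
    ∀ x ∈ specSup T.toLinearMap S, T x ∈ specSup T.toLinearMap S :=
  fun _ hx => specSup_mapsTo hx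

theorem mem_of_eigen_mem_specSup {f : Module.End ℂ X} {μ : ℂ} {x : X} (hx0 : x ≠ 0)
    (hx : f x = μ • x) (hxS : x ∈ specSup f S) : μ ∈ S := by
  by_contra hμ
  exact hx0 (Submodule.disjoint_def.mp (specSup_disjoint (f := f) (S := S) (S' := {μ})
    (Set.disjoint_singleton_right.mpr hμ)) x hxS (mem_specSup_of_eigen (Set.mem_singleton μ) hx))

theorem mem_of_mem_spectrum_restrict [FiniteDimensional ℂ (specSup T.toLinearMap S)] {z : ℂ}
    (hz : z ∈ spectrum ℂ (T.restrict (specSup_clm_mapsTo T S))) : z ∈ S := by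
  set E := specSup T.toLinearMap S with hE
  have hcomp : CompleteSpace E := FiniteDimensional.complete ℂ E
  by_contra hzS
  refine hz (spectrum.mem_resolventSet_iff.mpr ?_)
  rw [ContinuousLinearMap.isUnit_iff_bijective]
  have hinj : Function.Injective
      (algebraMap ℂ (E →L[ℂ] E) z - T.restrict (specSup_clm_mapsTo T S)).toLinearMap := by
    rw [injective_iff_map_eq_zero]
    intro x hx
    by_contra hx0
    refine hzS (mem_of_eigen_mem_specSup (f := T.toLinearMap) (fun h => hx0 (Subtype.ext h)) ?_ x.2)
    have h1 : z • x - T.restrict (specSup_clm_mapsTo T S) x = 0 := by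
      rw [Algebra.algebraMap_eq_smul_one] at hx; exact hx
    exact (congrArg Subtype.val (sub_eq_zero.mp h1)).symm
  exact ⟨hinj, LinearMap.injective_iff_surjective.mp hinj⟩

theorem exists_norm_pow_le_specSup [FiniteDimensional ℂ (specSup T.toLinearMap S)] {q : ℝ}
    (hq : 0 < q) (hS : ∀ z ∈ S, ‖z‖ < q) :
    ∃ C, ∀ n : ℕ, ∀ x ∈ specSup T.toLinearMap S, ‖(T ^ n) x‖ ≤ C * q ^ n * ‖x‖ := by
  have hcomp : CompleteSpace (specSup T.toLinearMap S) := FiniteDimensional.complete ℂ _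
  obtain ⟨q', hq', hqq, C, hC⟩ := exists_norm_pow_le_on (specSup_clm_mapsTo T S) hq
    fun z hz => hS z (mem_of_mem_spectrum_restrict hz)
  refine ⟨|C|, fun n x hx => (hC n x hx).trans ?_⟩
  have := le_abs_self C
  gcongr

theorem exists_le_norm_pow_specSup [FiniteDimensional ℂ (specSup T.toLinearMap S)] {q r : ℝ}
    (hq : 0 < q) (hqr : q < r) (hS : ∀ z ∈ S, r ≤ ‖z‖) :
    ∃ C, ∀ n : ℕ, ∀ x ∈ specSup T.toLinearMap S, q ^ n * ‖x‖ ≤ C * ‖(T ^ n) x‖ := by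
  set E := specSup T.toLinearMap S with hE
  have hcomp : CompleteSpace E := FiniteDimensional.complete ℂ _
  set A := T.restrict (specSup_clm_mapsTo T S) with hA
  have hr : 0 < r := hq.trans hqr
  have hunit : IsUnit A := by
    rw [← spectrum.zero_notMem_iff ℂ]
    intro h0
    have := hS 0 (mem_of_mem_spectrum_restrict h0)
    rw [norm_zero] at this
    linarith
  obtain ⟨u, hu⟩ := hunit
  have hspec : ∀ z ∈ spectrum ℂ (↑u⁻¹ : E →L[ℂ] E), ‖z‖ < q⁻¹ := by
    intro z hz
    have hz0 : z ≠ 0 := fun h0 => spectrum.zero_notMem ℂ (u⁻¹).isUnit (h0 ▸ hz)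
    have h1 : z⁻¹ ∈ spectrum ℂ A := by
      rw [← hu]
      have := (spectrum.inv_mem_iff (r := Units.mk0 z hz0) (a := u⁻¹)).mp hz
      simpa using this
    have h2 := hS _ (mem_of_mem_spectrum_restrict h1)
    rw [norm_inv] at h2
    have h3 : q < ‖z‖⁻¹ := hqr.trans_le h2
    exact (lt_inv_comm₀ hq (norm_pos_iff.mpr hz0)).mp h3
  obtain ⟨q', hq', hqq, C, hC⟩ := exists_norm_pow_apply_le (inv_pos.mpr hq) hspec
  refine ⟨|C|, fun n x hx => ?_⟩
  have h1 := hC n ((A ^ n) ⟨x, hx⟩)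
  have h2 : (↑u⁻¹ : E →L[ℂ] E) ^ n * A ^ n = 1 := by
    rw [← hu, ← Units.val_pow_eq_pow_val, ← Units.val_pow_eq_pow_val, inv_pow, Units.inv_mul]
  have h3 : ((↑u⁻¹ : E →L[ℂ] E) ^ n) ((A ^ n) ⟨x, hx⟩) = ⟨x, hx⟩ :=
    congrArg (fun L : E →L[ℂ] E => L ⟨x, hx⟩) h2
  rw [h3, Submodule.coe_norm, Submodule.coe_norm, hA, restrict_pow_apply] at h1
  calc q ^ n * ‖x‖ ≤ q ^ n * (C * q' ^ n * ‖(T ^ n) x‖) := by gcongr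
    _ ≤ q ^ n * (|C| * q⁻¹ ^ n * ‖(T ^ n) x‖) := by
        have := le_abs_self C
        gcongr
    _ = |C| * ‖(T ^ n) x‖ := by
        rw [inv_pow]
        field_simp

theorem eq_zero_of_mem_specSup_of_mem_decay [FiniteDimensional ℂ (specSup T.toLinearMap S)] {r : ℝ}
    (hr : 0 < r) (hS : ∀ z ∈ S, r ≤ ‖z‖) {x : X} (hx : x ∈ specSup T.toLinearMap S)
    (hd : x ∈ decay T r) : x = 0 := by
  obtain ⟨q, hq, hqr, C, hC⟩ := hd hr
  obtain ⟨q', hqq, hqr'⟩ := exists_between hqr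
  have hq' : 0 < q' := hq.trans hqq
  obtain ⟨D, hD⟩ := exists_le_norm_pow_specSup (T := T) hq' hqr' hS
  have h1 : ∀ n : ℕ, ‖x‖ ≤ |D| * C * (q / q') ^ n := fun n => by
    have h2 : q' ^ n * ‖x‖ ≤ |D| * (C * q ^ n) := (hD n x hx).trans (by
      have := le_abs_self D
      have := hC n
      gcongr)
    rw [div_pow, mul_div_assoc', le_div_iff₀ (pow_pos hq' n)]
    linarith
  have h3 := (tendsto_pow_atTop_nhds_zero_of_lt_one (div_nonneg hq.le hq'.le)
    ((div_lt_one hq').mpr hqq)).const_mul (|D| * C)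
  rw [mul_zero] at h3
  exact norm_le_zero_iff.mp (ge_of_tendsto' h3 h1)

theorem decay_mono {q r : ℝ} (hq : 0 < q) (hqr : q ≤ r) : decay T q ≤ decay T r := by
  intro x hx _
  obtain ⟨q', h1, h2, h3⟩ := hx hq
  exact ⟨q', h1, h2.trans_le hqr, h3⟩

end SpectralBounds

section Levels

variable {X : Type*} [NormedAddCommGroup X] [NormedSpace ℂ X] {T : X →L[ℂ] X} {S S' : Set ℂ}

theorem hasEigenvalue_of_maxGenEigenspace_ne_bot {f : Module.End ℂ X} {μ : ℂ}
    (h : f.maxGenEigenspace μ ≠ ⊥) : f.HasEigenvalue μ :=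
  Module.End.HasUnifEigenvalue.lt (k := ⊤) zero_lt_one h

theorem specSup_le_of_eigen {f : Module.End ℂ X} (h : ∀ μ ∈ S, f.HasEigenvalue μ → μ ∈ S') :
    specSup f S ≤ specSup f S' := by
  refine iSup₂_le fun μ hμ => ?_
  by_cases hb : f.maxGenEigenspace μ = ⊥
  · rw [hb]; exact bot_le
  · exact le_specSup (h μ hμ (hasEigenvalue_of_maxGenEigenspace_ne_bot hb))

theorem finite_eigenvalues [FiniteDimensional ℂ (specSup T.toLinearMap S)] :
    {μ | Module.End.HasEigenvalue T.toLinearMap μ ∧ μ ∈ S}.Finite := by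
  refine (Module.End.finite_hasEigenvalue
    (T.toLinearMap.restrict (specSup_clm_mapsTo T S))).subset fun μ hμ => ?_
  obtain ⟨x, hx⟩ := hμ.1.exists_hasEigenvector
  have hxS := mem_specSup_of_eigen hμ.2 hx.apply_eq_smul
  refine Module.End.hasEigenvalue_of_hasEigenvector (x := ⟨x, hxS⟩) ⟨?_, fun h => hx.2 ?_⟩
  · rw [Module.End.mem_eigenspace_iff]
    exact Subtype.ext hx.apply_eq_smul
  · exact congrArg Subtype.val h

theorem finiteDimensional_specSup_of_le {p : ℕ} (hK : IsCompactOperator (T ^ p)) {r : ℝ}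
    (hr : 0 < r) (hS : ∀ z ∈ S, r ≤ ‖z‖) : FiniteDimensional ℂ (specSup T.toLinearMap S) := by
  have := finiteDimensional_specSup hK hr
  exact Submodule.finiteDimensional_of_le (specSup_mono (f := T.toLinearMap) (S := S)
    (S' := {μ | r ≤ ‖μ‖}) hS)

theorem specSup_le_decay {p : ℕ} (hK : IsCompactOperator (T ^ p)) {r : ℝ}
    (hS : ∀ z ∈ S, 0 < ‖z‖ ∧ ‖z‖ < r) : specSup T.toLinearMap S ≤ decay T r := by
  refine iSup₂_le fun μ hμ x hx hr => ?_
  obtain ⟨h0, h1⟩ := hS μ hμ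
  obtain ⟨q, hq, hqr⟩ := exists_between h1
  have : FiniteDimensional ℂ (specSup T.toLinearMap {μ}) :=
    finiteDimensional_specSup_of_le hK h0 fun z hz => by rw [Set.mem_singleton_iff.mp hz]
  obtain ⟨C, hC⟩ := exists_norm_pow_le_specSup (T := T) (S := {μ}) (h0.trans hq)
    fun z hz => by rwa [Set.mem_singleton_iff.mp hz]
  refine ⟨q, h0.trans hq, hqr, C * ‖x‖, fun n => ?_⟩
  have := hC n x (le_specSup (Set.mem_singleton μ) hx)
  linarith

theorem exists_dominant_of_finset {f : Module.End ℂ X} (F : Finset ℝ) :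
    ∀ e ∈ specSup f {μ | ‖μ‖ ∈ F}, e ≠ 0 → ∃ r ∈ F, ∃ w ∈ specSup f {μ | ‖μ‖ = r}, w ≠ 0 ∧
      e - w ∈ specSup f {μ | ‖μ‖ ∈ F ∧ ‖μ‖ < r} := by
  refine Finset.induction_on_max F ?_ ?_
  · intro e he he0
    have h1 : {μ : ℂ | ‖μ‖ ∈ (∅ : Finset ℝ)} = ∅ := by simp
    rw [h1, specSup, iSup_emptyset, Submodule.mem_bot] at he
    exact absurd he he0
  · intro a F ha ih e he he0
    have h1 : {μ : ℂ | ‖μ‖ ∈ insert a F} = {μ | ‖μ‖ = a} ∪ {μ | ‖μ‖ ∈ F} := by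
      ext μ; simp
    rw [h1, specSup_union] at he
    obtain ⟨w, hw, e', he', rfl⟩ := Submodule.mem_sup.mp he
    by_cases hw0 : w = 0
    · rw [hw0, zero_add] at he0 ⊢
      obtain ⟨r, hr, w', hw', hw'0, h2⟩ := ih e' he' he0
      exact ⟨r, Finset.mem_insert_of_mem hr, w', hw', hw'0,
        specSup_mono (S := {μ | ‖μ‖ ∈ F ∧ ‖μ‖ < r})
          (S' := {μ | ‖μ‖ ∈ insert a F ∧ ‖μ‖ < r})
          (fun μ hμ => ⟨Finset.mem_insert_of_mem hμ.1, hμ.2⟩) h2⟩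
    · refine ⟨a, Finset.mem_insert_self _ _, w, hw, hw0, ?_⟩
      rw [add_sub_cancel_left]
      exact specSup_mono (S := {μ | ‖μ‖ ∈ F}) (S' := {μ | ‖μ‖ ∈ insert a F ∧ ‖μ‖ < a})
        (fun μ hμ => ⟨Finset.mem_insert_of_mem hμ, ha _ hμ⟩) he'

/-- A vector that does not decay at all rates has a dominant spectral component. -/
theorem exists_dominant [CompleteSpace X] {p : ℕ} (hp : 0 < p) (hK : IsCompactOperator (T ^ p))
    {r₀ : ℝ} (hr₀ : 0 < r₀) {u : X} (hu : u ∉ decay T r₀) :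
    ∃ r, r₀ ≤ r ∧ ∃ w ∈ specSup T.toLinearMap {μ | ‖μ‖ = r}, w ≠ 0 ∧ u - w ∈ decay T r := by
  have hu' : u ∈ specSup T.toLinearMap {μ | r₀ ≤ ‖μ‖} ⊔ decay T r₀ := by
    rw [specSup_sup_decay hp hK hr₀]; trivial
  obtain ⟨e, he, f, hf, rfl⟩ := Submodule.mem_sup.mp hu'
  have he0 : e ≠ 0 := fun h0 => hu (by rwa [h0, zero_add])
  have hfin := finiteDimensional_specSup hK hr₀
  have hfe := finite_eigenvalues (T := T) (S := {μ | r₀ ≤ ‖μ‖})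
  set F : Finset ℝ := hfe.toFinset.image norm with hF
  have hmem : ∀ r ∈ F, r₀ ≤ r := by
    intro r hr
    obtain ⟨μ, hμ, rfl⟩ := Finset.mem_image.mp hr
    exact (hfe.mem_toFinset.mp hμ).2
  have he' : e ∈ specSup T.toLinearMap {μ | ‖μ‖ ∈ F} :=
    specSup_le_of_eigen (S := {μ | r₀ ≤ ‖μ‖}) (S' := {μ | ‖μ‖ ∈ F}) (fun μ hμ h1 =>
      Finset.mem_image_of_mem _ (hfe.mem_toFinset.mpr ⟨h1, hμ⟩)) he
  obtain ⟨r, hr, w, hw, hw0, h2⟩ := exists_dominant_of_finset F e he' he0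
  refine ⟨r, hmem r hr, w, hw, hw0, ?_⟩
  have h3 := specSup_le_decay hK (r := r) (S := {μ | ‖μ‖ ∈ F ∧ ‖μ‖ < r})
    (fun z hz => ⟨hr₀.trans_le (hmem _ hz.1), hz.2⟩) h2
  have h4 := decay_mono hr₀ (hmem r hr) hf
  have h5 : e + f - w = (e - w) + f := by abel
  rw [h5]
  exact Submodule.add_mem _ h3 h4

theorem lt_of_dominant {p : ℕ} (hK : IsCompactOperator (T ^ p)) {r R : ℝ} (hR : 0 < R) {u w : X}
    (hw : w ∈ specSup T.toLinearMap {μ | ‖μ‖ = r}) (hw0 : w ≠ 0) (huw : u - w ∈ decay T r)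
    (hu : u ∈ decay T R) : r < R := by
  by_contra! h
  have hr := hR.trans_le h
  have := finiteDimensional_specSup_of_le (S := {μ : ℂ | ‖μ‖ = r}) hK hr fun z hz => hz.ge
  refine hw0 (eq_zero_of_mem_specSup_of_mem_decay hr (fun z hz => hz.ge) hw ?_)
  have h1 := Submodule.sub_mem _ (decay_mono hR h hu) huw
  rwa [sub_sub_cancel] at h1

end Levels

section Cones

open Filter Topology

variable {E : Type*} [NormedAddCommGroup E] [NormedSpace ℝ E] {L : E →ₗ[ℝ] E} {C : Set E}

theorem smul_mem_closure_compl (hsmul : ∀ (c : ℝ), ∀ φ ∈ C, c • φ ∈ C) {c : ℝ} (hc : c ≠ 0) {w : E}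
    (hw : w ∈ closure Cᶜ) : c • w ∈ closure Cᶜ := by
  refine map_mem_closure (continuous_const_smul c) hw fun x hx hcx => hx ?_
  have := hsmul c⁻¹ _ hcx
  rwa [inv_smul_smul₀ hc] at this

variable [FiniteDimensional ℝ E]

theorem exists_uniform_nhds (hC : IsClosed C) (hsmul : ∀ (c : ℝ), ∀ φ ∈ C, c • φ ∈ C)
    (hopen : ∀ φ ∈ C, φ ≠ 0 → ∃ ε > 0, ∀ ψ, ‖ψ - φ‖ < ε → L ψ ∈ C) :
    ∃ ε > 0, ∀ φ ∈ C, φ ≠ 0 → ∀ η, ‖η‖ ≤ ε * ‖φ‖ → L (φ + η) ∈ C := by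
  have hprop : ProperSpace E := FiniteDimensional.proper ℝ E
  set K := C ∩ Metric.sphere (0 : E) 1 with hKdef
  have hK : IsCompact K := (isCompact_sphere 0 1).inter_left hC
  have hne : ∀ x : K, (x : E) ≠ 0 := fun x => Metric.ne_of_mem_sphere x.2.2 one_ne_zero
  choose ε hε hεC using fun x : K => hopen x x.2.1 (hne x)
  obtain ⟨δ, hδ, hδK⟩ := lebesgue_number_lemma_of_metric hK
    (c := fun x : K => Metric.ball (x : E) (ε x)) (fun _ => Metric.isOpen_ball)
    (fun x hx => Set.mem_iUnion.mpr ⟨⟨x, hx⟩, Metric.mem_ball_self (hε _)⟩)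
  refine ⟨δ / 2, half_pos hδ, fun φ hφ hφ0 η hη => ?_⟩
  have hn : 0 < ‖φ‖ := norm_pos_iff.mpr hφ0
  have h1 : ‖φ‖⁻¹ • φ ∈ K := ⟨hsmul _ _ hφ, by
    rw [mem_sphere_zero_iff_norm, norm_smul, norm_inv, norm_norm, inv_mul_cancel₀ hn.ne']⟩
  obtain ⟨x, hx⟩ := hδK _ h1
  have h2 : ‖φ‖⁻¹ • φ + ‖φ‖⁻¹ • η ∈ Metric.ball (x : E) (ε x) := by
    refine hx ?_
    rw [Metric.mem_ball, dist_eq_norm, add_sub_cancel_left, norm_smul, norm_inv, norm_norm,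
      inv_mul_lt_iff₀ hn]
    nlinarith
  rw [mem_ball_iff_norm] at h2
  have h3 := hsmul ‖φ‖ _ (hεC x _ h2)
  rwa [← smul_add, map_smul, smul_inv_smul₀ hn.ne'] at h3

/-- A vector whose whole orbit avoids the interior of a cone that is not everything. -/
theorem exists_orbit_avoiding (hsmul : ∀ (c : ℝ), ∀ φ ∈ C, c • φ ∈ C)
    (hmap : ∀ φ ∈ C, L φ ∈ C) (hL : Function.Injective L) (h0 : (0 : E) ∈ C) (hCne : C ≠ Set.univ) :
    ∃ w : E, ‖w‖ = 1 ∧ ∀ j : ℕ, (L ^ j) w ∈ closure Cᶜ := by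
  have hprop : ProperSpace E := FiniteDimensional.proper ℝ E
  obtain ⟨w₀, hw₀⟩ := (Set.ne_univ_iff_exists_notMem C).mp hCne
  have hiter : ∀ (n : ℕ), ∀ φ ∈ C, (L ^ n) φ ∈ C := fun n φ hφ => by
    rw [Module.End.pow_apply]
    exact (show Set.MapsTo L C C from hmap).iterate n hφ
  have hsurj : ∀ n : ℕ, ∃ v, (L ^ n) v = w₀ := fun n => by
    have := (LinearMap.injective_iff_surjective.mp hL).iterate n
    rw [← Module.End.coe_pow] at this
    exact this w₀
  choose v hv using hsurj
  have hv0 : ∀ n, 0 < ‖v n‖ := fun n => norm_pos_iff.mpr fun h => hw₀ (by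
    rw [← hv n, h, map_zero]; exact h0)
  have hd : ∀ n, ‖v n‖⁻¹ • v n ∈ Metric.sphere (0 : E) 1 := fun n => by
    rw [mem_sphere_zero_iff_norm, norm_smul, norm_inv, norm_norm, inv_mul_cancel₀ (hv0 n).ne']
  obtain ⟨w, hw, ns, hns, hlim⟩ := (isCompact_sphere (0 : E) 1).tendsto_subseq hd
  refine ⟨w, mem_sphere_zero_iff_norm.mp hw, fun j => ?_⟩
  refine mem_closure_of_tendsto
    ((LinearMap.continuous_of_finiteDimensional (L ^ j)).tendsto _ |>.comp
    hlim) ?_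
  filter_upwards [eventually_ge_atTop j] with i hi
  intro hmem
  have hji : j ≤ ns i := hi.trans (hns.id_le i)
  have h1 := hsmul ‖v (ns i)‖ _ hmem
  simp only [Function.comp_apply, map_smul, smul_inv_smul₀ (hv0 (ns i)).ne'] at h1
  have h2 := hiter (ns i - j) _ h1
  rw [← Module.End.mul_apply, ← pow_add, Nat.sub_add_cancel hji, hv] at h2
  exact hw₀ h2

theorem exists_separation (hC : IsClosed C) (hsmul : ∀ (c : ℝ), ∀ φ ∈ C, c • φ ∈ C)
    (hL : Function.Injective L)
    (hopen : ∀ φ ∈ C, φ ≠ 0 → ∃ ε > 0, ∀ ψ, ‖ψ - φ‖ < ε → L ψ ∈ C) :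
    ∃ κ > 0, ∀ a, (∀ j : ℕ, (L ^ j) a ∈ closure Cᶜ) → ∀ φ ∈ C, κ * ‖a‖ ≤ ‖φ - a‖ := by
  have hprop : ProperSpace E := FiniteDimensional.proper ℝ E
  set B : Set E := Metric.sphere 0 1 ∩ ⋂ j : ℕ, (L ^ j) ⁻¹' closure Cᶜ with hB
  have hBc : IsCompact B := (isCompact_sphere 0 1).inter_right (isClosed_iInter fun j =>
    isClosed_closure.preimage (LinearMap.continuous_of_finiteDimensional (L ^ j)))
  have hLopen : IsOpenMap L := by
    have h1 := (LinearEquiv.ofInjectiveEndo L hL).toContinuousLinearEquiv.toHomeomorph.isOpenMap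
    exact h1
  have hdisj : Disjoint B C := by
    rw [Set.disjoint_left]
    rintro a ⟨ha1, ha2⟩ haC
    obtain ⟨ε, hε, hεC⟩ := hopen a haC (Metric.ne_of_mem_sphere ha1 one_ne_zero)
    have h1 : L a ∈ interior C := mem_interior.mpr ⟨L '' Metric.ball a ε, by
      rintro _ ⟨ψ, hψ, rfl⟩
      exact hεC ψ (mem_ball_iff_norm.mp hψ), hLopen _ Metric.isOpen_ball,
      Set.mem_image_of_mem _ (Metric.mem_ball_self hε)⟩
    have h2 := Set.mem_iInter.mp ha2 1
    rw [Set.mem_preimage, pow_one, closure_compl] at h2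
    exact h2 h1
  obtain ⟨κ, hκ, hκB⟩ := Metric.exists_pos_forall_lt_edist hBc hC hdisj
  refine ⟨κ, hκ, fun a ha φ hφ => ?_⟩
  rcases eq_or_ne a 0 with rfl | ha0
  · rw [norm_zero, mul_zero]; exact norm_nonneg _
  have hn : 0 < ‖a‖ := norm_pos_iff.mpr ha0
  have h1 : ‖a‖⁻¹ • a ∈ B := by
    refine ⟨by rw [mem_sphere_zero_iff_norm, norm_smul, norm_inv, norm_norm,
      inv_mul_cancel₀ hn.ne'], Set.mem_iInter.mpr fun j => ?_⟩
    rw [Set.mem_preimage, map_smul]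
    exact smul_mem_closure_compl hsmul (inv_ne_zero hn.ne') (ha j)
  have h2 := hκB _ h1 _ (hsmul ‖a‖⁻¹ _ hφ)
  rw [edist_nndist, ENNReal.coe_lt_coe, ← NNReal.coe_lt_coe, coe_nndist, dist_comm, dist_eq_norm,
    ← smul_sub, norm_smul, norm_inv, norm_norm, lt_inv_mul_iff₀ hn] at h2
  linarith

/-- A closed cone that is mapped strictly into itself and contains a vector of minimal growth is the
whole space. -/
theorem mem_cone_of_minimal_growth (hC : IsClosed C) (hsmul : ∀ (c : ℝ), ∀ φ ∈ C, c • φ ∈ C)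
    (hmap : ∀ φ ∈ C, L φ ∈ C) (hL : Function.Injective L)
    (hopen : ∀ φ ∈ C, φ ≠ 0 → ∃ ε > 0, ∀ ψ, ‖ψ - φ‖ < ε → L ψ ∈ C) {u : E} (hu : u ∈ C)
    (hu0 : u ≠ 0)
    (hgrowth : ∀ q > 1, ∃ K, ∀ (n : ℕ) (w : E), ‖(L ^ n) u‖ * ‖w‖ ≤ K * q ^ n * ‖(L ^ n) w‖)
    (w : E) : w ∈ C := by
  by_contra hwC
  have h0 : (0 : E) ∈ C := by simpa using hsmul 0 u hu
  obtain ⟨a, ha1, ha⟩ := exists_orbit_avoiding hsmul hmap hL h0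
    ((Set.ne_univ_iff_exists_notMem C).mpr ⟨w, hwC⟩)
  obtain ⟨κ, hκ, hsep⟩ := exists_separation hC hsmul hL hopen
  obtain ⟨ε, hε, hunif⟩ := exists_uniform_nhds hC hsmul hopen
  have hiter : ∀ n : ℕ, (L ^ n) u ∈ C := fun n => by
    rw [Module.End.pow_apply]
    exact (show Set.MapsTo L C C from hmap).iterate n hu
  have hsucc : ∀ (n : ℕ) (x : E), (L ^ (n + 1)) x = L ((L ^ n) x) := fun n x => by
    rw [pow_succ']; rfl
  have hinj : ∀ n : ℕ, ∀ x, (L ^ n) x = 0 → x = 0 := fun n x hx => by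
    have h1 := hL.iterate n
    rw [← Module.End.coe_pow] at h1
    exact h1 (hx.trans (map_zero _).symm)
  have hsep' : ∀ (n : ℕ) (s : ℝ), ∀ φ ∈ C, κ * (|s| * ‖(L ^ n) a‖) ≤ ‖φ - s • (L ^ n) a‖ := by
    intro n s φ hφ
    rcases eq_or_ne s 0 with rfl | hs
    · simp
    have h1 := hsep (s • (L ^ n) a) (fun j => by
      rw [map_smul, ← Module.End.mul_apply, ← pow_add]
      exact smul_mem_closure_compl hsmul hs (ha _)) φ hφ
    rwa [norm_smul, Real.norm_eq_abs] at h1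
  set τ := ε * ‖u‖ with hτ
  have hτ0 : 0 < τ := mul_pos hε (norm_pos_iff.mpr hu0)
  set Q := 1 + ε * κ with hQ
  have hQ1 : 1 < Q := by have := mul_pos hε hκ; linarith
  have key : ∀ (n : ℕ) (s : ℝ), |s| ≤ τ * Q ^ n →
      (L ^ (n + 1)) u + s • (L ^ (n + 1)) a ∈ C := by
    intro n
    induction n with
    | zero =>
      intro s hs
      have h1 := hunif u hu hu0 (s • a) (by
        rw [norm_smul, ha1, mul_one, Real.norm_eq_abs]; simpa using hs)
      simpa using h1
    | succ n ih =>
      intro s hs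
      rw [hsucc (n + 1), hsucc (n + 1)]
      have hQ0 : 0 < Q := by linarith
      have hs' : |s / Q| ≤ τ * Q ^ n := by
        rw [abs_div, abs_of_pos hQ0, div_le_iff₀ hQ0]
        calc |s| ≤ _ := hs
          _ = _ := by ring
      have hφ := ih (s / Q) hs'
      set φ := (L ^ (n + 1)) u + (s / Q) • (L ^ (n + 1)) a with hφdef
      have h1 : κ * (|s / Q| * ‖(L ^ (n + 1)) a‖) ≤ ‖φ‖ := by
        have := hsep' (n + 1) (-(s / Q)) _ (hiter (n + 1))
        rwa [abs_neg, neg_smul, sub_neg_eq_add] at this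
      by_cases hφ0 : φ = 0
      · have h2 : s = 0 := by
          by_contra hs0
          have h3 : 0 < ‖(L ^ (n + 1)) a‖ := norm_pos_iff.mpr fun h => by
            rw [hinj _ _ h, norm_zero] at ha1; exact zero_ne_one ha1
          rw [hφ0, norm_zero] at h1
          have h4 : 0 < |s / Q| := abs_pos.mpr (div_ne_zero hs0 hQ0.ne')
          exact absurd h1 (not_le.mpr (by positivity))
        rw [h2, zero_smul, add_zero]
        exact hmap _ (hiter (n + 1))
      · have h2 := hunif φ hφ hφ0 ((s - s / Q) • (L ^ (n + 1)) a) (by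
          have h3 : s - s / Q = ε * κ * (s / Q) := by
            field_simp
            rw [hQ]; ring
          rw [norm_smul, h3, Real.norm_eq_abs, abs_mul, abs_of_pos (mul_pos hε hκ)]
          nlinarith)
        rw [hφdef, add_assoc, ← add_smul, add_sub_cancel] at h2
        rwa [← map_smul, ← map_add]
  obtain ⟨q, hq1, hqQ⟩ := exists_between hQ1
  obtain ⟨K, hK⟩ := hgrowth q hq1
  have hq0 : 0 < q := by linarith
  have hfin : ∀ n : ℕ, κ * τ * (Q / q) ^ n ≤ K * q := by
    intro n
    have hs : |τ * Q ^ n| = τ * Q ^ n := abs_of_pos (by positivity)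
    have h1 := hsep' (n + 1) (τ * Q ^ n) _ (key n (τ * Q ^ n) hs.le)
    rw [add_sub_cancel_right, hs] at h1
    have h2 := hK (n + 1) a
    rw [ha1, mul_one] at h2
    have h3 : 0 < ‖(L ^ (n + 1)) a‖ := norm_pos_iff.mpr fun h => by
      rw [hinj _ _ h, norm_zero] at ha1; exact zero_ne_one ha1
    have h4 : κ * (τ * Q ^ n) ≤ K * q ^ (n + 1) := by
      refine le_of_mul_le_mul_right ?_ h3
      linarith
    rw [div_pow, mul_div_assoc', div_le_iff₀ (pow_pos hq0 n)]
    calc _ = _ := mul_assoc _ _ _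
      _ ≤ _ := h4
      _ = _ := by ring
  have h1 := (tendsto_pow_atTop_atTop_of_one_lt ((one_lt_div hq0).mpr hqQ)).const_mul_atTop
    (mul_pos hκ hτ0)
  obtain ⟨n, hn⟩ := (h1.eventually_gt_atTop (K * q)).exists
  exact absurd (hfin n) (not_le.mpr hn)

end Cones

section GrowthRatio

variable {X : Type*} [NormedAddCommGroup X] [NormedSpace ℂ X] {T : X →L[ℂ] X}

theorem exists_growth_ratio {r : ℝ} (hr : 0 < r)
    [FiniteDimensional ℂ (specSup T.toLinearMap {μ | r ≤ ‖μ‖})] {u : X}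
    (hu : u ∈ specSup T.toLinearMap {μ | ‖μ‖ = r}) {p : ℕ} (hp : 0 < p) {q : ℝ} (hq : 1 < q) :
    ∃ K, ∀ n : ℕ, ∀ w ∈ specSup T.toLinearMap {μ | r ≤ ‖μ‖},
      ‖(T ^ (p * n)) u‖ * ‖w‖ ≤ K * q ^ n * ‖(T ^ (p * n)) w‖ := by
  have hfin : FiniteDimensional ℂ (specSup T.toLinearMap {μ | ‖μ‖ = r}) :=
    Submodule.finiteDimensional_of_le (specSup_mono (f := T.toLinearMap) (S := {μ | ‖μ‖ = r})
      (S' := {μ | r ≤ ‖μ‖}) fun z hz => le_of_eq (Eq.symm hz))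
  have h2p : 2 * p ≠ 0 := by omega
  set a : ℝ := q ^ (((2 * p : ℕ) : ℝ)⁻¹) with ha
  have ha2 : a ^ (2 * p) = q := Real.rpow_inv_natCast_pow (by linarith) h2p
  have ha1 : 1 < a := Real.one_lt_rpow hq (by positivity)
  have ha0 : 0 < a := by linarith
  obtain ⟨C₁, hC₁⟩ := exists_norm_pow_le_specSup (T := T) (S := {μ | ‖μ‖ = r})
    (q := r * a) (by positivity) fun z hz => by
      rw [Set.mem_ofPred_eq] at hz; rw [hz]; nlinarith
  obtain ⟨C₂, hC₂⟩ := exists_le_norm_pow_specSup (T := T) (S := {μ | r ≤ ‖μ‖})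
    (q := r / a) (by positivity) (div_lt_self hr ha1) fun z hz => hz
  refine ⟨|C₁| * ‖u‖ * |C₂|, fun n w hw => ?_⟩
  have h1 : ‖(T ^ (p * n)) u‖ ≤ |C₁| * (r * a) ^ (p * n) * ‖u‖ := (hC₁ _ u hu).trans (by
    have := le_abs_self C₁
    gcongr)
  have h2 : (r / a) ^ (p * n) * ‖w‖ ≤ |C₂| * ‖(T ^ (p * n)) w‖ := (hC₂ _ w hw).trans (by
    have := le_abs_self C₂
    gcongr)
  have h3 : r ^ (p * n) * ‖w‖ ≤ |C₂| * ‖(T ^ (p * n)) w‖ * a ^ (p * n) := by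
    rw [div_pow, div_mul_eq_mul_div, div_le_iff₀ (by positivity)] at h2
    exact h2
  have h4 : a ^ (p * n) * a ^ (p * n) = q ^ n := by
    rw [← ha2, ← pow_add, ← pow_mul]; congr 1; ring
  calc ‖(T ^ (p * n)) u‖ * ‖w‖ ≤ |C₁| * (r * a) ^ (p * n) * ‖u‖ * ‖w‖ := by gcongr
    _ = |C₁| * ‖u‖ * a ^ (p * n) * (r ^ (p * n) * ‖w‖) := by rw [mul_pow]; ring
    _ ≤ |C₁| * ‖u‖ * a ^ (p * n) * (|C₂| * ‖(T ^ (p * n)) w‖ * a ^ (p * n)) := by gcongr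
    _ = |C₁| * ‖u‖ * |C₂| * (a ^ (p * n) * a ^ (p * n)) * ‖(T ^ (p * n)) w‖ := by ring
    _ = _ := by rw [h4]

end GrowthRatio

section RealPart

/-- The real part of a complex function, as a complex function. -/
def reC (ψ : CC) : CC := (2⁻¹ : ℂ) • (ψ + star ψ)

theorem reC_apply (ψ : CC) (θ : I01) : reC ψ θ = ((ψ θ).re : ℂ) := by
  have := Complex.add_conj (ψ θ)
  simp only [reC, ContinuousMap.smul_apply, ContinuousMap.add_apply, ContinuousMap.star_apply,
    smul_eq_mul, RCLike.star_def, this]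
  push_cast
  ring

theorem reC_re (ψ : CC) (θ : I01) : (reC ψ θ).re = (ψ θ).re := by
  rw [reC_apply, Complex.ofReal_re]

theorem star_reC (ψ : CC) : star (reC ψ) = reC ψ := by
  ext θ
  rw [ContinuousMap.star_apply, reC_apply, RCLike.star_def, Complex.conj_ofReal]

theorem reC_mem {W : Submodule ℂ CC} (hW : ∀ ψ ∈ W, star ψ ∈ W) {ψ : CC} (h : ψ ∈ W) : reC ψ ∈ W :=
  W.smul_mem _ (W.add_mem h (hW ψ h))

theorem re_eq_of_star_eq {ψ : CC} (h : star ψ = ψ) (θ : I01) : ((ψ θ).re : ℂ) = ψ θ := by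
  have := congrArg (fun φ : CC => φ θ) h
  exact Complex.conj_eq_iff_re.mp this

theorem exists_re_ne_zero {ψ : CC} (h : star ψ = ψ) (h0 : ψ ≠ 0) : ∃ θ, (ψ θ).re ≠ 0 := by
  by_contra! hc
  refine h0 (ContinuousMap.ext fun θ => ?_)
  rw [← re_eq_of_star_eq h θ, hc θ]
  rfl

theorem reC_ne_zero {ψ : CC} (h : ∃ θ, (ψ θ).re ≠ 0) : reC ψ ≠ 0 := by
  obtain ⟨θ, hθ⟩ := h
  intro h0
  rw [← reC_re, h0] at hθ
  exact hθ rfl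

theorem norm_star_eq (ψ : CC) : ‖star ψ‖ = ‖ψ‖ := by
  simp [ContinuousMap.norm_eq_iSup_norm]

theorem ofReal_smul_eq (c : ℝ) (ψ : CC) : (c : ℂ) • ψ = c • ψ := by
  ext θ
  simp

theorem isClosed_star_eq : IsClosed {ψ : CC | star ψ = ψ} :=
  isClosed_eq continuous_star continuous_id

end RealPart

namespace Floq

variable {b E : ℝ → ℝ} {γ Q δ c₀ : ℝ} {M : CC →L[ℂ] CC} {N : ℕ} {S : Set ℂ}

theorem sub_smul_iter_star (h : Floq b E γ Q δ c₀ M) (μ : ℂ) (k : ℕ) (ψ : CC) :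
    ((M.toLinearMap - (star μ) • (1 : Module.End ℂ CC)) ^ k) (star ψ) =
      star (((M.toLinearMap - μ • (1 : Module.End ℂ CC)) ^ k) ψ) := by
  induction k generalizing ψ with
  | zero => simp
  | succ k ih =>
    rw [pow_succ, pow_succ, Module.End.mul_apply, Module.End.mul_apply, ← ih]
    congr 1
    have h1 : M (star ψ) - star μ • star ψ = star (M ψ - μ • ψ) := by
      rw [star_sub, star_smul, h.map_star]
    exact h1

theorem star_mem_specSup (h : Floq b E γ Q δ c₀ M) (hS : ∀ z ∈ S, star z ∈ S) :
    ∀ ψ ∈ specSup M.toLinearMap S, star ψ ∈ specSup M.toLinearMap S := by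
  have key : specSup M.toLinearMap S ≤ (specSup M.toLinearMap S).comap
      (starLinearEquiv ℂ : CC ≃ₗ⋆[ℂ] CC).toLinearMap := by
    refine iSup₂_le fun μ hμ ψ hψ => ?_
    obtain ⟨k, hk⟩ := (Module.End.mem_maxGenEigenspace _ _ _).mp hψ
    refine le_specSup (hS μ hμ) ((Module.End.mem_maxGenEigenspace _ _ _).mpr ⟨k, ?_⟩)
    have := h.sub_smul_iter_star μ k ψ
    rw [hk, star_zero] at this
    exact this
  exact fun ψ hψ => key hψ

theorem star_mem_decay (h : Floq b E γ Q δ c₀ M) (r : ℝ) :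
    ∀ ψ ∈ decay M r, star ψ ∈ decay M r := by
  intro ψ hψ hr
  obtain ⟨q, hq, hqr, C, hC⟩ := hψ hr
  exact ⟨q, hq, hqr, C, fun n => by rw [h.iter_star, norm_star_eq]; exact hC n⟩

theorem exists_compact_pow (h : Floq b E γ Q δ c₀ M) (N : ℕ) :
    ∃ p : ℕ, 0 < p ∧ 2 * N + 4 ≤ p * γ ∧ IsCompactOperator (M ^ p) := by
  obtain ⟨p, hp⟩ := exists_nat_ge ((2 * N + 4) / γ)
  rw [div_le_iff₀ h.γpos] at hp
  refine ⟨p, ?_, hp, h.isCompactOperator (by have : (0 : ℝ) ≤ N := N.cast_nonneg; linarith)⟩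
  rcases Nat.eq_zero_or_pos p with rfl | h0
  · rw [Nat.cast_zero, zero_mul] at hp
    have : (0 : ℝ) ≤ N := N.cast_nonneg
    linarith
  · exact h0

theorem finiteDimensional_specSup (h : Floq b E γ Q δ c₀ M) {r : ℝ} (hr : 0 < r)
    (hS : ∀ z ∈ S, r ≤ ‖z‖) : FiniteDimensional ℂ (specSup M.toLinearMap S) := by
  obtain ⟨p, -, -, hK⟩ := h.exists_compact_pow 0
  exact finiteDimensional_specSup_of_le hK hr hS

/-- A spectral subspace that meets the cone at its lowest level is contained in the cone. -/
theorem specSup_subset_cone (h : Floq b E γ Q δ c₀ M) (hδ : δ = (-1) ^ N) {r : ℝ} (hr : 0 < r)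
    {u : CC} (hu : u ∈ specSup M.toLinearMap {μ | ‖μ‖ = r}) (hu0 : u ≠ 0) (hus : star u = u)
    (huc : u ∈ cone N) : ∀ ψ ∈ specSup M.toLinearMap {μ | r ≤ ‖μ‖}, ψ ∈ cone N := by
  obtain ⟨p, hp, hpγ, hK⟩ := h.exists_compact_pow N
  have hfin := h.finiteDimensional_specSup (S := {μ | r ≤ ‖μ‖}) hr fun z hz => hz
  set W := specSup M.toLinearMap {μ | r ≤ ‖μ‖} with hW
  have hstar := h.star_mem_specSup (S := {μ | r ≤ ‖μ‖}) fun z hz => by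
    rw [Set.mem_ofPred_eq, norm_star]; exact hz
  let V : Submodule ℝ CC :=
    { carrier := {ψ | ψ ∈ W ∧ star ψ = ψ}
      zero_mem' := ⟨W.zero_mem, star_zero _⟩
      add_mem' := fun hx hy => ⟨W.add_mem hx.1 hy.1, by rw [star_add, hx.2, hy.2]⟩
      smul_mem' := fun c x hx => ⟨(W.restrictScalars ℝ).smul_mem c hx.1, by
        rw [star_smul, hx.2, star_trivial]⟩ }
  have hWR : Module.Finite ℝ (W.restrictScalars ℝ) :=
    haveI : Module.Finite ℂ (W.restrictScalars ℝ) := hfin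
    Module.Finite.trans ℂ (W.restrictScalars ℝ)
  have hVfin : FiniteDimensional ℝ V :=
    Submodule.finiteDimensional_of_le (S₂ := W.restrictScalars ℝ) fun x hx => hx.1
  have hiterW : ∀ n : ℕ, ∀ x ∈ W, (M ^ n) x ∈ W := fun n x hx => by
    rw [← restrict_pow_apply (specSup_clm_mapsTo M _) n ⟨x, hx⟩]; exact Subtype.prop _
  have hVinv : ∀ x ∈ V, ((M ^ p).toLinearMap.restrictScalars ℝ) x ∈ V := fun x hx =>
    ⟨hiterW p x hx.1, by
      have := h.iter_star p x
      rw [hx.2] at this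
      exact this.symm⟩
  set L : V →ₗ[ℝ] V := ((M ^ p).toLinearMap.restrictScalars ℝ).restrict hVinv with hL
  have hLpow : ∀ (n : ℕ) (x : V), ((L ^ n) x : CC) = (M ^ (p * n)) x := by
    intro n
    induction n with
    | zero => intro x; simp
    | succ n ih =>
      intro x
      have h1 : (L ^ (n + 1)) x = L ((L ^ n) x) := by rw [pow_succ']; rfl
      rw [h1, Nat.mul_succ, add_comm, pow_add, mul_apply_eq_comp, ← ih]
      rfl
  have hLinj : Function.Injective L := by
    rw [injective_iff_map_eq_zero]
    intro x hx
    obtain ⟨C, hC⟩ := exists_le_norm_pow_specSup (T := M) (S := {μ | r ≤ ‖μ‖}) (half_pos hr)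
      (half_lt_self hr) fun z hz => hz
    have h1 := hC p x x.2.1
    have h2 : (M ^ p) (x : CC) = 0 := congrArg Subtype.val hx
    rw [h2, norm_zero, mul_zero] at h1
    have h3 : 0 < (r / 2) ^ p := by positivity
    exact Subtype.ext (norm_le_zero_iff.mp (by nlinarith))
  have huW : u ∈ W := specSup_mono (S := {μ | ‖μ‖ = r}) (S' := {μ | r ≤ ‖μ‖})
    (fun z hz => le_of_eq (Eq.symm hz)) hu
  have key := mem_cone_of_minimal_growth (E := V) (L := L) (C := Subtype.val ⁻¹' cone N)
    (u := (⟨u, huW, hus⟩ : V))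
    ((isClosed_cone N).preimage continuous_subtype_val) (fun c φ hφ => by
      have h1 := smul_mem_cone hφ c
      rw [ofReal_smul_eq] at h1
      exact h1)
    (fun φ hφ => h.iter_mem_cone hδ hφ p) hLinj
    (fun φ hφ hφ0 => by
      obtain ⟨ε, hε, hεC⟩ := h.exists_nhds_cone hδ hpγ hφ
        (exists_re_ne_zero φ.2.2 fun h0 => hφ0 (Subtype.ext h0))
      exact ⟨ε, hε, fun ψ hψ => hεC ψ hψ⟩)
    huc (fun h0 => hu0 (congrArg Subtype.val h0))
    (fun q hq => by
      obtain ⟨K, hK⟩ := exists_growth_ratio hr hu hp hq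
      refine ⟨K, fun n w => ?_⟩
      have := hK n w w.2.1
      rw [Submodule.coe_norm, Submodule.coe_norm, Submodule.coe_norm, hLpow, hLpow]
      exact this)
  intro ψ hψ
  have h1 := key ⟨reC ψ, reC_mem hstar hψ, star_reC ψ⟩
  exact mem_cone_of_re_eq h1 fun θ => (reC_re ψ θ).symm

theorem finrank_specSup_le (h : Floq b E γ Q δ c₀ M) (hδ : δ = (-1) ^ N) {r : ℝ} (hr : 0 < r)
    {u : CC} (hu : u ∈ specSup M.toLinearMap {μ | ‖μ‖ = r}) (hu0 : u ≠ 0) (hus : star u = u)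
    (huc : u ∈ cone N) : Module.finrank ℂ (specSup M.toLinearMap {μ | r ≤ ‖μ‖}) ≤ N + 1 :=
  haveI := h.finiteDimensional_specSup (S := {μ | r ≤ ‖μ‖}) hr fun _ hz => hz
  finrank_le_of_subset_cone _ (h.specSup_subset_cone hδ hr hu hu0 hus huc)

/-- A real element of the cone that is not superexponentially small produces a spectral level that
meets the cone. -/
theorem exists_level (h : Floq b E γ Q δ c₀ M) (hδ : δ = (-1) ^ N) {u : CC} (hus : star u = u)
    (huc : u ∈ cone N) {r₀ : ℝ} (hr₀ : 0 < r₀) (hu : u ∉ decay M r₀) :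
    ∃ r, r₀ ≤ r ∧ (∀ R, 0 < R → u ∈ decay M R → r < R) ∧
      ∃ v ∈ specSup M.toLinearMap {μ | ‖μ‖ = r}, v ≠ 0 ∧ star v = v ∧ v ∈ cone N := by
  obtain ⟨p, hp, hpγ, hK⟩ := h.exists_compact_pow N
  obtain ⟨r, hr₀r, w, hw, hw0, huw⟩ := exists_dominant hp hK hr₀ hu
  have hr : 0 < r := hr₀.trans_le hr₀r
  refine ⟨r, hr₀r, fun R hR hRu => lt_of_dominant hK hR hw hw0 huw hRu, ?_⟩
  have hfin := h.finiteDimensional_specSup (S := {μ | ‖μ‖ = r}) hr fun z hz => hz.ge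
  set W := specSup M.toLinearMap {μ | ‖μ‖ = r} with hW
  have hstar := h.star_mem_specSup (S := {μ | ‖μ‖ = r}) fun z hz => by
    rw [Set.mem_ofPred_eq, norm_star]; exact hz
  have hws : star w = w := by
    have h1 : star w - w ∈ decay M r := by
      have h2 := Submodule.sub_mem _ huw (h.star_mem_decay r _ huw)
      rwa [star_sub, hus, sub_sub_sub_cancel_left] at h2
    exact sub_eq_zero.mp (eq_zero_of_mem_specSup_of_mem_decay hr (fun z hz => hz.ge)
      (W.sub_mem (hstar w hw) hw) h1)
  obtain ⟨q, hq, hqr, C, hC⟩ := huw hr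
  obtain ⟨q', hqq, hqr'⟩ := exists_between hqr
  have hq' : 0 < q' := hq.trans hqq
  obtain ⟨D, hD⟩ := exists_le_norm_pow_specSup (T := M) (S := {μ | ‖μ‖ = r}) hq' hqr'
    fun z hz => hz.ge
  have hwn : 0 < ‖w‖ := norm_pos_iff.mpr hw0
  have hpos : ∀ n : ℕ, 0 < ‖(M ^ n) w‖ := fun n => by
    rw [norm_pos_iff]
    intro h0
    have h1 := hD n w hw
    rw [h0, norm_zero, mul_zero] at h1
    have := pow_pos hq' n
    nlinarith
  have hiterW : ∀ n : ℕ, (M ^ n) w ∈ W := fun n => by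
    rw [← restrict_pow_apply (specSup_clm_mapsTo M _) n ⟨w, hw⟩]; exact Subtype.prop _
  have hprop : ProperSpace W := FiniteDimensional.proper ℂ W
  let x : ℕ → W := fun n => ((‖(M ^ n) w‖⁻¹ : ℝ) : ℂ) • ⟨(M ^ n) w, hiterW n⟩
  have hx : ∀ n, x n ∈ Metric.sphere (0 : W) 1 := fun n => by
    refine (dist_zero_right (x n : CC)).trans
      (Eq.trans (norm_smul ((‖(M ^ n) w‖⁻¹ : ℝ) : ℂ) ((M ^ n) w)) ?_)
    rw [Complex.norm_real, norm_inv, norm_norm]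
    exact inv_mul_cancel₀ (hpos n).ne'
  obtain ⟨v, hv, ns, hns, hlim⟩ := (isCompact_sphere (0 : W) 1).tendsto_subseq hx
  have hlim' : Filter.Tendsto (fun i => (x (ns i) : CC)) Filter.atTop (nhds (v : CC)) :=
    (continuous_subtype_val.tendsto v).comp hlim
  have hrem : Filter.Tendsto (fun n => ((‖(M ^ n) w‖⁻¹ : ℝ) : ℂ) • (M ^ n) (u - w)) Filter.atTop
      (nhds 0) := by
    have h1 := (tendsto_pow_atTop_nhds_zero_of_lt_one (div_nonneg hq.le hq'.le)
      ((div_lt_one hq').mpr hqq)).const_mul (|C| * |D| * ‖w‖⁻¹)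
    rw [mul_zero] at h1
    refine squeeze_zero_norm (fun n => ?_) h1
    rw [norm_smul, Complex.norm_real, norm_inv, norm_norm, div_pow,
      inv_mul_le_iff₀ (hpos n)]
    have h2 : ‖(M ^ n) (u - w)‖ ≤ |C| * q ^ n := (hC n).trans (by
      have := le_abs_self C
      gcongr)
    have h3 : q' ^ n * ‖w‖ ≤ |D| * ‖(M ^ n) w‖ := (hD n w hw).trans (by
      have := le_abs_self D
      gcongr)
    refine h2.trans ?_
    have h4 := pow_pos hq' n
    calc |C| * q ^ n = |C| * q ^ n / (q' ^ n * ‖w‖) * (q' ^ n * ‖w‖) := by field_simp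
      _ ≤ |C| * q ^ n / (q' ^ n * ‖w‖) * (|D| * ‖(M ^ n) w‖) := by gcongr
      _ = _ := by field_simp
  have hsum : Filter.Tendsto (fun i => ((‖(M ^ ns i) w‖⁻¹ : ℝ) : ℂ) • (M ^ ns i) u) Filter.atTop
      (nhds (v : CC)) := by
    have h1 := hlim'.add (hrem.comp hns.tendsto_atTop)
    rw [add_zero] at h1
    refine h1.congr fun i => ?_
    have h2 : (x (ns i) : CC) = ((‖(M ^ ns i) w‖⁻¹ : ℝ) : ℂ) • (M ^ ns i) w := rfl
    rw [h2, Function.comp_apply]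
    rw [map_sub]
    ext θ
    simp [mul_sub]
  refine ⟨v, v.2, fun h0 => ?_, ?_, ?_⟩
  · have h1 : ‖(v : CC)‖ = 1 := (dist_zero_right (v : CC)).symm.trans hv
    rw [h0, norm_zero] at h1
    exact zero_ne_one h1
  · refine isClosed_star_eq.mem_of_tendsto hsum (Filter.Eventually.of_forall fun i => ?_)
    rw [Set.mem_ofPred_eq, star_smul, ← h.iter_star, hus, RCLike.star_def, Complex.conj_ofReal]
  · exact (isClosed_cone N).mem_of_tendsto hsum (Filter.Eventually.of_forall fun i =>
      smul_mem_cone (h.iter_mem_cone hδ huc _) _)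

end Floq

section Links

variable {M : CC →L[ℂ] CC} {μ : ℂ} {Λ : ℕ → ℂ}

theorem genEig_eq (M : CC →L[ℂ] CC) (μ : ℂ) :
    genEig M μ = Module.End.maxGenEigenspace M.toLinearMap μ := by
  have h1 : ∀ n : ℕ, ((M - μ • (1 : CC →L[ℂ] CC)) ^ n : CC →L[ℂ] CC).toLinearMap =
      (M.toLinearMap - μ • (1 : Module.End ℂ CC)) ^ n := fun n => by
    induction n with
    | zero => rfl
    | succ n ih => rw [pow_succ, pow_succ, ← ih]; rfl
  ext x
  rw [Module.End.mem_maxGenEigenspace, genEig, Submodule.mem_iSup_of_directed]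
  · exact exists_congr fun n => by rw [LinearMap.mem_ker, h1]
  · refine (monotone_nat_of_le_succ fun n x hx => ?_).directed_le
    rw [LinearMap.mem_ker, h1] at hx ⊢
    rw [pow_succ', Module.End.mul_apply, hx, map_zero]

theorem isFloquetMult_iff :
    IsFloquetMult M μ ↔ μ ≠ 0 ∧ Module.End.HasEigenvalue M.toLinearMap μ := by
  refine and_congr_right fun _ => ⟨fun ⟨φ, hφ, h⟩ =>
    Module.End.hasEigenvalue_of_hasEigenvector (x := φ)
      ⟨Module.End.mem_eigenspace_iff.mpr h, hφ⟩, fun h => ?_⟩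
  obtain ⟨x, hx⟩ := h.exists_hasEigenvector
  exact ⟨x, hx.2, hx.apply_eq_smul⟩

theorem GabsSpan_eq {ρ : ℝ} (hρ : 0 < ρ) :
    GabsSpan M ρ = specSup M.toLinearMap {μ | ‖μ‖ = ρ} := by
  refine le_antisymm (iSup₂_le fun μ hμ => ?_) (iSup₂_le fun μ hμ => ?_)
  · rw [genEig_eq]
    exact le_specSup (f := M.toLinearMap) (S := {μ | ‖μ‖ = ρ}) hμ.2
  · by_cases hb : Module.End.maxGenEigenspace M.toLinearMap μ = ⊥
    · rw [hb]; exact bot_le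
    · rw [← genEig_eq]
      refine le_biSup (genEig M) (i := μ) ⟨isFloquetMult_iff.mpr ⟨?_,
        hasEigenvalue_of_maxGenEigenspace_ne_bot hb⟩, hμ⟩
      rintro rfl
      rw [Set.mem_ofPred_eq, norm_zero] at hμ
      exact hρ.ne hμ

theorem specSup_singleton (f : Module.End ℂ CC) (μ : ℂ) :
    specSup f {μ} = f.maxGenEigenspace μ := iSup_singleton

theorem ncard_enum_finset (hΛ : IsOrderedEnum M Λ) {r : ℝ}
    (hfin : FiniteDimensional ℂ (specSup M.toLinearMap {μ | r ≤ ‖μ‖})) (F : Finset ℂ)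
    (hF : ∀ μ ∈ F, IsFloquetMult M μ ∧ r ≤ ‖μ‖) :
    {k : ℕ | 1 ≤ k ∧ Λ k ∈ F}.Finite ∧
      {k : ℕ | 1 ≤ k ∧ Λ k ∈ F}.ncard = Module.finrank ℂ (specSup M.toLinearMap (F : Set ℂ)) := by
  have hfd : ∀ S : Set ℂ, (∀ z ∈ S, r ≤ ‖z‖) → FiniteDimensional ℂ (specSup M.toLinearMap S) :=
    fun S hS => Submodule.finiteDimensional_of_le
      (specSup_mono (f := M.toLinearMap) (S := S) (S' := {μ | r ≤ ‖μ‖}) hS)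
  induction F using Finset.induction_on with
  | empty =>
    have h1 : specSup M.toLinearMap ((∅ : Finset ℂ) : Set ℂ) = ⊥ := by simp [specSup]
    rw [h1]
    simp
  | insert μ F hμF ih =>
    obtain ⟨ihf, ihc⟩ := ih fun z hz => hF z (Finset.mem_insert_of_mem hz)
    obtain ⟨hμ, hμr⟩ := hF μ (Finset.mem_insert_self _ _)
    have hset : {k : ℕ | 1 ≤ k ∧ Λ k ∈ insert μ F} =
        {k : ℕ | 1 ≤ k ∧ Λ k = μ} ∪ {k : ℕ | 1 ≤ k ∧ Λ k ∈ F} := by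
      ext k
      simp only [Finset.mem_insert, Set.mem_ofPred_eq, Set.mem_union]
      tauto
    have hfμ := hfd {μ} (by rintro z rfl; exact hμr)
    have hfF := hfd (F : Set ℂ) fun z hz => (hF z (Finset.mem_insert_of_mem hz)).2
    have hcard := hΛ.2.2 μ hμ
    rw [Nat.card_coe_set_eq, algMult, genEig_eq, ← specSup_singleton] at hcard
    have hpos : 0 < Module.finrank ℂ (specSup M.toLinearMap {μ}) := by
      obtain ⟨-, φ, hφ, h1⟩ := hμ
      have hφm : φ ∈ specSup M.toLinearMap {μ} := mem_specSup_of_eigen (Set.mem_singleton μ) h1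
      have : Nontrivial (specSup M.toLinearMap {μ}) :=
        ⟨⟨φ, hφm⟩, 0, fun h0 => hφ (congrArg Subtype.val h0)⟩
      exact Module.finrank_pos (R := ℂ) (M := specSup M.toLinearMap {μ})
    have hfin1 : {k : ℕ | 1 ≤ k ∧ Λ k = μ}.Finite :=
      Set.finite_of_ncard_pos (by rw [hcard]; exact hpos)
    have hdisj : Disjoint {k : ℕ | 1 ≤ k ∧ Λ k = μ} {k : ℕ | 1 ≤ k ∧ Λ k ∈ F} := by
      rw [Set.disjoint_left]
      rintro k ⟨-, hk⟩ ⟨-, hk'⟩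
      rw [hk] at hk'
      exact hμF hk'
    refine ⟨hset ▸ hfin1.union ihf, ?_⟩
    rw [hset, Set.ncard_union_eq hdisj hfin1 ihf, hcard, ihc, Finset.coe_insert, Set.insert_eq,
      specSup_union]
    have h1 := Submodule.finrank_sup_add_finrank_inf_eq (specSup M.toLinearMap {μ})
      (specSup M.toLinearMap (F : Set ℂ))
    have h2 : specSup M.toLinearMap {μ} ⊓ specSup M.toLinearMap (F : Set ℂ) = ⊥ :=
      (specSup_disjoint (by simpa using hμF)).eq_bot
    rw [h2, finrank_bot, add_zero] at h1
    exact h1.symm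

theorem norm_antitone_enum (hΛ : IsOrderedEnum M Λ) {j k : ℕ} (hj : 1 ≤ j) (hjk : j ≤ k) :
    ‖Λ k‖ ≤ ‖Λ j‖ := by
  induction k, hjk using Nat.le_induction with
  | base => exact le_rfl
  | succ k hk ih => exact (hΛ.1 k (hj.trans hk)).trans ih

theorem norm_enum_pos (hΛ : IsOrderedEnum M Λ) {k : ℕ} (hk : 1 ≤ k) : 0 < ‖Λ k‖ :=
  norm_pos_iff.mpr (hΛ.2.1 k hk).1

/-- The number of terms of an ordered enumeration of norm at least `r` is the dimension of the sum
of the corresponding generalized eigenspaces. -/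
theorem le_norm_enum_iff (hΛ : IsOrderedEnum M Λ) {r : ℝ} (hr : 0 < r)
    (hfin : FiniteDimensional ℂ (specSup M.toLinearMap {μ | r ≤ ‖μ‖})) {k : ℕ} (hk : 1 ≤ k) :
    r ≤ ‖Λ k‖ ↔ k ≤ Module.finrank ℂ (specSup M.toLinearMap {μ | r ≤ ‖μ‖}) := by
  have hfe := finite_eigenvalues (T := M) (S := {μ | r ≤ ‖μ‖})
  set F := hfe.toFinset with hFdef
  have hmemF : ∀ μ, μ ∈ F ↔ Module.End.HasEigenvalue M.toLinearMap μ ∧ r ≤ ‖μ‖ := fun μ => by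
    rw [hFdef, Set.Finite.mem_toFinset]; rfl
  have hF : ∀ μ ∈ F, IsFloquetMult M μ ∧ r ≤ ‖μ‖ := fun μ hμ => by
    obtain ⟨h1, h2⟩ := (hmemF μ).mp hμ
    exact ⟨isFloquetMult_iff.mpr ⟨norm_pos_iff.mp (hr.trans_le h2), h1⟩, h2⟩
  obtain ⟨hAf, hAc⟩ := ncard_enum_finset hΛ hfin F hF
  have hspec : specSup M.toLinearMap (F : Set ℂ) = specSup M.toLinearMap {μ | r ≤ ‖μ‖} :=
    le_antisymm (specSup_mono (f := M.toLinearMap) (S := F) (S' := {μ | r ≤ ‖μ‖})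
      fun z hz => (hF z hz).2)
      (specSup_le_of_eigen fun μ hμ he => (hmemF μ).mpr ⟨he, hμ⟩)
  rw [hspec] at hAc
  have hA : ∀ j, 1 ≤ j → (Λ j ∈ F ↔ r ≤ ‖Λ j‖) := fun j hj => by
    rw [hmemF]
    exact and_iff_right (isFloquetMult_iff.mp (hΛ.2.1 j hj)).2
  rw [← hAc]
  constructor
  · intro h
    have : (Set.Icc 1 k).ncard ≤ {k : ℕ | 1 ≤ k ∧ Λ k ∈ F}.ncard :=
      Set.ncard_le_ncard (fun j hj => ⟨hj.1, (hA j hj.1).mpr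
        (h.trans (norm_antitone_enum hΛ hj.1 hj.2))⟩) hAf
    rw [← Nat.card_coe_set_eq] at this
    simpa using this
  · intro h
    by_contra! hlt
    have : {k : ℕ | 1 ≤ k ∧ Λ k ∈ F}.ncard ≤ (Set.Icc 1 (k - 1)).ncard :=
      Set.ncard_le_ncard (fun j hj => ⟨hj.1, by
        by_contra! hc
        have h1 := (hA j hj.1).mp hj.2
        have h2 := norm_antitone_enum hΛ (k := j) hk (by omega)
        linarith⟩) (Set.finite_Icc _ _)
    rw [← Nat.card_coe_set_eq (Set.Icc 1 (k - 1))] at this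
    simp at this
    omega

end Links

theorem exists_mem_ker_of_finrank_lt {X : Type*} [AddCommGroup X] [Module ℂ X] {n : ℕ}
    (P : (Fin n → ℂ) →ₗ[ℂ] X) {W D : Submodule ℂ X} [FiniteDimensional ℂ W] (hWD : W ⊔ D = ⊤)
    (hn : Module.finrank ℂ W < n) : ∃ a, a ≠ 0 ∧ P a ∈ D := by
  have hsurj : Function.Surjective (D.mkQ ∘ₗ W.subtype) := by
    intro y
    obtain ⟨x, rfl⟩ := D.mkQ_surjective y
    obtain ⟨w, hw, d, hd, rfl⟩ := Submodule.mem_sup.mp (hWD ▸ Submodule.mem_top : x ∈ W ⊔ D)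
    refine ⟨⟨w, hw⟩, ?_⟩
    have hd0 : D.mkQ d = 0 := (Submodule.Quotient.mk_eq_zero D).mpr hd
    rw [map_add, hd0, add_zero]
    rfl
  have hfin : Module.Finite ℂ (X ⧸ D) := Module.Finite.of_surjective _ hsurj
  by_contra! hc
  have hinj : Function.Injective (D.mkQ ∘ₗ P) := by
    rw [injective_iff_map_eq_zero]
    intro a ha
    by_contra h0
    exact hc a h0 ((Submodule.Quotient.mk_eq_zero D).mp ha)
  have h1 := LinearMap.finrank_le_finrank_of_surjective hsurj
  have h2 := LinearMap.finrank_le_finrank_of_injective hinj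
  rw [Module.finrank_fin_fun] at h2
  omega

theorem exists_real_of_star_mem {X : Type*} [AddCommGroup X] [Module ℂ X] [StarAddMonoid X]
    [StarModule ℂ X] {D : Submodule ℂ X} (hD : ∀ x ∈ D, star x ∈ D) {a : X} (ha0 : a ≠ 0)
    (ha : a ∈ D) : ∃ b ∈ D, b ≠ 0 ∧ star b = b := by
  by_cases h : a + star a = 0
  · refine ⟨Complex.I • a, D.smul_mem _ ha, fun h0 => ha0 ?_, ?_⟩
    · exact (smul_eq_zero.mp h0).resolve_left Complex.I_ne_zero
    · rw [star_smul, eq_neg_of_add_eq_zero_right h, RCLike.star_def, Complex.conj_I, neg_smul_neg]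
  · exact ⟨a + star a, D.add_mem ha (hD a ha), h, by rw [star_add, star_star, add_comm]⟩

namespace Floq

variable {b E : ℝ → ℝ} {γ Q δ c₀ : ℝ} {M : CC →L[ℂ] CC} {N : ℕ} {Λ : ℕ → ℂ}

/-- If the spectral subspace for moduli at least `R` has dimension at most `N`, then the cone
meets a spectral level below `R`. -/
theorem exists_level_lt (h : Floq b E γ Q δ c₀ M) (hδ : δ = (-1) ^ N) {R : ℝ} (hR : 0 < R)
    (hn : Module.finrank ℂ (specSup M.toLinearMap {μ | R ≤ ‖μ‖}) ≤ N) :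
    ∃ r, 0 < r ∧ r < R ∧
      ∃ v ∈ specSup M.toLinearMap {μ | ‖μ‖ = r}, v ≠ 0 ∧ star v = v ∧ v ∈ cone N := by
  obtain ⟨p, hp, -, hK⟩ := h.exists_compact_pow N
  have hfin := h.finiteDimensional_specSup (S := {μ | R ≤ ‖μ‖}) hR fun z hz => hz
  obtain ⟨a, ha0, ha⟩ := exists_mem_ker_of_finrank_lt (polyC h.Econt N)
    (specSup_sup_decay hp hK hR) (Nat.lt_succ_of_le hn)
  obtain ⟨c, hc, hc0, hcs⟩ := exists_real_of_star_mem
    (D := (decay M R).comap (polyC h.Econt N)) (fun x hx => by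
      rw [Submodule.mem_comap, ← star_polyC]
      exact h.star_mem_decay R _ hx) ha0 ha
  have hne : ∃ r₀ > 0, polyC h.Econt N c ∉ decay M r₀ := by
    by_contra! hall
    refine hc0 (h.polyC_eq_zero hδ c fun q hq => ?_)
    obtain ⟨q', hq', hqq, C, hC⟩ := hall q hq hq
    refine ⟨|C|, fun n => (hC n).trans ?_⟩
    have := le_abs_self C
    gcongr
  obtain ⟨r₀, hr₀, hu⟩ := hne
  obtain ⟨r, hr, hlt, v, hv⟩ := h.exists_level hδ (by rw [star_polyC, hcs])
    (polyC_mem_cone h.Econt h.Epos N c) hr₀ hu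
  exact ⟨r, hr₀.trans_le hr, hlt R hR hc, v, hv⟩

theorem exists_floquetMult_norm_eq {r : ℝ} (hr : 0 < r) {v : CC}
    (hv : v ∈ specSup M.toLinearMap {μ | ‖μ‖ = r}) (hv0 : v ≠ 0) :
    ∃ μ, IsFloquetMult M μ ∧ ‖μ‖ = r := by
  by_contra! hc
  refine hv0 ((Submodule.mem_bot ℂ).mp ?_)
  have : specSup M.toLinearMap {μ | ‖μ‖ = r} ≤ ⊥ := iSup₂_le fun μ hμ => by
    by_contra hb
    refine hc μ (isFloquetMult_iff.mpr ⟨?_, hasEigenvalue_of_maxGenEigenspace_ne_bot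
      fun h0 => hb h0.le⟩) hμ
    rintro rfl
    rw [Set.mem_ofPred_eq, norm_zero] at hμ
    exact hr.ne hμ
  exact this hv

theorem exists_enum_eq (h : Floq b E γ Q δ c₀ M) (hΛ : IsOrderedEnum M Λ) {μ : ℂ}
    (hμ : IsFloquetMult M μ) : ∃ k, 1 ≤ k ∧ Λ k = μ := by
  have hcard := hΛ.2.2 μ hμ
  have hpos : 0 < algMult M μ := by
    have hfin := h.finiteDimensional_specSup (S := {μ}) (norm_pos_iff.mpr hμ.1)
      (by rintro z rfl; exact le_rfl)
    rw [algMult, genEig_eq, ← specSup_singleton]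
    obtain ⟨-, φ, hφ, h1⟩ := hμ
    have hφm : φ ∈ specSup M.toLinearMap {μ} := mem_specSup_of_eigen (Set.mem_singleton μ) h1
    have : Nontrivial (specSup M.toLinearMap {μ}) :=
      ⟨⟨φ, hφm⟩, 0, fun h0 => hφ (congrArg Subtype.val h0)⟩
    exact Module.finrank_pos (R := ℂ) (M := specSup M.toLinearMap {μ})
  rw [← hcard] at hpos
  obtain ⟨k, hk⟩ := (Nat.card_pos_iff.mp hpos).1
  exact ⟨k, hk⟩

theorem le_enum_iff (h : Floq b E γ Q δ c₀ M) (hΛ : IsOrderedEnum M Λ) {r : ℝ} (hr : 0 < r)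
    {k : ℕ} (hk : 1 ≤ k) :
    r ≤ ‖Λ k‖ ↔ k ≤ Module.finrank ℂ (specSup M.toLinearMap {μ | r ≤ ‖μ‖}) :=
  le_norm_enum_iff hΛ hr (h.finiteDimensional_specSup (S := {μ | r ≤ ‖μ‖}) hr fun _ hz => hz) hk

theorem exists_gap (x : ℕ → ℝ) (r : ℝ) (N : ℕ) : ∃ R > r, ∀ j ≤ N, r < x j → R ≤ x j := by
  induction N with
  | zero =>
    by_cases h0 : r < x 0
    · exact ⟨x 0, h0, fun j hj _ => by rw [Nat.le_zero.mp hj]⟩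
    · exact ⟨r + 1, by linarith, fun j hj h1 => absurd (Nat.le_zero.mp hj ▸ h1) h0⟩
  | succ N ih =>
    obtain ⟨R, hR, h⟩ := ih
    by_cases h0 : r < x (N + 1)
    · refine ⟨min R (x (N + 1)), lt_min hR h0, fun j hj h1 => ?_⟩
      rcases Nat.le_succ_iff.mp hj with hj | rfl
      · exact (min_le_left _ _).trans (h j hj h1)
      · exact min_le_right _ _
    · refine ⟨R, hR, fun j hj h1 => ?_⟩
      rcases Nat.le_succ_iff.mp hj with hj | rfl
      · exact h j hj h1
      · exact absurd h1 h0

theorem enum_subset_cone (h : Floq b E γ Q δ c₀ M) (hδ : δ = (-1) ^ N) (hΛ : IsOrderedEnum M Λ) :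
    ∀ ψ ∈ specSup M.toLinearMap {μ | ‖Λ (N + 1)‖ ≤ ‖μ‖}, ψ ∈ cone N := by
  have hr := norm_enum_pos hΛ (k := N + 1) (by omega)
  obtain ⟨R, hR, hgap⟩ := exists_gap (fun j => ‖Λ j‖) ‖Λ (N + 1)‖ N
  have hn : Module.finrank ℂ (specSup M.toLinearMap {μ | R ≤ ‖μ‖}) ≤ N := by
    by_contra! hc
    exact absurd ((h.le_enum_iff hΛ (hr.trans hR) (by omega)).mpr hc) (not_le.mpr hR)
  obtain ⟨r, hr0, hrR, v, hv, hv0, hvs, hvc⟩ := h.exists_level_lt hδ (hr.trans hR) hn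
  have hle : r ≤ ‖Λ (N + 1)‖ := by
    by_contra! hlt
    obtain ⟨μ, hμ, hμr⟩ := exists_floquetMult_norm_eq hr0 hv hv0
    obtain ⟨j, hj, rfl⟩ := h.exists_enum_eq hΛ hμ
    rcases Nat.lt_or_ge N j with hNj | hNj
    · have := norm_antitone_enum hΛ (j := N + 1) (by omega) hNj
      linarith
    · have := hgap j hNj (by linarith)
      linarith
  intro ψ hψ
  exact h.specSup_subset_cone hδ hr0 hv hv0 hvs hvc ψ
    (specSup_mono (S := {μ | ‖Λ (N + 1)‖ ≤ ‖μ‖}) (S' := {μ | r ≤ ‖μ‖}) (fun z hz => hle.trans hz)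
      hψ)

theorem norm_enum_lt (h : Floq b E γ Q δ c₀ M) (hδ : δ = (-1) ^ N) (hΛ : IsOrderedEnum M Λ) :
    ‖Λ (N + 2)‖ < ‖Λ (N + 1)‖ := by
  have hr := norm_enum_pos hΛ (k := N + 1) (by omega)
  have hfin := h.finiteDimensional_specSup (S := {μ | ‖Λ (N + 1)‖ ≤ ‖μ‖}) hr fun z hz => hz
  have h1 := finrank_le_of_subset_cone _ (h.enum_subset_cone hδ hΛ)
  by_contra! hc
  have := (h.le_enum_iff hΛ hr (k := N + 2) (by omega)).mp hc
  omega

theorem notMem_cone (h : Floq b E γ Q δ c₀ M) (hδ : δ = (-1) ^ N) (hN : 2 ≤ N)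
    (hΛ : IsOrderedEnum M Λ) {r : ℝ} (hr : 0 < r) (hrN : r ≤ ‖Λ N‖) {ψ : CC}
    (hψ : ψ ∈ specSup M.toLinearMap {μ | ‖μ‖ = r}) (h0 : ∃ θ, (ψ θ).re ≠ 0) : ψ ∉ cone (N - 2) := by
  intro hc
  obtain ⟨K, rfl⟩ : ∃ K, N = K + 2 := ⟨N - 2, by omega⟩
  have hstar := h.star_mem_specSup (S := {μ | ‖μ‖ = r}) fun z hz => by
    rw [Set.mem_ofPred_eq, norm_star]; exact hz
  have h1 := h.finrank_specSup_le (N := K) (by rw [hδ, pow_add]; norm_num) hr (reC_mem hstar hψ)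
    (reC_ne_zero h0) (star_reC ψ) (mem_cone_of_re_eq hc fun θ => reC_re ψ θ)
  have := (h.le_enum_iff hΛ hr (k := K + 2) (by omega)).mp hrN
  omega

theorem vpm_enum (h : Floq b E γ Q δ c₀ M) (hδ : δ = (-1) ^ N) (hΛ : IsOrderedEnum M Λ) {r : ℝ}
    (hr : ‖Λ (N + 1)‖ ≤ r) (hrN : 2 ≤ N → r ≤ ‖Λ N‖) {ψ : CC}
    (hψ : ψ ∈ GabsSpan M r) (h0 : (fun θ : I01 => (ψ θ).re) ≠ 0) :
    Vpm (N % 2) (fun θ : I01 => (ψ θ).re) = (N : ℕ∞) := by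
  have hr0 := (norm_enum_pos hΛ (k := N + 1) (by omega)).trans_le hr
  rw [GabsSpan_eq hr0] at hψ
  refine vpm_eq (h.enum_subset_cone hδ hΛ ψ (specSup_mono (S := {μ | ‖μ‖ = r})
    (S' := {μ | ‖Λ (N + 1)‖ ≤ ‖μ‖}) (fun z hz => hr.trans_eq (Eq.symm hz)) hψ)) fun hN => ?_
  exact h.notMem_cone hδ hN hΛ hr0 (hrN hN) hψ (Function.ne_iff.mp h0)

theorem infinite_floquetMult (h : Floq b E γ Q δ c₀ M) : {μ | IsFloquetMult M μ}.Infinite := by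
  intro hfin
  obtain ⟨ρ, hρ, hmin⟩ : ∃ ρ > 0, ∀ μ, IsFloquetMult M μ → ρ ≤ ‖μ‖ := by
    rcases Set.eq_empty_or_nonempty {μ | IsFloquetMult M μ} with he | hne
    · exact ⟨1, one_pos, fun μ hμ => absurd (he ▸ hμ : μ ∈ (∅ : Set ℂ)) (Set.notMem_empty _)⟩
    · obtain ⟨μ, hμ, hm⟩ := Set.exists_min_image _ (fun z : ℂ => ‖z‖) hfin hne
      exact ⟨‖μ‖, norm_pos_iff.mpr hμ.1, hm⟩
  set n := Module.finrank ℂ (specSup M.toLinearMap {μ | ρ ≤ ‖μ‖}) with hn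
  obtain ⟨N, hnN, hδ⟩ : ∃ N, n ≤ N ∧ δ = (-1) ^ N := by
    rcases mul_self_eq_one_iff.mp h.fb.sq with h1 | h1
    · exact ⟨2 * n, by omega, by rw [h1, pow_mul]; norm_num⟩
    · exact ⟨2 * n + 1, by omega, by rw [h1, pow_succ, pow_mul]; norm_num⟩
  obtain ⟨r, hr, hrρ, v, hv, hv0, -⟩ := h.exists_level_lt hδ hρ (hn ▸ hnN)
  obtain ⟨μ, hμ, hμr⟩ := exists_floquetMult_norm_eq hr hv hv0
  exact absurd (hmin μ hμ) (by rw [hμr]; exact not_le.mpr hrρ)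

theorem countable_floquetMult (h : Floq b E γ Q δ c₀ M) : {μ | IsFloquetMult M μ}.Countable := by
  refine (Set.countable_iUnion fun n : ℕ => (?_ : Set.Finite
    {μ | Module.End.HasEigenvalue M.toLinearMap μ ∧
      μ ∈ {μ : ℂ | 1 / ((n : ℝ) + 1) ≤ ‖μ‖}}).countable).mono fun μ hμ => ?_
  · have := h.finiteDimensional_specSup (S := {μ : ℂ | 1 / ((n : ℝ) + 1) ≤ ‖μ‖})
      (r := 1 / ((n : ℝ) + 1)) (by positivity) fun z hz => hz
    exact finite_eigenvalues
  · obtain ⟨n, hn⟩ := exists_nat_one_div_lt (norm_pos_iff.mpr hμ.1)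
    exact Set.mem_iUnion.mpr ⟨n, (isFloquetMult_iff.mp hμ).2, hn.le⟩

end Floq

theorem Feedback.nonneg_forward {b f : ℝ → ℝ} {c₀ : ℝ} (hb : Feedback b 1 c₀) (hf : DelaySol b f)
    (h0 : ∀ t ∈ Set.Icc (-1 : ℝ) 0, 0 ≤ f t) (n : ℕ) : ∀ t ∈ Set.Icc (-1 : ℝ) n, 0 ≤ f t := by
  induction n with
  | zero => simpa using h0
  | succ n ih =>
    intro t ht
    rcases le_or_gt t 0 with h | h
    · exact h0 t ⟨ht.1, h⟩
    have h1 := hf.eq 0 t le_rfl h.le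
    have h2 : 0 ≤ ∫ u in (0 : ℝ)..t, b u * f (u - 1) := by
      refine intervalIntegral.integral_nonneg_of_ae_restrict h.le ?_
      filter_upwards [ae_restrict_of_ae hb.ge, ae_restrict_mem measurableSet_Icc] with u hu hut
      have h3 := ht.2
      push_cast at h3
      have h4 := ih (u - 1) ⟨by linarith [hut.1], by linarith [hut.2]⟩
      have h5 : 0 ≤ b u := by linarith [hb.pos]
      exact mul_nonneg h5 h4
    have := h0 0 ⟨by norm_num, le_rfl⟩
    linarith

theorem nonneg_or_nonpos_of_not_alt {f : ℝ → ℝ} {t : ℝ} (h : ¬ Alt f 2 t) :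
    (∀ x ∈ Set.Icc (t - 1) t, 0 ≤ f x) ∨ ∀ x ∈ Set.Icc (t - 1) t, f x ≤ 0 := by
  have key : ∀ x ∈ Set.Icc (t - 1) t, ∀ y ∈ Set.Icc (t - 1) t, x < y → 0 ≤ f x * f y := by
    intro x hx y hy hxy
    by_contra! hneg
    refine h ⟨f x, fun i => if i = 0 then x else y, ⟨fun i hi => ?_, fun i hi => ?_⟩, fun i hi =>
      ?_⟩
    · have : i = 0 := by omega
      subst this
      simpa using hxy
    · have hx0 : f x ≠ 0 := by rintro h0; simp [h0] at hneg
      interval_cases i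
      · simpa using (mul_self_pos.mpr hx0)
      · simpa using hneg
    · dsimp only
      split_ifs
      exacts [hx, hy]
  by_contra! hc
  obtain ⟨⟨x, hx, hx0⟩, y, hy, hy0⟩ := hc
  rcases lt_trichotomy x y with hl | rfl | hl
  · have := key x hx y hy hl
    nlinarith
  · linarith
  · have := key y hy x hx hl
    nlinarith

namespace Floq

variable {b E : ℝ → ℝ} {γ Q δ c₀ : ℝ} {M : CC →L[ℂ] CC} {N : ℕ} {Λ : ℕ → ℂ} {f g : ℝ → ℝ}
  {ψ φ : CC}

theorem eq_zero_of_rep (hs : star ψ = ψ) (hψ : ∀ θ : I01, (ψ θ).re = E θ * f θ)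
    (h0 : ∀ t ∈ I01, f t = 0) : ψ = 0 := by
  by_contra hne
  obtain ⟨θ, hθ⟩ := exists_re_ne_zero hs hne
  exact hθ (by rw [hψ, h0 _ θ.2, mul_zero])

theorem isFloquetMult_star (h : Floq b E γ Q δ c₀ M) {μ : ℂ} (hμ : IsFloquetMult M μ) :
    IsFloquetMult M (star μ) := by
  obtain ⟨h0, x, hx, hM⟩ := hμ
  exact ⟨star_ne_zero.mpr h0, star x, star_ne_zero.mpr hx, by rw [h.map_star, hM, star_smul]⟩

theorem exists_real_eigenvector (h : Floq b E γ Q δ c₀ M) {a : ℝ}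
    (ha : IsFloquetMult M (a : ℂ)) : ∃ x : CC, x ≠ 0 ∧ star x = x ∧ M x = (a : ℂ) • x := by
  obtain ⟨-, x, hx, hM⟩ := ha
  obtain ⟨y, hy, hy0, hys⟩ := exists_real_of_star_mem
    (D := Module.End.eigenspace M.toLinearMap (a : ℂ)) (fun x hx => by
      rw [Module.End.mem_eigenspace_iff] at hx ⊢
      have h1 : M (star x) = star (M x) := h.map_star x
      have h2 : M x = (a : ℂ) • x := hx
      rw [h2, star_smul, RCLike.star_def, Complex.conj_ofReal] at h1
      exact h1) hx (Module.End.mem_eigenspace_iff.mpr hM)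
  exact ⟨y, hy0, hys, Module.End.mem_eigenspace_iff.mp hy⟩

theorem rep_eigen (h : Floq b E γ Q δ c₀ M) (hf : DelaySol b f)
    (hψ : ∀ θ : I01, (ψ θ).re = E θ * f θ) {a : ℝ} (hM : M ψ = (a : ℂ) • ψ) {t : ℝ} (ht : -1 ≤ t) :
    f (t + γ) = a / E γ * f t := by
  refine h.unique (hf.shift h.γpos.le h.per) (hf.smul (a / E γ)) (fun t ht => ?_) ht
  have h1 := h.rep_iter hf hψ 1 ⟨t, ht⟩
  rw [pow_one, hM, ContinuousMap.smul_apply, smul_eq_mul, Complex.re_ofReal_mul, hψ,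
    Nat.cast_one, one_mul, add_comm γ, h.Eper] at h1
  have hEt := (h.Epos t).ne'
  have hEγ := (h.Epos γ).ne'
  field_simp
  have h2 : E t * (a * f t) = E t * (E γ * f (t + γ)) := by linear_combination h1
  linarith [mul_left_cancel₀ hEt h2]

/-- A real element of the spectral subspace for the moduli between those of two consecutive
multipliers has no double zero at distance one. -/
theorem not_consecutive_zeros (h : Floq b E γ Q δ c₀ M) (hδ : δ = (-1) ^ N) (hN : 1 ≤ N)
    (hΛ : IsOrderedEnum M Λ)
    (hψ : ψ ∈ specSup M.toLinearMap {μ | ‖Λ (N + 1)‖ ≤ ‖μ‖ ∧ ‖μ‖ ≤ ‖Λ N‖}) (hψ0 : ψ ≠ 0)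
    (hs : star ψ = ψ) (hf : DelaySol b f) (hfψ : ∀ θ : I01, (ψ θ).re = E θ * f θ) {t : ℝ}
    (ht : 2 ≤ t) (h0 : f t = 0) (h1 : f (t - 1) = 0) : False := by
  set S : Set ℂ := {μ | ‖Λ (N + 1)‖ ≤ ‖μ‖ ∧ ‖μ‖ ≤ ‖Λ N‖} with hS
  have hr := norm_enum_pos hΛ (k := N + 1) (by omega)
  have hcone : ψ ∈ cone N := h.enum_subset_cone hδ hΛ ψ
    (specSup_mono (S := S) (S' := {μ | ‖Λ (N + 1)‖ ≤ ‖μ‖}) (fun z hz => hz.1) hψ)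
  have hno : ¬ Alt f (N + 2) 0 := fun hA => hcone ((h.alt_rep_iff hfψ).mpr hA)
  have hdrop := h.fb.drop hf hδ le_rfl (by linarith) hno h1 h0
  rw [max_eq_left hN] at hdrop
  rcases Nat.lt_or_ge N 2 with hN2 | hN2
  · have hN1 : N = 1 := by omega
    subst hN1
    rw [alt_one_iff] at hdrop
    push Not at hdrop
    refine hψ0 (eq_zero_of_rep hs hfψ ?_)
    have := h.fb.zero_backward hf le_rfl (by linarith) hdrop
    rwa [zero_sub] at this
  obtain ⟨K, rfl⟩ : ∃ K, N = K + 2 := ⟨N - 2, by omega⟩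
  obtain ⟨p, hp⟩ := exists_nat_ge (t / γ)
  rw [div_le_iff₀ h.γpos] at hp
  have hδK : δ = (-1) ^ K := by rw [hδ, pow_add]; norm_num
  have hvc : (M ^ p) ψ ∈ cone K := fun hA =>
    hdrop (h.fb.alt_backward hf hδ (by linarith) hp ((h.alt_iter_iff hf hfψ p).mp hA))
  have hfin := h.finiteDimensional_specSup (S := S) hr fun z hz => hz.1
  have hvS : (M ^ p) ψ ∈ specSup M.toLinearMap S := by
    rw [← restrict_pow_apply (specSup_clm_mapsTo M _) p ⟨ψ, hψ⟩]; exact Subtype.prop _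
  have hv0 : (M ^ p) ψ ≠ 0 := by
    intro hv
    obtain ⟨C, hC⟩ := exists_le_norm_pow_specSup (T := M) (S := S) (half_pos hr)
      (half_lt_self hr) fun z hz => hz.1
    have h2 := hC p ψ hψ
    rw [hv, norm_zero, mul_zero] at h2
    have h3 : 0 < (‖Λ (K + 2 + 1)‖ / 2) ^ p := by positivity
    exact hψ0 (norm_le_zero_iff.mp (by nlinarith))
  have hvs : star ((M ^ p) ψ) = (M ^ p) ψ := by rw [← h.iter_star, hs]
  obtain ⟨r, hrr, hlt, v, hv, hv0', hvs', hvc'⟩ := h.exists_level hδK hvs hvc hr fun hd =>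
    hv0 (eq_zero_of_mem_specSup_of_mem_decay hr (fun z hz => hz.1) hvS hd)
  obtain ⟨_, -, -, hK⟩ := h.exists_compact_pow 0
  have hle : r ≤ ‖Λ (K + 2)‖ := le_of_forall_gt_imp_ge_of_dense fun R hR =>
    (hlt R ((norm_enum_pos hΛ (by omega)).trans hR) (specSup_le_decay hK
      (fun z hz => ⟨hr.trans_le hz.1, hz.2.trans_lt hR⟩) hvS)).le
  exact h.notMem_cone hδ hN2 hΛ (hr.trans_le hrr) hle hv (exists_re_ne_zero hvs' hv0') hvc'

theorem combo_ne_zero {a c : ℝ} (hac : a ≠ c) (hψ0 : ψ ≠ 0) (hφ0 : φ ≠ 0)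
    (hψ : M ψ = (a : ℂ) • ψ) (hφ : M φ = (c : ℂ) • φ) {x y : ℂ} (hxy : x ≠ 0 ∨ y ≠ 0) :
    x • ψ - y • φ ≠ 0 := by
  intro h
  have h1 : x • ψ = y • φ := sub_eq_zero.mp h
  have h2 : (a : ℂ) • (x • ψ) = (c : ℂ) • (x • ψ) := by
    have h3 := congrArg M h1
    rw [map_smul, map_smul, hψ, hφ, smul_comm x, smul_comm y, ← h1] at h3
    exact h3
  have h4 : x • ψ = 0 := by
    by_contra hne
    exact hac (Complex.ofReal_injective (smul_left_injective ℂ hne h2))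
  have hx := (smul_eq_zero_iff_left hψ0).mp h4
  rw [h4] at h1
  have hy := (smul_eq_zero_iff_left hφ0).mp h1.symm
  tauto

theorem wronskian_ne_zero (h : Floq b E γ Q δ c₀ M) (hδ : δ = (-1) ^ N) (hN : 1 ≤ N)
    (hΛ : IsOrderedEnum M Λ) {a c : ℝ} (hac : a ≠ c) (hψ0 : ψ ≠ 0) (hφ0 : φ ≠ 0)
    (hψ : M ψ = (a : ℂ) • ψ) (hφ : M φ = (c : ℂ) • φ) (hψs : star ψ = ψ) (hφs : star φ = φ)
    (ha : Λ N = a) (hc : Λ (N + 1) = c) (hf : DelaySol b f) (hg : DelaySol b g)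
    (hfψ : ∀ θ : I01, (ψ θ).re = E θ * f θ) (hgφ : ∀ θ : I01, (φ θ).re = E θ * g θ) {t : ℝ}
    (ht : 2 ≤ t) : f t * g (t - 1) - g t * f (t - 1) ≠ 0 := by
  intro hw
  have hanti := hΛ.1 N hN
  have hψS : ψ ∈ specSup M.toLinearMap {μ | ‖Λ (N + 1)‖ ≤ ‖μ‖ ∧ ‖μ‖ ≤ ‖Λ N‖} :=
    mem_specSup_of_eigen (f := M.toLinearMap)
      (S := {μ | ‖Λ (N + 1)‖ ≤ ‖μ‖ ∧ ‖μ‖ ≤ ‖Λ N‖}) (μ := (a : ℂ))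
      (by rw [← ha]; exact ⟨hanti, le_rfl⟩) hψ
  have hφS : φ ∈ specSup M.toLinearMap {μ | ‖Λ (N + 1)‖ ≤ ‖μ‖ ∧ ‖μ‖ ≤ ‖Λ N‖} :=
    mem_specSup_of_eigen (f := M.toLinearMap)
      (S := {μ | ‖Λ (N + 1)‖ ≤ ‖μ‖ ∧ ‖μ‖ ≤ ‖Λ N‖}) (μ := (c : ℂ))
      (by rw [← hc]; exact ⟨le_rfl, hanti⟩) hφ
  have key : ∀ x y : ℝ, (x ≠ 0 ∨ y ≠ 0) → x * f t - y * g t = 0 →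
      x * f (t - 1) - y * g (t - 1) = 0 → False := by
    intro x y hxy h1 h2
    refine h.not_consecutive_zeros hδ hN hΛ (Submodule.sub_mem _ (Submodule.smul_mem _ (x : ℂ) hψS)
      (Submodule.smul_mem _ (y : ℂ) hφS)) (combo_ne_zero hac hψ0 hφ0 hψ hφ ?_) ?_
      ((hf.smul x).sub h.fb.int (hg.smul y)) (fun θ => ?_) ht h1 h2
    · simpa using hxy
    · rw [star_sub, star_smul, star_smul, hψs, hφs, RCLike.star_def,
        Complex.conj_ofReal, Complex.conj_ofReal]
    · rw [ContinuousMap.sub_apply, ContinuousMap.smul_apply, ContinuousMap.smul_apply,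
        Complex.sub_re, smul_eq_mul, smul_eq_mul, Complex.re_ofReal_mul, Complex.re_ofReal_mul,
        hfψ, hgφ]
      ring
  by_cases h1 : g t = 0 ∧ f t = 0
  · by_cases h2 : g (t - 1) = 0 ∧ f (t - 1) = 0
    · exact key 1 0 (Or.inl one_ne_zero) (by rw [h1.2]; ring) (by rw [h2.2]; ring)
    · exact key (g (t - 1)) (f (t - 1)) (by tauto) (by rw [h1.1, h1.2]; ring) (by ring)
  · exact key (g t) (f t) (by tauto) (by ring) (by linarith)

theorem real_mul_pos (h : Floq b E γ Q δ c₀ M) (hδ : δ = (-1) ^ N) (hN : 1 ≤ N)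
    (hΛ : IsOrderedEnum M Λ) {a c : ℝ} (ha : Λ N = a) (hc : Λ (N + 1) = c) : 0 < a * c := by
  have hma := hΛ.2.1 N hN
  have hmc := hΛ.2.1 (N + 1) (by omega)
  rw [ha] at hma
  rw [hc] at hmc
  have ha0 : a ≠ 0 := by exact_mod_cast hma.1
  have hc0 : c ≠ 0 := by exact_mod_cast hmc.1
  by_contra! hle
  have hneg : a * c < 0 := lt_of_le_of_ne hle (mul_ne_zero ha0 hc0)
  have hac : a ≠ c := by
    rintro rfl
    nlinarith [mul_self_pos.mpr ha0]
  obtain ⟨ψ, hψ0, hψs, hψ⟩ := h.exists_real_eigenvector hma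
  obtain ⟨φ, hφ0, hφs, hφ⟩ := h.exists_real_eigenvector hmc
  obtain ⟨f, hf, hfψ⟩ := h.exists_rep ψ
  obtain ⟨g, hg, hgφ⟩ := h.exists_rep φ
  have hw := fun t ht => h.wronskian_ne_zero hδ hN hΛ hac hψ0 hφ0 hψ hφ hψs hφs ha hc hf hg hfψ hgφ
    (t := t) ht
  set w : ℝ → ℝ := fun t => f t * g (t - 1) - g t * f (t - 1) with hwdef
  have hwc : Continuous w := by
    have := hf.cont
    have := hg.cont
    fun_prop
  have hγ := h.γpos
  have hEγ := h.Epos γ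
  have hstep : w (2 + γ) = a * c / (E γ * E γ) * w 2 := by
    have e1 := h.rep_eigen hf hfψ hψ (t := 2) (by norm_num)
    have e2 := h.rep_eigen hf hfψ hψ (t := 2 - 1) (by norm_num)
    have e3 := h.rep_eigen hg hgφ hφ (t := 2) (by norm_num)
    have e4 := h.rep_eigen hg hgφ hφ (t := 2 - 1) (by norm_num)
    simp only [hwdef]
    rw [show (2 : ℝ) + γ - 1 = 2 - 1 + γ by ring, e1, e2, e3, e4]
    field_simp
  have hk : a * c / (E γ * E γ) < 0 := div_neg_of_neg_of_pos hneg (by positivity)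
  have h0 : (0 : ℝ) ∈ Set.uIcc (w 2) (w (2 + γ)) := by
    rw [Set.mem_uIcc, hstep]
    rcases le_total (w 2) 0 with h1 | h1
    · exact Or.inl ⟨h1, by nlinarith⟩
    · exact Or.inr ⟨by nlinarith, h1⟩
  obtain ⟨t, ht, ht0⟩ := intermediate_value_uIcc hwc.continuousOn h0
  rw [Set.uIcc_of_le (by linarith)] at ht
  exact hw t ht.1 ht0

theorem enum_mul_pos (h : Floq b E γ Q δ c₀ M) (hδ : δ = (-1) ^ N) (hN : 1 ≤ N)
    (hΛ : IsOrderedEnum M Λ) : ∃ r : ℝ, 0 < r ∧ Λ N * Λ (N + 1) = r := by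
  have hlt := h.norm_enum_lt hδ hΛ
  have hanti := hΛ.1 N hN
  have hgt : 2 ≤ N → ‖Λ N‖ < ‖Λ (N - 1)‖ := fun hN2 => by
    obtain ⟨K, rfl⟩ : ∃ K, N = K + 2 := ⟨N - 2, by omega⟩
    exact h.norm_enum_lt (N := K) (by rw [hδ, pow_add]; norm_num) hΛ
  have hpos : 0 < ‖Λ N‖ := norm_enum_pos hΛ hN
  have hpos' : 0 < ‖Λ (N + 1)‖ := norm_enum_pos hΛ (by omega)
  have hcase : ∀ i, i = N ∨ i = N + 1 → ∃ j, (j = N ∨ j = N + 1) ∧ Λ j = star (Λ i) := by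
    intro i hi
    have hi1 : 1 ≤ i := by omega
    obtain ⟨j, hj, hji⟩ := h.exists_enum_eq hΛ (h.isFloquetMult_star (hΛ.2.1 i hi1))
    have hn : ‖Λ j‖ = ‖Λ i‖ := by rw [hji, norm_star]
    have hiN : ‖Λ i‖ ≤ ‖Λ N‖ := norm_antitone_enum hΛ hN (by omega)
    have hiN' : ‖Λ (N + 1)‖ ≤ ‖Λ i‖ := norm_antitone_enum hΛ hi1 (by omega)
    refine ⟨j, ?_, hji⟩
    by_contra! hc
    rcases Nat.lt_or_ge j N with h1 | h1
    · have h2 := hgt (by omega)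
      have h3 := norm_antitone_enum hΛ (j := j) (k := N - 1) hj (by omega)
      linarith
    · have h3 := norm_antitone_enum hΛ (j := N + 2) (k := j) (by omega) (by omega)
      linarith
  obtain ⟨j, hj, hjN⟩ := hcase N (Or.inl rfl)
  rcases hj with rfl | rfl
  · obtain ⟨i, hi, hiN⟩ := hcase (j + 1) (Or.inr rfl)
    rcases hi with rfl | rfl
    · refine ⟨‖Λ (i + 1)‖ ^ 2, by positivity, ?_⟩
      rw [hiN, RCLike.star_def, mul_comm, Complex.mul_conj, Complex.normSq_eq_norm_sq]
    · have h1 := Complex.conj_eq_iff_re.mp hjN.symm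
      have h2 := Complex.conj_eq_iff_re.mp hiN.symm
      refine ⟨_, h.real_mul_pos hδ hN hΛ h1.symm h2.symm, ?_⟩
      rw [Complex.ofReal_mul, h1, h2]
  · refine ⟨‖Λ N‖ ^ 2, by positivity, ?_⟩
    rw [hjN, RCLike.star_def, Complex.mul_conj, Complex.normSq_eq_norm_sq]

theorem enum_one_pos (h : Floq b E γ Q 1 c₀ M) (hΛ : IsOrderedEnum M Λ) :
    ∃ r : ℝ, 0 < r ∧ Λ 1 = r := by
  have hlt : ‖Λ 2‖ < ‖Λ 1‖ := h.norm_enum_lt (N := 0) (by norm_num) hΛ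
  have hm := hΛ.2.1 1 le_rfl
  obtain ⟨j, hj, hj1⟩ := h.exists_enum_eq hΛ (h.isFloquetMult_star hm)
  have hj' : j = 1 := by
    by_contra hne
    have h1 := norm_antitone_enum hΛ (j := 2) (k := j) (by omega) (by omega)
    rw [hj1, norm_star] at h1
    linarith
  subst hj'
  have hre := Complex.conj_eq_iff_re.mp hj1.symm
  set a := (Λ 1).re with ha
  rw [← hre] at hm
  have ha0 : a ≠ 0 := by exact_mod_cast hm.1
  refine ⟨a, ?_, hre.symm⟩
  by_contra! hle
  have hneg : a < 0 := lt_of_le_of_ne hle ha0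
  obtain ⟨ψ, hψ0, hψs, hψ⟩ := h.exists_real_eigenvector hm
  obtain ⟨f, hf, hfψ⟩ := h.exists_rep ψ
  have hcone : ψ ∈ cone 0 := h.enum_subset_cone (by norm_num) hΛ ψ
    (mem_specSup_of_eigen (μ := (a : ℂ)) (by
      rw [Set.mem_ofPred_eq, hre]) hψ)
  have key : ∀ g : ℝ → ℝ, DelaySol b g → (∀ t ∈ I01, g (t + γ) = a / E γ * g t) →
      (∀ t ∈ I01, 0 ≤ g t) → ∀ t ∈ I01, g t = 0 := by
    intro g hg hper hnn t ht
    obtain ⟨n, hn⟩ := exists_nat_ge (t + γ)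
    have h1 := h.fb.nonneg_forward hg hnn n (t + γ) ⟨by linarith [ht.1, h.γpos], hn⟩
    rw [hper t ht] at h1
    have h2 : a / E γ < 0 := div_neg_of_neg_of_pos hneg (h.Epos γ)
    have h3 := hnn t ht
    nlinarith
  have hper : ∀ t ∈ I01, f (t + γ) = a / E γ * f t := fun t ht => h.rep_eigen hf hfψ hψ ht.1
  refine hψ0 (eq_zero_of_rep hψs hfψ ?_)
  have hsgn := nonneg_or_nonpos_of_not_alt (f := f) (t := 0) fun hA =>
    hcone ((h.alt_rep_iff hfψ).mpr hA)
  rw [zero_sub] at hsgn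
  rcases hsgn with hs | hs
  · exact key f hf hper hs
  · intro t ht
    have := key _ (hf.smul (-1)) (fun t ht => by rw [hper t ht]; ring)
      (fun t ht => by linarith [hs t ht]) t ht
    linarith

end Floq


theorem statement4 (α β : ℝ → ℝ)
    (hα : LocallyIntegrable α volume) (hβ : LocallyIntegrable β volume)
    (γ : ℝ) (hγ : 0 < γ)
    (hαper : ∀ᵐ t ∂volume, α (t + γ) = α t) (hβper : ∀ᵐ t ∂volume, β (t + γ) = β t)
    (m : ℤ) (β₀ : ℝ) (hβ₀ : 0 < (-1 : ℝ) ^ m * β₀)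
    (hsign : ∀ᵐ t ∂volume, (-1 : ℝ) ^ m * β₀ ≤ (-1 : ℝ) ^ m * β t)
    (M : CC →L[ℂ] CC) (hM : IsMonodromy α β γ M) :
    ({μ : ℂ | IsFloquetMult M μ}.Countable ∧ {μ : ℂ | IsFloquetMult M μ}.Infinite) ∧
    ∀ Λ : ℕ → ℂ, IsOrderedEnum M Λ →
      (∀ k : ℕ, 1 ≤ k → Even ((k : ℤ) - m) →
        ‖Λ (k + 1)‖ < ‖Λ k‖) ∧
      (∀ k : ℕ, 2 ≤ k → Even ((k : ℤ) - m) →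
        (∃ r : ℝ, 0 < r ∧ Λ (k - 1) * Λ k = (r : ℂ)) ∧
        (∀ ψ ∈ GabsSpan M ‖Λ (k - 1)‖, (fun θ : I01 => (ψ θ).re) ≠ 0 →
          Vpm (if Even m then 1 else 0) (fun θ : I01 => (ψ θ).re) = ((k - 1 : ℕ) : ℕ∞)) ∧
        (∀ ψ ∈ GabsSpan M ‖Λ k‖, (fun θ : I01 => (ψ θ).re) ≠ 0 →
          Vpm (if Even m then 1 else 0) (fun θ : I01 => (ψ θ).re) = ((k - 1 : ℕ) : ℕ∞))) ∧
      (Odd m →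
        (∃ r : ℝ, 0 < r ∧ Λ 1 = (r : ℂ)) ∧
        ∀ ψ ∈ GabsSpan M ‖Λ 1‖, (fun θ : I01 => (ψ θ).re) ≠ 0 →
          Vpm 0 (fun θ : I01 => (ψ θ).re) = 0) := by
  have hsq : (-(-1 : ℝ) ^ m) * -(-1 : ℝ) ^ m = 1 := by
    rcases m.even_or_odd with hm | hm <;> simp [hm.neg_one_zpow]
  obtain ⟨b, E, Q, c₀, h⟩ := hM.exists_floq hα hβ hγ hαper hβper hsq (by rwa [neg_neg])
    (by simpa only [neg_neg] using hsign)
  have hδ : ∀ N : ℕ, Even (((N + 1 : ℕ) : ℤ) - m) → -(-1 : ℝ) ^ m = (-1) ^ N := fun N hN => by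
    rcases m.even_or_odd with hm | hm
    · have hN' : Odd N := by
        rw [Int.even_sub, iff_true_right hm, Int.even_coe_nat] at hN
        exact Nat.not_even_iff_odd.mp (Nat.even_add_one.mp hN)
      rw [hm.neg_one_zpow, hN'.neg_one_pow]
    · have hN' : Even N := by
        rw [Int.even_sub, iff_false_right (Int.not_even_iff_odd.mpr hm), Int.even_coe_nat,
          Nat.even_add_one, not_not] at hN
        exact hN
      rw [hm.neg_one_zpow, hN'.neg_one_pow, neg_neg]
  have hpar : ∀ N : ℕ, Even (((N + 1 : ℕ) : ℤ) - m) → (if Even m then 1 else 0) = N % 2 :=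
    fun N hN => by
      rw [Int.even_sub, Int.even_coe_nat, Nat.even_add_one] at hN
      split_ifs with hm
      · exact (Nat.not_even_iff.mp (hN.mpr hm)).symm
      · exact (Nat.even_iff.mp (not_not.mp (mt hN.mp hm))).symm
  refine ⟨⟨h.countable_floquetMult, h.infinite_floquetMult⟩, fun Λ hΛ =>
    ⟨fun k hk hkm => ?_, fun k hk hkm => ?_, fun hm => ?_⟩⟩
  · obtain ⟨N, rfl⟩ : ∃ N, k = N + 1 := ⟨k - 1, by omega⟩
    exact h.norm_enum_lt (hδ N hkm) hΛ
  · obtain ⟨N, rfl⟩ : ∃ N, k = N + 1 := ⟨k - 1, by omega⟩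
    rw [Nat.add_sub_cancel, hpar N hkm]
    have hanti := hΛ.1 N (by omega)
    exact ⟨h.enum_mul_pos (hδ N hkm) (by omega) hΛ,
      fun ψ hψ h0 => h.vpm_enum (hδ N hkm) hΛ hanti (fun _ => le_rfl) hψ h0,
      fun ψ hψ h0 => h.vpm_enum (hδ N hkm) hΛ le_rfl (fun _ => hanti) hψ h0⟩
  · rw [hm.neg_one_zpow, neg_neg] at h
    exact ⟨h.enum_one_pos hΛ, fun ψ hψ h0 =>
      h.vpm_enum (N := 0) (pow_zero _).symm hΛ le_rfl (fun h => absurd h (by norm_num)) hψ h0⟩
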